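/- arXiv:1301.6047 — 4 statements merged into one kernel-verified Lean document; each statement's English description precedes it below -/
import Mathlib

section
/- Let l > 0 and let u be a bounded harmonic function on the punctured unit cone of length l. Then there exist real sequences (a_k)_{k≥0} and (b_k)_{k≥0} such that for every r ∈ (0,1) and θ ∈ ℝ, u(r,θ) = Σ_{k=0}^∞ r^{2πk/l} ( a_k cos(2πkθ/l) + b_k sin(2πkθ/l) ), the series converging absolutely. -/
open MeasureTheory Set

noncomputable section

/-- A bounded `C²` function on the punctured unit cone of length `l`, in polar
coordinates `(r, θ) ∈ (0,1) × ℝ`, which is `l`-periodic in `θ` and satisfies the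
Laplace equation in polar coordinates. -/
structure HarmonicCone (l : ℝ) (u : ℝ → ℝ → ℝ) : Prop where
  smooth : ContDiffOn ℝ 2 (fun p : ℝ × ℝ => u p.1 p.2)
    (Set.Ioo (0:ℝ) 1 ×ˢ (Set.univ : Set ℝ))
  periodic : ∀ r θ : ℝ, u r (θ + l) = u r θ
  laplace : ∀ r ∈ Set.Ioo (0:ℝ) 1, ∀ θ : ℝ,
    deriv (fun s => deriv (fun s' => u s' θ) s) r
      + (1 / r) * deriv (fun s => u s θ) r
      + (1 / r ^ 2) * deriv (fun φ => deriv (fun φ' => u r φ') φ) θ = 0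


lemma cone_partials (n : ℕ) (G : ℝ × ℝ → ℝ)
    (hG : ContDiffOn ℝ (n + 1 : ℕ) G (Ioo (0:ℝ) 1 ×ˢ (univ : Set ℝ))) :
    ∃ G1 G2 : ℝ × ℝ → ℝ,
      ContDiffOn ℝ n G1 (Ioo (0:ℝ) 1 ×ˢ (univ : Set ℝ)) ∧
      ContDiffOn ℝ n G2 (Ioo (0:ℝ) 1 ×ˢ (univ : Set ℝ)) ∧
      (∀ r ∈ Ioo (0:ℝ) 1, ∀ θ : ℝ, HasDerivAt (fun s => G (s, θ)) (G1 (r, θ)) r) ∧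
      (∀ r ∈ Ioo (0:ℝ) 1, ∀ θ : ℝ, HasDerivAt (fun φ => G (r, φ)) (G2 (r, θ)) θ) := by
  have hS : IsOpen (Ioo (0:ℝ) 1 ×ˢ (univ : Set ℝ)) := isOpen_Ioo.prod isOpen_univ
  have hd : ContDiffOn ℝ n (fderiv ℝ G) (Ioo (0:ℝ) 1 ×ˢ (univ : Set ℝ)) :=
    hG.fderiv_of_isOpen hS (by push_cast; exact le_rfl)
  have hdiff : ∀ r ∈ Ioo (0:ℝ) 1, ∀ θ : ℝ, HasFDerivAt G (fderiv ℝ G (r, θ)) (r, θ) := by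
    intro r hr θ
    have : ContDiffAt ℝ (n + 1 : ℕ) G (r, θ) :=
      hG.contDiffAt (hS.mem_nhds ⟨hr, mem_univ _⟩)
    exact (this.differentiableAt (by norm_cast)).hasFDerivAt
  refine ⟨fun p => fderiv ℝ G p (1, 0), fun p => fderiv ℝ G p (0, 1),
    hd.clm_apply contDiffOn_const, hd.clm_apply contDiffOn_const, ?_, ?_⟩
  · intro r hr θ
    exact (hdiff r hr θ).comp_hasDerivAt r ((hasDerivAt_id r).prodMk (hasDerivAt_const r θ))
  · intro r hr θ
    exact (hdiff r hr θ).comp_hasDerivAt θ ((hasDerivAt_const θ r).prodMk (hasDerivAt_id θ))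

lemma cone_slice (G : ℝ × ℝ → ℝ) (hG : ContinuousOn G (Ioo (0:ℝ) 1 ×ˢ (univ : Set ℝ)))
    (r : ℝ) (hr : r ∈ Ioo (0:ℝ) 1) : Continuous (fun θ => G (r, θ)) := by
  rw [← continuousOn_univ]
  exact hG.comp (by fun_prop) (fun θ _ => ⟨hr, mem_univ _⟩)

lemma cone_integral_deriv (l : ℝ) (G G1 : ℝ × ℝ → ℝ) (w : ℝ → ℂ) (hw : Continuous w)
    (hG : ContinuousOn G (Ioo (0:ℝ) 1 ×ˢ (univ : Set ℝ)))
    (hG1 : ContinuousOn G1 (Ioo (0:ℝ) 1 ×ˢ (univ : Set ℝ)))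
    (hd : ∀ r ∈ Ioo (0:ℝ) 1, ∀ θ : ℝ, HasDerivAt (fun s => G (s, θ)) (G1 (r, θ)) r)
    (r : ℝ) (hr : r ∈ Ioo (0:ℝ) 1) :
    HasDerivAt (fun s => ∫ θ in (0:ℝ)..l, w θ * (G (s, θ) : ℂ))
      (∫ θ in (0:ℝ)..l, w θ * (G1 (r, θ) : ℂ)) r := by
  have hcont : ∀ s ∈ Ioo (0:ℝ) 1, Continuous (fun θ => w θ * (G (s, θ) : ℂ)) := fun s hs =>
    hw.mul (Complex.continuous_ofReal.comp (cone_slice G hG s hs))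
  have hcont1 : ∀ s ∈ Ioo (0:ℝ) 1, Continuous (fun θ => w θ * (G1 (s, θ) : ℂ)) := fun s hs =>
    hw.mul (Complex.continuous_ofReal.comp (cone_slice G1 hG1 s hs))
  have hsub : Icc (r/2) ((r+1)/2) ⊆ Ioo (0:ℝ) 1 := fun x hx =>
    ⟨by linarith [hx.1, hr.1], by linarith [hx.2, hr.2]⟩
  have hK : IsCompact (Icc (r/2) ((r+1)/2) ×ˢ uIcc (0:ℝ) l) := isCompact_Icc.prod isCompact_uIcc
  have hc : ContinuousOn (fun p : ℝ × ℝ => w p.2 * (G1 p : ℂ))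
      (Icc (r/2) ((r+1)/2) ×ˢ uIcc (0:ℝ) l) := by
    refine (hw.comp continuous_snd).continuousOn.mul ?_
    exact Complex.continuous_ofReal.comp_continuousOn
      (hG1.mono (prod_mono hsub (subset_univ _)))
  obtain ⟨C, hC⟩ := hK.exists_bound_of_continuousOn hc
  refine (intervalIntegral.hasDerivAt_integral_of_dominated_loc_of_deriv_le
    (F := fun s θ => w θ * (G (s, θ) : ℂ)) (F' := fun s θ => w θ * (G1 (s, θ) : ℂ))
    (bound := fun _ => C) (s := Icc (r/2) ((r+1)/2))
    (Icc_mem_nhds (by linarith [hr.1]) (by linarith [hr.2])) ?_ ?_ ?_ ?_ ?_ ?_).2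
  · filter_upwards [Ioo_mem_nhds hr.1 hr.2] with s hs
    exact (hcont s hs).aestronglyMeasurable
  · exact (hcont r hr).intervalIntegrable _ _
  · exact (hcont1 r hr).aestronglyMeasurable
  · exact ae_of_all _ fun θ hθ s hs => hC (s, θ) ⟨hs, uIoc_subset_uIcc hθ⟩
  · exact intervalIntegrable_const
  · exact ae_of_all _ fun θ hθ s hs => ((hd s (hsub hs) θ).ofReal_comp).const_mul (w θ)

lemma cone_const (f : ℝ → ℂ) (h : ∀ r ∈ Ioo (0:ℝ) 1, HasDerivAt f 0 r) :
    ∃ K, ∀ r ∈ Ioo (0:ℝ) 1, f r = K :=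
  isOpen_Ioo.exists_is_const_of_deriv_eq_zero isPreconnected_Ioo
    (fun r hr => (h r hr).differentiableAt.differentiableWithinAt) (fun r hr => (h r hr).deriv)

/-- If `K * g` is bounded near `0` with `g → ∞`, then `K = 0`. -/
lemma cone_zero (K : ℂ) (g : ℝ → ℝ) (C : ℝ)
    (hg : Filter.Tendsto g (nhdsWithin 0 (Ioi 0)) Filter.atTop)
    (hb : ∀ r ∈ Ioo (0:ℝ) 1, ‖K‖ * g r ≤ C) : K = 0 := by
  by_contra hK
  have hK' : 0 < ‖K‖ := norm_pos_iff.mpr hK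
  have h1 : ∀ᶠ r in nhdsWithin (0:ℝ) (Ioi 0), C / ‖K‖ < g r := hg.eventually_gt_atTop _
  have h2 : ∀ᶠ r in nhdsWithin (0:ℝ) (Ioi 0), r ∈ Ioo (0:ℝ) 1 :=
    Ioo_mem_nhdsGT one_pos
  obtain ⟨r, hr1, hr2⟩ := (h1.and h2).exists
  have := hb r hr2
  rw [div_lt_iff₀ hK'] at hr1
  linarith [mul_comm (g r) ‖K‖]

lemma cone_ode (m : ℝ) (hm : 0 ≤ m) (c c1 c2 : ℝ → ℂ) (M : ℝ)
    (h1 : ∀ r ∈ Ioo (0:ℝ) 1, HasDerivAt c (c1 r) r)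
    (h2 : ∀ r ∈ Ioo (0:ℝ) 1, HasDerivAt c1 (c2 r) r)
    (h : ∀ r ∈ Ioo (0:ℝ) 1, (r:ℂ)^2 * c2 r + r * c1 r = m^2 * c r)
    (hM : ∀ r ∈ Ioo (0:ℝ) 1, ‖c r‖ ≤ M) :
    ∃ A : ℂ, ‖A‖ ≤ M ∧ ∀ r ∈ Ioo (0:ℝ) 1, c r = A * ((r ^ m : ℝ) : ℂ) := by
  -- first integrals
  have first : ∀ μ : ℝ, μ^2 = m^2 → ∃ K : ℂ, ∀ r ∈ Ioo (0:ℝ) 1,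
      r * c1 r - μ * c r = K * ((r ^ (-μ) : ℝ) : ℂ) := by
    intro μ hμ
    obtain ⟨K, hK⟩ := cone_const
      (fun r => ((r ^ μ : ℝ) : ℂ) * ((r:ℂ) * c1 r - μ * c r)) (by
      intro r hr
      have hr0 : (r:ℂ) ≠ 0 := by exact_mod_cast hr.1.ne'
      have e1 := (Real.hasDerivAt_rpow_const (p := μ) (Or.inl hr.1.ne')).ofReal_comp
      have e2 := ((hasDerivAt_id r).ofReal_comp.mul (h2 r hr)).sub ((h1 r hr).const_mul (μ:ℂ))
      have e := e1.mul e2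
      refine e.congr_deriv ?_
      have e3 : r ^ μ = r ^ (μ - 1) * r := by
        rw [Real.rpow_sub_one hr.1.ne']; field_simp [hr.1.ne']
      have hμ' : (μ:ℂ)^2 = (m:ℂ)^2 := by exact_mod_cast hμ
      rw [e3]
      simp only [id, Pi.mul_apply, Pi.sub_apply]
      push_cast
      linear_combination ((r ^ (μ - 1) : ℝ) : ℂ) * h r hr - ((r ^ (μ - 1) : ℝ) : ℂ) * c r * hμ')
    refine ⟨K, fun r hr => ?_⟩
    have : ((r ^ (-μ) : ℝ) : ℂ) * ((r ^ μ : ℝ) : ℂ) = 1 := by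
      rw [← Complex.ofReal_mul, ← Real.rpow_add hr.1]; simp
    rw [← hK r hr]
    linear_combination (-(r * c1 r - μ * c r)) * this
  have key : ∃ A : ℂ, ∀ r ∈ Ioo (0:ℝ) 1, c r = A * ((r ^ m : ℝ) : ℂ) := by
    rcases hm.eq_or_lt with hm0 | hm0
    · subst hm0
      obtain ⟨K, hK⟩ := first 0 (by simp)
      simp only [Complex.ofReal_zero, zero_mul, sub_zero, neg_zero, Real.rpow_zero,
        Complex.ofReal_one, mul_one] at hK
      obtain ⟨A, hA⟩ := cone_const (fun r => c r - K * (Real.log r : ℂ)) (by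
        intro r hr
        have hr0 : (r:ℂ) ≠ 0 := by exact_mod_cast hr.1.ne'
        refine ((h1 r hr).sub
          ((Real.hasDerivAt_log hr.1.ne').ofReal_comp.const_mul K)).congr_deriv ?_
        rw [← hK r hr]; push_cast; field_simp; ring)
      have hK0 : K = 0 := by
        refine cone_zero K (fun r => - Real.log r) (M + ‖A‖)
          (Filter.tendsto_neg_atBot_atTop.comp Real.tendsto_log_nhdsGT_zero) ?_
        intro r hr
        have hlog : Real.log r ≤ 0 := (Real.log_neg hr.1 hr.2).le
        have : ‖K‖ * (- Real.log r) = ‖c r - A‖ := by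
          rw [← hA r hr, sub_sub_cancel, norm_mul, Complex.norm_real, Real.norm_eq_abs,
            abs_of_nonpos hlog]
        rw [this]
        exact (norm_sub_le _ _).trans (by linarith [hM r hr])
      refine ⟨A, fun r hr => ?_⟩
      have := hA r hr
      simp [hK0] at this
      simp [this]
    · obtain ⟨K, hK⟩ := first m rfl
      obtain ⟨L, hL⟩ := first (-m) (by ring)
      have hmC : (m:ℂ) ≠ 0 := by exact_mod_cast hm0.ne'
      have hc : ∀ r ∈ Ioo (0:ℝ) 1,
          2 * m * c r = L * ((r ^ m : ℝ) : ℂ) - K * ((r ^ (-m) : ℝ) : ℂ) := by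
        intro r hr
        have a1 := hK r hr
        have a2 := hL r hr
        rw [neg_neg] at a2
        push_cast at a2
        linear_combination a2 - a1
      have hK0 : K = 0 := by
        refine cone_zero K (fun r => r ^ (-m)) (‖L‖ + 2 * m * M)
          (tendsto_rpow_neg_nhdsGT_zero (by linarith)) ?_
        intro r hr
        have : ‖K‖ * r ^ (-m) = ‖L * ((r ^ m : ℝ) : ℂ) - 2 * m * c r‖ := by
          rw [hc r hr, sub_sub_cancel, norm_mul, Complex.norm_real, Real.norm_eq_abs,
            abs_of_pos (Real.rpow_pos_of_pos hr.1 _)]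
        rw [this]
        refine (norm_sub_le _ _).trans ?_
        gcongr
        · rw [norm_mul, Complex.norm_real, Real.norm_eq_abs,
            abs_of_pos (Real.rpow_pos_of_pos hr.1 _)]
          exact mul_le_of_le_one_right (norm_nonneg _) (Real.rpow_le_one hr.1.le hr.2.le hm)
        · rw [norm_mul, norm_mul, Complex.norm_real, Real.norm_eq_abs, abs_of_pos hm0]
          simp only [Complex.norm_ofNat]
          have := hM r hr
          gcongr
      refine ⟨L / (2 * m), fun r hr => ?_⟩
      have := hc r hr
      rw [hK0, zero_mul, sub_zero] at this
      field_simp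
      linear_combination this
  obtain ⟨A, hA⟩ := key
  refine ⟨A, ?_, hA⟩
  have ht : Filter.Tendsto (fun r : ℝ => ‖A‖ * r ^ m) (nhdsWithin 1 (Iio 1)) (nhds (‖A‖ * 1 ^ m)) := by
    refine Filter.Tendsto.mono_left ?_ nhdsWithin_le_nhds
    exact ((Real.continuousAt_rpow_const 1 m (Or.inl one_ne_zero)).tendsto).const_mul _
  rw [Real.one_rpow, mul_one] at ht
  refine le_of_tendsto ht ?_
  filter_upwards [Ioo_mem_nhdsLT (zero_lt_one (α := ℝ))] with r hr
  have := hM r hr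
  rwa [hA r hr, norm_mul, Complex.norm_real, Real.norm_eq_abs,
    abs_of_pos (Real.rpow_pos_of_pos hr.1 _)] at this

lemma cone_coeff (l : ℝ) (hl : 0 < l) (u : ℝ → ℝ → ℝ)
    (hu : HarmonicCone l u) (M : ℝ)
    (hbound : ∀ r ∈ Set.Ioo (0:ℝ) 1, ∀ θ : ℝ, |u r θ| ≤ M) (n : ℤ) :
    ∃ A : ℂ, ‖A‖ ≤ M * l ∧ ∀ r ∈ Ioo (0:ℝ) 1,
      ∫ θ in (0:ℝ)..l, (fourier (-n) (θ : AddCircle l) : ℂ) * (u r θ : ℂ)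
        = A * ((r ^ (2 * Real.pi * (n.natAbs : ℝ) / l) : ℝ) : ℂ) := by
  set w : ℝ → ℂ := fun θ => (fourier (-n) (θ : AddCircle l) : ℂ) with hw
  set κ : ℂ := 2 * Real.pi * Complex.I * ((-n : ℤ) : ℂ) / l with hκ
  have hwd : ∀ θ, HasDerivAt w (κ * w θ) θ := fun θ => hasDerivAt_fourier l (-n) θ
  have hwc : Continuous w := continuous_iff_continuousAt.mpr fun θ => (hwd θ).continuousAt
  have hwl : w l = w 0 := by
    simp only [hw, AddCircle.coe_period, QuotientAddGroup.mk_zero]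
  have hwn : ∀ θ, ‖w θ‖ = 1 := fun θ => by
    simp only [hw, fourier_apply]
    exact Circle.norm_coe _
  set m : ℝ := 2 * Real.pi * (n.natAbs : ℝ) / l with hm
  have hm0 : 0 ≤ m := by positivity
  have hκm : κ ^ 2 = - (m:ℂ) ^ 2 := by
    have : ((n.natAbs : ℝ) : ℂ) ^ 2 = (n : ℂ) ^ 2 := by
      have h0 : (n.natAbs : ℤ) ^ 2 = n ^ 2 := Int.natAbs_sq n
      have h1 : (((n.natAbs : ℤ) : ℂ)) ^ 2 = (n : ℂ) ^ 2 := by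
        rw [← Int.cast_pow, h0, Int.cast_pow]
      rw [Int.cast_natCast] at h1
      rw [Complex.ofReal_natCast]
      exact h1
    rw [hκ, hm]
    push_cast at this ⊢
    linear_combination (4 * (Real.pi:ℂ)^2 * n^2 / l^2) * Complex.I_sq
      + (4 * (Real.pi:ℂ)^2 / l^2) * this
  obtain ⟨U1, U2, hU1, hU2, d1, d2⟩ := cone_partials 1 (fun p => u p.1 p.2) (by exact_mod_cast hu.smooth)
  obtain ⟨U11, -, hU11, -, d11, -⟩ := cone_partials 0 U1 (by exact_mod_cast hU1)
  obtain ⟨-, U22, -, hU22, -, d22⟩ := cone_partials 0 U2 (by exact_mod_cast hU2)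
  have cU := hu.smooth.continuousOn
  have cU1 := hU1.continuousOn
  have cU2 := hU2.continuousOn
  have cU11 := hU11.continuousOn
  have cU22 := hU22.continuousOn
  refine cone_ode m hm0 (fun r => ∫ θ in (0:ℝ)..l, w θ * (u r θ : ℂ))
    (fun r => ∫ θ in (0:ℝ)..l, w θ * (U1 (r, θ) : ℂ))
    (fun r => ∫ θ in (0:ℝ)..l, w θ * (U11 (r, θ) : ℂ)) (M * l)
    (fun r hr => cone_integral_deriv l (fun p => u p.1 p.2) U1 w hwc cU cU1 d1 r hr)
    (fun r hr => cone_integral_deriv l U1 U11 w hwc cU1 cU11 d11 r hr) ?_ ?_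
  · intro r hr
    have lap : ∀ θ, r^2 * U11 (r, θ) + r * U1 (r, θ) + U22 (r, θ) = 0 := by
      intro θ
      have h0 := hu.laplace r hr θ
      have e1 : deriv (fun s => u s θ) r = U1 (r, θ) := (d1 r hr θ).deriv
      have e2 : deriv (fun s => deriv (fun s' => u s' θ) s) r = U11 (r, θ) := by
        have : (fun s => deriv (fun s' => u s' θ) s) =ᶠ[nhds r] fun s => U1 (s, θ) := by
          filter_upwards [Ioo_mem_nhds hr.1 hr.2] with s hs
          exact (d1 s hs θ).deriv
        rw [this.deriv_eq]
        exact (d11 r hr θ).deriv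
      have e3 : deriv (fun φ => deriv (fun φ' => u r φ') φ) θ = U22 (r, θ) := by
        have : (fun φ => deriv (fun φ' => u r φ') φ) = fun φ => U2 (r, φ) := by
          funext φ
          exact (d2 r hr φ).deriv
        rw [this]
        exact (d22 r hr θ).deriv
      rw [e1, e2, e3] at h0
      have hr0 := hr.1.ne'
      field_simp at h0
      linear_combination h0
    have c0 : Continuous fun θ => (u r θ : ℂ) :=
      Complex.continuous_ofReal.comp (cone_slice _ cU r hr)
    have c1 : Continuous fun θ => (U1 (r, θ) : ℂ) :=
      Complex.continuous_ofReal.comp (cone_slice _ cU1 r hr)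
    have c11 : Continuous fun θ => (U11 (r, θ) : ℂ) :=
      Complex.continuous_ofReal.comp (cone_slice _ cU11 r hr)
    have c22 : Continuous fun θ => (U22 (r, θ) : ℂ) :=
      Complex.continuous_ofReal.comp (cone_slice _ cU22 r hr)
    have per2 : U2 (r, l) = U2 (r, 0) := by
      have a := (d2 r hr l).deriv
      have b := (d2 r hr 0).deriv
      have hshift : (fun φ => u r (φ + l)) = fun φ => u r φ := funext (hu.periodic r)
      have h3 := deriv_comp_add_const (fun φ => u r φ) l 0
      simp only [zero_add] at h3
      rw [← a, ← b]
      simp only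
      rw [← h3, hshift]
    have per0 : u r l = u r 0 := by simpa using hu.periodic r 0
    have ftc := intervalIntegral.integral_eq_sub_of_hasDerivAt (a := 0) (b := l)
      (f := fun θ => w θ * (U2 (r, θ) : ℂ) - (κ * w θ) * (u r θ : ℂ))
      (f' := fun θ => w θ * (U22 (r, θ) : ℂ) + (m:ℂ)^2 * (w θ * (u r θ : ℂ))) (by
        intro θ _
        have a := ((hwd θ).mul (d22 r hr θ).ofReal_comp).sub
          (((hwd θ).const_mul κ).mul (d2 r hr θ).ofReal_comp)
        refine a.congr_deriv ?_
        simp only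
        linear_combination (- w θ * (u r θ : ℂ)) * hκm)
      (((hwc.mul c22).add (continuous_const.mul (hwc.mul c0))).intervalIntegrable _ _)
    simp only [hwl, per2, per0, sub_self] at ftc
    have i0 : IntervalIntegrable (fun θ => (m:ℂ)^2 * (w θ * (u r θ : ℂ))) volume 0 l :=
      (continuous_const.mul (hwc.mul c0)).intervalIntegrable _ _
    have i1 : IntervalIntegrable (fun θ => (r:ℂ) * (w θ * (U1 (r, θ) : ℂ))) volume 0 l :=
      (continuous_const.mul (hwc.mul c1)).intervalIntegrable _ _
    have i11 : IntervalIntegrable (fun θ => (r:ℂ)^2 * (w θ * (U11 (r, θ) : ℂ))) volume 0 l :=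
      (continuous_const.mul (hwc.mul c11)).intervalIntegrable _ _
    have i22 : IntervalIntegrable (fun θ => w θ * (U22 (r, θ) : ℂ)) volume 0 l :=
      (hwc.mul c22).intervalIntegrable _ _
    have i3 : IntervalIntegrable (fun θ => (r:ℂ)^2 * (w θ * (U11 (r, θ) : ℂ))
        + (r:ℂ) * (w θ * (U1 (r, θ) : ℂ))) volume 0 l := i11.add i1
    rw [intervalIntegral.integral_add i22 i0, intervalIntegral.integral_const_mul] at ftc
    have e : (r:ℂ)^2 * (∫ θ in (0:ℝ)..l, w θ * (U11 (r, θ) : ℂ))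
        + r * (∫ θ in (0:ℝ)..l, w θ * (U1 (r, θ) : ℂ))
        + ∫ θ in (0:ℝ)..l, w θ * (U22 (r, θ) : ℂ) = 0 := by
      rw [← intervalIntegral.integral_const_mul, ← intervalIntegral.integral_const_mul,
        ← intervalIntegral.integral_add i11 i1, ← intervalIntegral.integral_add i3 i22]
      have : ∀ θ, (r:ℂ)^2 * (w θ * (U11 (r, θ) : ℂ)) + r * (w θ * (U1 (r, θ) : ℂ))
          + w θ * (U22 (r, θ) : ℂ) = 0 := by
        intro θ
        have h1 : (r:ℂ)^2 * (U11 (r, θ):ℂ) + r * (U1 (r, θ):ℂ) + (U22 (r, θ):ℂ) = 0 := by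
          exact_mod_cast congrArg (Complex.ofReal) (lap θ)
        linear_combination w θ * h1
      simp only [this, intervalIntegral.integral_zero]
    linear_combination e - ftc
  · intro r hr
    have := intervalIntegral.norm_integral_le_of_norm_le_const (a := 0) (b := l) (C := M)
      (f := fun θ => w θ * (u r θ : ℂ)) (by
        intro θ _
        rw [norm_mul, hwn, one_mul, Complex.norm_real]
        exact hbound r hr θ)
    rwa [sub_zero, abs_of_pos hl] at this

/-- Any bounded harmonic function on the punctured unit cone of length `l` admits
an absolutely convergent Fourier expansion
`u(r,θ) = Σ_k r^{2πk/l} (a_k cos(2πkθ/l) + b_k sin(2πkθ/l))`. -/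
theorem fourier_expansion_on_cone (l : ℝ) (hl : 0 < l) (u : ℝ → ℝ → ℝ)
    (hu : HarmonicCone l u) (M : ℝ)
    (hbound : ∀ r ∈ Set.Ioo (0:ℝ) 1, ∀ θ : ℝ, |u r θ| ≤ M) :
    ∃ a b : ℕ → ℝ, ∀ r ∈ Set.Ioo (0:ℝ) 1, ∀ θ : ℝ,
      Summable (fun k : ℕ =>
        |r ^ (2 * Real.pi * (k : ℝ) / l) *
          (a k * Real.cos (2 * Real.pi * (k : ℝ) * θ / l)
            + b k * Real.sin (2 * Real.pi * (k : ℝ) * θ / l))|) ∧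
      HasSum (fun k : ℕ =>
        r ^ (2 * Real.pi * (k : ℝ) / l) *
          (a k * Real.cos (2 * Real.pi * (k : ℝ) * θ / l)
            + b k * Real.sin (2 * Real.pi * (k : ℝ) * θ / l))) (u r θ) := by
  have : Fact (0 < l) := ⟨hl⟩
  choose A hAM hA using cone_coeff l hl u hu M hbound
  -- normalized coefficients
  set B : ℤ → ℂ := fun n => (1 / l : ℝ) • A n with hB
  have hBM : ∀ n, ‖B n‖ ≤ M := by
    intro n
    rw [hB]
    simp only
    rw [norm_smul, Real.norm_eq_abs, abs_of_pos (by positivity)]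
    have := hAM n
    rw [one_div, inv_mul_le_iff₀ hl]
    linarith
  refine ⟨fun k => (B k).re + if k = 0 then 0 else (B (-k)).re,
    fun k => (B (-k)).im - (B k).im, fun r hr θ => ?_⟩
  suffices hs : HasSum (fun k : ℕ =>
        r ^ (2 * Real.pi * (k : ℝ) / l) *
          (((B k).re + if k = 0 then 0 else (B (-k)).re) * Real.cos (2 * Real.pi * (k : ℝ) * θ / l)
            + ((B (-k)).im - (B k).im) * Real.sin (2 * Real.pi * (k : ℝ) * θ / l))) (u r θ) from
    ⟨hs.summable.abs, hs⟩
  -- the continuous function on the circle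
  have hper : Function.Periodic (fun φ => (u r φ : ℂ)) l := fun φ => by
    simp only [hu.periodic r φ]
  have hcu : Continuous (fun φ => (u r φ : ℂ)) :=
    Complex.continuous_ofReal.comp (cone_slice (fun p => u p.1 p.2) hu.smooth.continuousOn r hr)
  let f : C(AddCircle l, ℂ) := ⟨hper.lift, continuous_coinduced_dom.mpr hcu⟩
  have hf : ∀ φ : ℝ, f (φ : AddCircle l) = (u r φ : ℂ) := fun φ => rfl
  have hcoef : ∀ n : ℤ, fourierCoeff f n
      = B n * ((r ^ (2 * Real.pi * (n.natAbs : ℝ) / l) : ℝ) : ℂ) := by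
    intro n
    rw [fourierCoeff_eq_intervalIntegral _ n 0, zero_add]
    simp only [hf, smul_eq_mul]
    rw [hA n r hr, hB]
    simp only [smul_mul_assoc]
  set q : ℝ := r ^ (2 * Real.pi / l) with hq
  have hq0 : 0 < q := Real.rpow_pos_of_pos hr.1 _
  have hq1 : q < 1 := Real.rpow_lt_one hr.1.le hr.2 (by positivity)
  have hqk : ∀ k : ℕ, r ^ (2 * Real.pi * (k : ℝ) / l) = q ^ k := by
    intro k
    rw [hq, ← Real.rpow_natCast, ← Real.rpow_mul hr.1.le]
    congr 1; ring
  have hsumm : Summable (fourierCoeff f) := by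
    have hg : Summable (fun k : ℕ => M * q ^ k) :=
      (summable_geometric_of_lt_one hq0.le hq1).mul_left M
    have hn : ∀ n : ℤ, ‖fourierCoeff f n‖ ≤ M * q ^ n.natAbs := by
      intro n
      rw [hcoef, hqk, norm_mul, Complex.norm_real, Real.norm_eq_abs, abs_of_pos (pow_pos hq0 _)]
      exact mul_le_mul_of_nonneg_right (hBM n) (pow_pos hq0 _).le
    refine Summable.of_norm_bounded (g := fun n : ℤ => M * q ^ n.natAbs) ?_ hn
    exact Summable.of_nat_of_neg (by simpa using hg) (by simpa using hg)
  have H := (has_pointwise_sum_fourier_series_of_summable hsumm (θ : AddCircle l)).nat_add_neg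
  rw [hf] at H
  have H2 := (H.sub (hasSum_ite_eq (0:ℕ) (fourierCoeff f 0 • (fourier 0 (θ : AddCircle l) : ℂ)))).mapL Complex.reCLM
  rw [add_sub_cancel_right] at H2
  change HasSum _ (u r θ) at H2
  convert H2 using 1
  funext k
  have hcos : ∀ n : ℤ, (fourier n (θ : AddCircle l) : ℂ)
      = (Real.cos (2 * Real.pi * n * θ / l) : ℂ)
        + (Real.sin (2 * Real.pi * n * θ / l) : ℂ) * Complex.I := by
    intro n
    rw [fourier_coe_apply, Complex.ofReal_cos, Complex.ofReal_sin, ← Complex.exp_mul_I]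
    congr 1
    push_cast
    ring
  rcases Nat.eq_zero_or_pos k with rfl | hk
  · simp [hcoef]
  · have hk0 : k ≠ 0 := hk.ne'
    have hneg : 2 * Real.pi * ((-(k:ℤ) : ℤ) : ℝ) * θ / l = -(2 * Real.pi * (k:ℝ) * θ / l) := by
      push_cast; ring
    simp only [hk0, if_false, sub_zero, hcoef, hcos, hneg, Real.cos_neg, Real.sin_neg,
      Int.natAbs_neg, Int.natAbs_natCast, Int.cast_natCast, smul_eq_mul, Complex.reCLM_apply,
      Complex.add_re, Complex.mul_re, Complex.add_im, Complex.mul_im, Complex.ofReal_re,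
      Complex.ofReal_im, Complex.I_re, Complex.I_im]
    ring
end
end

section
/- Let l > 0 and let u be a bounded harmonic function on the punctured unit cone of length l, with M = sup |u|. Then there exist a constant C > 0 depending only on l and a real number c such that |u(r,θ) − c| ≤ C · M · r^{2π/l} for all r ∈ (0, 1/2] and θ ∈ ℝ. In particular u extends continuously to the vertex: u(r,θ) → c as r → 0, uniformly in θ. -/
open MeasureTheory Set

noncomputable section

open Filter Topology

lemma cone_ode_first (k : ℝ) (a b : ℝ → ℂ)
    (ha : ∀ r ∈ Ioo (0:ℝ) 1, HasDerivAt a (b r) r)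
    (hb : ∀ r ∈ Ioo (0:ℝ) 1,
      HasDerivAt b ((k ^ 2 / r ^ 2 : ℝ) * a r - (1 / r : ℝ) * b r) r) :
    ∃ P : ℂ, ∀ r ∈ Ioo (0:ℝ) 1, (r : ℂ) * b r + (k : ℂ) * a r = ((r ^ k : ℝ) : ℂ) * P := by
  set g : ℝ → ℂ := fun r => ((r ^ (-k) : ℝ) : ℂ) * ((r : ℂ) * b r + (k : ℂ) * a r) with hg
  have hd : ∀ r ∈ Ioo (0:ℝ) 1, HasDerivAt g 0 r := by
    intro r hr
    have hr0 : r ≠ 0 := hr.1.ne'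
    have h1 : HasDerivAt (fun r : ℝ => ((r ^ (-k) : ℝ) : ℂ)) (((-k) * r ^ (-k - 1) : ℝ) : ℂ) r :=
      (Real.hasDerivAt_rpow_const (Or.inl hr0)).ofReal_comp
    have h2 : HasDerivAt (fun r : ℝ => (r : ℂ)) 1 r := by
      simpa using (hasDerivAt_id r).ofReal_comp
    have h3 := h1.mul ((h2.mul (hb r hr)).add ((ha r hr).const_mul (k : ℂ)))
    refine h3.congr_deriv ?_
    have hrc : (r : ℂ) ≠ 0 := by exact_mod_cast hr0
    rw [Real.rpow_sub hr.1, Real.rpow_one]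
    simp only [Pi.mul_apply, Pi.add_apply]
    push_cast
    field_simp
    ring
  refine ⟨g (1/2), fun r hr => ?_⟩
  have hc : g r = g (1/2) := by
    refine isOpen_Ioo.is_const_of_deriv_eq_zero (𝕜 := ℝ) (s := Ioo (0:ℝ) 1) isPreconnected_Ioo
      (fun x hx => (hd x hx).differentiableAt.differentiableWithinAt)
      (fun x hx => (hd x hx).deriv) hr ⟨by norm_num, by norm_num⟩
  rw [← hc, hg]
  simp only
  rw [← mul_assoc, ← Complex.ofReal_mul, ← Real.rpow_add hr.1]
  simp

lemma cone_ode_pos (k : ℝ) (hk : 0 < k) (a b : ℝ → ℂ) (M : ℝ)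
    (ha : ∀ r ∈ Ioo (0:ℝ) 1, HasDerivAt a (b r) r)
    (hb : ∀ r ∈ Ioo (0:ℝ) 1,
      HasDerivAt b ((k ^ 2 / r ^ 2 : ℝ) * a r - (1 / r : ℝ) * b r) r)
    (hM : ∀ r ∈ Ioo (0:ℝ) 1, ‖a r‖ ≤ M) :
    ∀ r ∈ Ioo (0:ℝ) 1, ‖a r‖ ≤ M * r ^ k := by
  obtain ⟨P, hP⟩ := cone_ode_first k a b ha hb
  obtain ⟨Q, hQ⟩ := cone_ode_first (-k) a b ha (by simpa using hb)
  have key : ∀ r ∈ Ioo (0:ℝ) 1,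
      (2 * k : ℂ) * a r = ((r ^ k : ℝ) : ℂ) * P - ((r ^ (-k) : ℝ) : ℂ) * Q := by
    intro r hr
    rw [← hP r hr, ← hQ r hr]; push_cast; ring
  have nkey : ∀ r ∈ Ioo (0:ℝ) 1, ‖(2 * k : ℂ) * a r‖ = 2 * k * ‖a r‖ := by
    intro r hr
    rw [norm_mul, norm_mul, Complex.norm_real, Real.norm_of_nonneg hk.le]; simp
  have hev : ∀ᶠ r in 𝓝[>] (0:ℝ), r ∈ Ioo (0:ℝ) 1 := Ioo_mem_nhdsGT one_pos
  have hQ0 : Q = 0 := by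
    by_contra hne
    have hpos : 0 < ‖Q‖ := norm_pos_iff.mpr hne
    have ht := tendsto_rpow_neg_nhdsGT_zero (y := -k) (by linarith)
    obtain ⟨r, h1, hr⟩ :=
      ((ht.eventually_gt_atTop ((‖P‖ + 2 * k * M) / ‖Q‖)).and hev).exists
    rw [div_lt_iff₀ hpos] at h1
    have h2 : ((r ^ (-k) : ℝ) : ℂ) * Q = ((r ^ k : ℝ) : ℂ) * P - (2 * k : ℂ) * a r := by
      rw [key r hr]; ring
    have h3 := congrArg norm h2
    rw [norm_mul, Complex.norm_real, Real.norm_of_nonneg (Real.rpow_nonneg hr.1.le _)] at h3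
    have h4 := norm_sub_le (((r ^ k : ℝ) : ℂ) * P) ((2 * k : ℂ) * a r)
    rw [nkey r hr, norm_mul, Complex.norm_real,
      Real.norm_of_nonneg (Real.rpow_nonneg hr.1.le _)] at h4
    have h5 : r ^ k ≤ 1 := Real.rpow_le_one hr.1.le hr.2.le hk.le
    have h6 := hM r hr
    nlinarith [norm_nonneg P, mul_le_mul_of_nonneg_left h6 hk.le,
      mul_le_mul_of_nonneg_right h5 (norm_nonneg P)]
  have key2 : ∀ r ∈ Ioo (0:ℝ) 1, 2 * k * ‖a r‖ = r ^ k * ‖P‖ := by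
    intro r hr
    rw [← nkey r hr, key r hr, hQ0, mul_zero, sub_zero, norm_mul, Complex.norm_real,
      Real.norm_of_nonneg (Real.rpow_nonneg hr.1.le _)]
  have hPM : ‖P‖ ≤ 2 * k * M := by
    have ht : Tendsto (fun r : ℝ => r ^ k * ‖P‖) (𝓝[<] 1) (𝓝 ((1:ℝ) ^ k * ‖P‖)) := by
      refine Tendsto.mono_left ?_ nhdsWithin_le_nhds
      exact ((Real.continuousAt_rpow_const 1 k (Or.inl one_ne_zero)).tendsto).mul_const _
    rw [Real.one_rpow, one_mul] at ht
    have hev : ∀ᶠ r in 𝓝[<] (1:ℝ), r ∈ Ioo (0:ℝ) 1 := Ioo_mem_nhdsLT one_pos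
    refine le_of_tendsto ht ?_
    filter_upwards [hev] with r hr
    rw [← key2 r hr]
    exact mul_le_mul_of_nonneg_left (hM r hr) (by positivity)
  intro r hr
  have h1 := key2 r hr
  have h2 := mul_le_mul_of_nonneg_left hPM (Real.rpow_nonneg hr.1.le k)
  have : 2 * k * ‖a r‖ ≤ 2 * k * (M * r ^ k) := by rw [h1]; linarith
  exact le_of_mul_le_mul_left this (by positivity)

lemma cone_ode_zero (a b : ℝ → ℂ) (M : ℝ)
    (ha : ∀ r ∈ Ioo (0:ℝ) 1, HasDerivAt a (b r) r)
    (hb : ∀ r ∈ Ioo (0:ℝ) 1, HasDerivAt b (- ((1 / r : ℝ) * b r)) r)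
    (hM : ∀ r ∈ Ioo (0:ℝ) 1, ‖a r‖ ≤ M) :
    ∃ D : ℂ, ∀ r ∈ Ioo (0:ℝ) 1, a r = D := by
  obtain ⟨P, hP⟩ := cone_ode_first 0 a b ha (by simpa using hb)
  simp only [Complex.ofReal_zero, zero_mul, add_zero, Real.rpow_zero, Complex.ofReal_one,
    one_mul] at hP
  set g : ℝ → ℂ := fun r => a r - ((Real.log r : ℝ) : ℂ) * P with hg
  have hd : ∀ r ∈ Ioo (0:ℝ) 1, HasDerivAt g 0 r := by
    intro r hr
    have hr0 : r ≠ 0 := hr.1.ne'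
    have hrc : (r : ℂ) ≠ 0 := by exact_mod_cast hr0
    have h1 := (Real.hasDerivAt_log hr0).ofReal_comp.mul_const P
    refine ((ha r hr).sub h1).congr_deriv ?_
    rw [← hP r hr]
    push_cast
    field_simp
    ring
  have hc : ∀ r ∈ Ioo (0:ℝ) 1, g r = g (1/2) := fun r hr =>
    isOpen_Ioo.is_const_of_deriv_eq_zero (𝕜 := ℝ) (s := Ioo (0:ℝ) 1) isPreconnected_Ioo
      (fun x hx => (hd x hx).differentiableAt.differentiableWithinAt)
      (fun x hx => (hd x hx).deriv) hr ⟨by norm_num, by norm_num⟩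
  have hP0 : P = 0 := by
    by_contra hne
    have hpos : 0 < ‖P‖ := norm_pos_iff.mpr hne
    have hev : ∀ᶠ r in 𝓝[>] (0:ℝ), r ∈ Ioo (0:ℝ) 1 := Ioo_mem_nhdsGT one_pos
    obtain ⟨r, h1, hr⟩ :=
      ((Real.tendsto_log_nhdsGT_zero.eventually_lt_atBot (-((M + ‖g (1/2)‖) / ‖P‖))).and
        hev).exists
    have h1' : (M + ‖g (1/2)‖) / ‖P‖ < - Real.log r := by linarith
    rw [div_lt_iff₀ hpos] at h1'
    have h2 : ((Real.log r : ℝ) : ℂ) * P = a r - g (1/2) := by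
      rw [← hc r hr, hg]; ring
    have h3 := congrArg norm h2
    rw [norm_mul, Complex.norm_real] at h3
    have h4 := norm_sub_le (a r) (g (1/2))
    have h5 := hM r hr
    have h6 : - Real.log r ≤ ‖Real.log r‖ := neg_le_abs _
    nlinarith [mul_le_mul_of_nonneg_right h6 hpos.le]
  refine ⟨g (1/2), fun r hr => ?_⟩
  rw [← hc r hr, hg, hP0]; simp

lemma cone_slice_s1 (g : ℝ × ℝ → ℝ)
    (hg : ContDiffOn ℝ 1 g (Ioo (0:ℝ) 1 ×ˢ (univ : Set ℝ))) :
    (∀ r ∈ Ioo (0:ℝ) 1, ∀ θ : ℝ, HasDerivAt (fun s => g (s, θ)) (fderiv ℝ g (r, θ) (1, 0)) r) ∧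
    (∀ r ∈ Ioo (0:ℝ) 1, ∀ θ : ℝ, HasDerivAt (fun φ => g (r, φ)) (fderiv ℝ g (r, θ) (0, 1)) θ) := by
  have hU : IsOpen (Ioo (0:ℝ) 1 ×ˢ (univ : Set ℝ)) := isOpen_Ioo.prod isOpen_univ
  have hd : ∀ r ∈ Ioo (0:ℝ) 1, ∀ θ : ℝ, HasFDerivAt g (fderiv ℝ g (r, θ)) (r, θ) := by
    intro r hr θ
    have hm : (r, θ) ∈ (Ioo (0:ℝ) 1 ×ˢ (univ : Set ℝ)) := ⟨hr, mem_univ _⟩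
    exact ((hg.contDiffAt (hU.mem_nhds hm)).differentiableAt (by norm_num)).hasFDerivAt
  constructor
  · intro r hr θ
    exact (hd r hr θ).comp_hasDerivAt r ((hasDerivAt_id r).prodMk (hasDerivAt_const r θ))
  · intro r hr θ
    exact (hd r hr θ).comp_hasDerivAt θ ((hasDerivAt_const θ r).prodMk (hasDerivAt_id θ))

lemma cone_regular (l : ℝ) (u : ℝ → ℝ → ℝ) (h : HarmonicCone l u) :
    ∃ ur urr ut utt : ℝ → ℝ → ℝ,
      ContinuousOn (fun p : ℝ × ℝ => u p.1 p.2) (Ioo (0:ℝ) 1 ×ˢ (univ : Set ℝ)) ∧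
      ContinuousOn (fun p : ℝ × ℝ => ur p.1 p.2) (Ioo (0:ℝ) 1 ×ˢ (univ : Set ℝ)) ∧
      ContinuousOn (fun p : ℝ × ℝ => urr p.1 p.2) (Ioo (0:ℝ) 1 ×ˢ (univ : Set ℝ)) ∧
      ContinuousOn (fun p : ℝ × ℝ => utt p.1 p.2) (Ioo (0:ℝ) 1 ×ˢ (univ : Set ℝ)) ∧
      (∀ r ∈ Ioo (0:ℝ) 1, ∀ θ : ℝ, HasDerivAt (fun s => u s θ) (ur r θ) r) ∧
      (∀ r ∈ Ioo (0:ℝ) 1, ∀ θ : ℝ, HasDerivAt (fun s => ur s θ) (urr r θ) r) ∧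
      (∀ r ∈ Ioo (0:ℝ) 1, ∀ θ : ℝ, HasDerivAt (fun φ => u r φ) (ut r θ) θ) ∧
      (∀ r ∈ Ioo (0:ℝ) 1, ∀ θ : ℝ, HasDerivAt (fun φ => ut r φ) (utt r θ) θ) ∧
      (∀ r ∈ Ioo (0:ℝ) 1, ∀ θ : ℝ, ut r (θ + l) = ut r θ) ∧
      (∀ r ∈ Ioo (0:ℝ) 1, ∀ θ : ℝ,
        urr r θ + (1 / r) * ur r θ + (1 / r ^ 2) * utt r θ = 0) := by
  have hU : IsOpen (Ioo (0:ℝ) 1 ×ˢ (univ : Set ℝ)) := isOpen_Ioo.prod isOpen_univ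
  set f : ℝ × ℝ → ℝ := fun p => u p.1 p.2 with hf
  have hf2 : ContDiffOn ℝ 2 f (Ioo (0:ℝ) 1 ×ˢ (univ : Set ℝ)) := h.smooth
  have hfd : ContDiffOn ℝ 1 (fderiv ℝ f) (Ioo (0:ℝ) 1 ×ˢ (univ : Set ℝ)) :=
    hf2.fderiv_of_isOpen hU (by norm_num)
  have h1 : ∀ v : ℝ × ℝ,
      ContDiffOn ℝ 1 (fun p => fderiv ℝ f p v) (Ioo (0:ℝ) 1 ×ˢ (univ : Set ℝ)) :=
    fun v => hfd.clm_apply contDiffOn_const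
  have h2 : ∀ v w : ℝ × ℝ,
      ContinuousOn (fun p => fderiv ℝ (fun p => fderiv ℝ f p v) p w)
        (Ioo (0:ℝ) 1 ×ˢ (univ : Set ℝ)) :=
    fun v w => (((h1 v).fderiv_of_isOpen (m := 0) hU (by norm_num)).clm_apply
      contDiffOn_const).continuousOn
  have s0 := cone_slice_s1 f (hf2.of_le (by norm_num))
  have s1 := cone_slice_s1 _ (h1 (1, 0))
  have s2 := cone_slice_s1 _ (h1 (0, 1))
  refine ⟨fun r θ => fderiv ℝ f (r, θ) (1, 0),
    fun r θ => fderiv ℝ (fun p => fderiv ℝ f p (1, 0)) (r, θ) (1, 0),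
    fun r θ => fderiv ℝ f (r, θ) (0, 1),
    fun r θ => fderiv ℝ (fun p => fderiv ℝ f p (0, 1)) (r, θ) (0, 1),
    hf2.continuousOn, (h1 _).continuousOn, h2 _ _, h2 _ _, s0.1, s1.1, s0.2, s2.2, ?_, ?_⟩
  · intro r hr θ
    have e1 : HasDerivAt (fun φ => u r (φ + l)) (fderiv ℝ f (r, θ + l) (0, 1)) θ :=
      (s0.2 r hr (θ + l)).comp_add_const θ l
    have e2 : (fun φ => u r (φ + l)) = fun φ => u r φ := funext fun φ => h.periodic r φ
    rw [e2] at e1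
    exact e1.unique (s0.2 r hr θ)
  · intro r hr θ
    have hl := h.laplace r hr θ
    have e1 : deriv (fun s => deriv (fun s' => u s' θ) s) r
        = fderiv ℝ (fun p => fderiv ℝ f p (1, 0)) (r, θ) (1, 0) := by
      rw [← (s1.1 r hr θ).deriv]
      apply Filter.EventuallyEq.deriv_eq
      filter_upwards [isOpen_Ioo.mem_nhds hr] with s hs
      exact (s0.1 s hs θ).deriv
    have e2 : deriv (fun φ => deriv (fun φ' => u r φ') φ) θ
        = fderiv ℝ (fun p => fderiv ℝ f p (0, 1)) (r, θ) (0, 1) := by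
      rw [← (s2.2 r hr θ).deriv]
      congr 1
      funext φ
      exact (s0.2 r hr φ).deriv
    have e3 : deriv (fun s => u s θ) r = fderiv ℝ f (r, θ) (1, 0) := (s0.1 r hr θ).deriv
    rw [e1, e2, e3] at hl
    exact hl

lemma cone_cont_slice (g : ℝ → ℝ → ℝ)
    (hg : ContinuousOn (fun p : ℝ × ℝ => g p.1 p.2) (Ioo (0:ℝ) 1 ×ˢ (univ : Set ℝ)))
    (r : ℝ) (hr : r ∈ Ioo (0:ℝ) 1) : Continuous (g r) := by
  have : Continuous ((fun p : ℝ × ℝ => g p.1 p.2) ∘ fun θ : ℝ => (r, θ)) :=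
    hg.comp_continuous (by fun_prop) (fun θ => ⟨hr, mem_univ _⟩)
  exact this

lemma cone_param (l : ℝ) (g g' : ℝ → ℝ → ℝ) (e : ℝ → ℂ) (he : Continuous e)
    (hg : ContinuousOn (fun p : ℝ × ℝ => g p.1 p.2) (Ioo (0:ℝ) 1 ×ˢ (univ : Set ℝ)))
    (hg' : ContinuousOn (fun p : ℝ × ℝ => g' p.1 p.2) (Ioo (0:ℝ) 1 ×ˢ (univ : Set ℝ)))
    (hd : ∀ r ∈ Ioo (0:ℝ) 1, ∀ θ : ℝ, HasDerivAt (fun s => g s θ) (g' r θ) r)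
    (r : ℝ) (hr : r ∈ Ioo (0:ℝ) 1) :
    HasDerivAt (fun r => ∫ θ in (0:ℝ)..l, e θ * (g r θ : ℂ))
      (∫ θ in (0:ℝ)..l, e θ * (g' r θ : ℂ)) r := by
  have cs : ∀ s ∈ Ioo (0:ℝ) 1, Continuous fun θ => e θ * (g s θ : ℂ) := fun s hs =>
    he.mul (Complex.continuous_ofReal.comp (cone_cont_slice g hg s hs))
  have cs' : ∀ s ∈ Ioo (0:ℝ) 1, Continuous fun θ => e θ * (g' s θ : ℂ) := fun s hs =>
    he.mul (Complex.continuous_ofReal.comp (cone_cont_slice g' hg' s hs))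
  obtain ⟨p, q, hpr, hsub⟩ : ∃ p q : ℝ, r ∈ Ioo p q ∧ Icc p q ⊆ Ioo (0:ℝ) 1 :=
    ⟨r / 2, (r + 1) / 2, ⟨by linarith [hr.1], by linarith [hr.2]⟩,
      fun x hx => ⟨by linarith [hr.1, hx.1], by linarith [hr.2, hx.2]⟩⟩
  have hK : IsCompact (Icc p q ×ˢ uIcc 0 l) := isCompact_Icc.prod isCompact_uIcc
  have hcont : ContinuousOn (fun z : ℝ × ℝ => e z.2 * (g' z.1 z.2 : ℂ)) (Icc p q ×ˢ uIcc 0 l) := by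
    refine ContinuousOn.mul (he.comp continuous_snd).continuousOn ?_
    exact Complex.continuous_ofReal.comp_continuousOn
      (hg'.mono (prod_mono hsub (subset_univ _)))
  obtain ⟨B, hB⟩ := hK.exists_bound_of_continuousOn hcont
  refine (intervalIntegral.hasDerivAt_integral_of_dominated_loc_of_deriv_le
    (F := fun r θ => e θ * (g r θ : ℂ)) (F' := fun r θ => e θ * (g' r θ : ℂ))
    (bound := fun _ => B) (s := Ioo p q) (isOpen_Ioo.mem_nhds hpr) ?_
    ((cs r hr).intervalIntegrable _ _) (cs' r hr).aestronglyMeasurable ?_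
    intervalIntegrable_const ?_).2
  · filter_upwards [isOpen_Ioo.mem_nhds hr] with s hs
    exact (cs s hs).aestronglyMeasurable
  · refine Filter.Eventually.of_forall fun t ht x hx => ?_
    exact hB (x, t) ⟨Ioo_subset_Icc_self hx, uIoc_subset_uIcc ht⟩
  · refine Filter.Eventually.of_forall fun t ht x hx => ?_
    exact ((hd x (hsub (Ioo_subset_Icc_self hx)) t).ofReal_comp).const_mul _

/-- The unnormalised Fourier coefficient. -/
def coneCoeff (l κ : ℝ) (g : ℝ → ℝ → ℝ) (r : ℝ) : ℂ :=
  ∫ θ in (0:ℝ)..l, Complex.exp (Complex.I * κ * θ) * (g r θ : ℂ)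

lemma cone_exp_deriv (κ θ : ℝ) : HasDerivAt (fun θ : ℝ => Complex.exp (Complex.I * κ * θ))
    (Complex.I * κ * Complex.exp (Complex.I * κ * θ)) θ := by
  have h2 : HasDerivAt (fun r : ℝ => (r : ℂ)) 1 θ := by
    simpa using (hasDerivAt_id θ).ofReal_comp
  refine ((h2.const_mul (Complex.I * κ)).cexp).congr_deriv ?_
  ring

lemma cone_byparts (l κ : ℝ) (u : ℝ → ℝ → ℝ) (ut utt : ℝ → ℝ → ℝ) (r : ℝ)
    (hper : Complex.exp (Complex.I * κ * l) = 1)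
    (hc0 : Continuous (u r)) (hc : Continuous (utt r))
    (h1 : ∀ θ : ℝ, HasDerivAt (fun φ => u r φ) (ut r θ) θ)
    (h2 : ∀ θ : ℝ, HasDerivAt (fun φ => ut r φ) (utt r θ) θ)
    (p0 : ∀ θ, u r (θ + l) = u r θ) (p1 : ∀ θ, ut r (θ + l) = ut r θ) :
    coneCoeff l κ utt r = - (κ ^ 2 : ℝ) * coneCoeff l κ u r := by
  have hce : Continuous fun θ : ℝ => Complex.exp (Complex.I * κ * θ) := by fun_prop
  have key := intervalIntegral.integral_eq_sub_of_hasDerivAt (a := 0) (b := l)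
    (f := fun θ : ℝ => Complex.exp (Complex.I * κ * θ) * (ut r θ : ℂ)
      - Complex.I * κ * Complex.exp (Complex.I * κ * θ) * (u r θ : ℂ))
    (f' := fun θ : ℝ => Complex.exp (Complex.I * κ * θ) * (utt r θ : ℂ)
      + (κ ^ 2 : ℝ) * (Complex.exp (Complex.I * κ * θ) * (u r θ : ℂ)))
    (by
      intro θ _
      refine (((cone_exp_deriv κ θ).mul (h2 θ).ofReal_comp).sub
        (((cone_exp_deriv κ θ).const_mul (Complex.I * κ)).mul (h1 θ).ofReal_comp)).congr_deriv ?_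
      push_cast
      linear_combination (-(κ:ℂ)^2 * Complex.exp (Complex.I * κ * θ) * (u r θ : ℂ)) * Complex.I_sq)
    (by
      apply Continuous.intervalIntegrable
      fun_prop)
  rw [intervalIntegral.integral_add, intervalIntegral.integral_const_mul] at key
  · have q0 := p0 0
    have q1 := p1 0
    rw [zero_add] at q0 q1
    rw [hper, q0, q1] at key
    simp only [Complex.ofReal_zero, mul_zero, Complex.exp_zero, sub_self] at key
    unfold coneCoeff
    linear_combination key
  · apply Continuous.intervalIntegrable; fun_prop
  · apply Continuous.intervalIntegrable; fun_prop

lemma cone_coeff_bound (l κ : ℝ) (hl : 0 < l) (g : ℝ → ℝ → ℝ) (r M : ℝ)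
    (hM : ∀ θ, |g r θ| ≤ M) : ‖coneCoeff l κ g r‖ ≤ M * l := by
  have := intervalIntegral.norm_integral_le_of_norm_le_const (a := 0) (b := l) (C := M)
    (f := fun θ : ℝ => Complex.exp (Complex.I * κ * θ) * (g r θ : ℂ)) (by
      intro θ _
      rw [norm_mul, Complex.norm_real]
      have : ‖Complex.exp (Complex.I * κ * θ)‖ = 1 := by
        rw [show Complex.I * κ * θ = ((κ * θ : ℝ) : ℂ) * Complex.I by push_cast; ring]
        exact Complex.norm_exp_ofReal_mul_I _
      rw [this, one_mul]; exact hM θ)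
  rwa [sub_zero, abs_of_pos hl] at this

lemma cone_coeff_ode (l κ : ℝ) (u : ℝ → ℝ → ℝ) (h : HarmonicCone l u)
    (hper : Complex.exp (Complex.I * κ * l) = 1) :
    ∃ b : ℝ → ℂ, (∀ r ∈ Ioo (0:ℝ) 1, HasDerivAt (coneCoeff l κ u) (b r) r) ∧
      (∀ r ∈ Ioo (0:ℝ) 1, HasDerivAt b
        ((κ ^ 2 / r ^ 2 : ℝ) * coneCoeff l κ u r - (1 / r : ℝ) * b r) r) := by
  obtain ⟨ur, urr, ut, utt, c0, c1, c2, c3, d1, d2, d3, d4, pt, hL⟩ := cone_regular l u h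
  have hce : Continuous fun θ : ℝ => Complex.exp (Complex.I * κ * θ) := by fun_prop
  refine ⟨coneCoeff l κ ur, fun r hr => cone_param l u ur _ hce c0 c1 d1 r hr, fun r hr => ?_⟩
  refine (cone_param l ur urr _ hce c1 c2 d2 r hr).congr_deriv ?_
  have k1 := cone_cont_slice ur c1 r hr
  have k3 := cone_cont_slice utt c3 r hr
  have hb := cone_byparts l κ u ut utt r hper (cone_cont_slice u c0 r hr) k3
    (d3 r hr) (d4 r hr) (h.periodic r) (pt r hr)
  have e : (∫ θ in (0:ℝ)..l, Complex.exp (Complex.I * κ * θ) * (urr r θ : ℂ))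
      = - (1 / r ^ 2 : ℝ) * coneCoeff l κ utt r - (1 / r : ℝ) * coneCoeff l κ ur r := by
    unfold coneCoeff
    rw [← intervalIntegral.integral_const_mul, ← intervalIntegral.integral_const_mul,
      ← intervalIntegral.integral_sub]
    · apply intervalIntegral.integral_congr
      intro θ _
      simp only
      have : urr r θ = - (1 / r) * ur r θ - (1 / r ^ 2) * utt r θ := by linarith [hL r hr θ]
      rw [this]; push_cast; ring
    · apply Continuous.intervalIntegrable; fun_prop
    · apply Continuous.intervalIntegrable; fun_prop
  rw [e, hb]
  push_cast
  ring

lemma cone_fourierCoeff (l : ℝ) [Fact (0 < l)] (u : ℝ → ℝ → ℝ) (r : ℝ) (F : AddCircle l → ℂ)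
    (hF : ∀ θ : ℝ, F (θ : AddCircle l) = (u r θ : ℂ)) (n : ℤ) :
    fourierCoeff F n = (1 / l : ℝ) * coneCoeff l (-(2 * Real.pi / l * n)) u r := by
  rw [fourierCoeff_eq_intervalIntegral F n 0, Complex.real_smul, zero_add]
  congr 1
  unfold coneCoeff
  apply intervalIntegral.integral_congr
  intro θ _
  simp only
  rw [hF, fourier_coe_apply, smul_eq_mul]
  congr 2
  push_cast
  ring

lemma cone_hasSum_geom (q : ℝ) (h0 : 0 ≤ q) (h1 : q < 1) (M : ℝ) :
    HasSum (fun n : ℤ => if n = 0 then 0 else M * q ^ n.natAbs) (M * (2 * q / (1 - q))) := by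
  have g := hasSum_geometric_of_lt_one h0 h1
  have s : HasSum (fun n : ℤ => q ^ n.natAbs) ((1 - q)⁻¹ + (1 - q)⁻¹ - q ^ (0:ℤ).natAbs) :=
    HasSum.of_nat_of_neg (f := fun n : ℤ => q ^ n.natAbs) (by simpa using g) (by simpa using g)
  have s2 := hasSum_ite_sub_hasSum (s.mul_left M) 0
  have hq : 1 - q ≠ 0 := by linarith
  have e : M * (2 * q / (1 - q))
      = M * ((1 - q)⁻¹ + (1 - q)⁻¹ - q ^ (0:ℤ).natAbs) - M * q ^ (0:ℤ).natAbs := by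
    simp only [Int.natAbs_zero, pow_zero]
    field_simp
    ring
  rw [e]
  exact s2

theorem holder_continuity_at_vertex (l : ℝ) (hl : 0 < l) :
    ∃ C : ℝ, 0 < C ∧ ∀ (u : ℝ → ℝ → ℝ) (M : ℝ), HarmonicCone l u →
      (∀ r ∈ Set.Ioo (0:ℝ) 1, ∀ θ : ℝ, |u r θ| ≤ M) →
      ∃ c : ℝ,
        (∀ r ∈ Set.Ioc (0:ℝ) (1/2), ∀ θ : ℝ,
          |u r θ - c| ≤ C * M * r ^ (2 * Real.pi / l)) ∧
        (∀ ε > (0:ℝ), ∃ r₀ > (0:ℝ), ∀ r ∈ Set.Ioo (0:ℝ) r₀, ∀ θ : ℝ,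
          |u r θ - c| ≤ ε) := by
  have : Fact (0 < l) := ⟨hl⟩
  set ω : ℝ := 2 * Real.pi / l with hω
  have hωpos : 0 < ω := by positivity
  set q0 : ℝ := (1/2 : ℝ) ^ ω with hq0
  have hq01 : q0 < 1 := Real.rpow_lt_one (by norm_num) (by norm_num) hωpos
  have hq1 : 0 < 1 - q0 := by linarith
  refine ⟨2 / (1 - q0), by positivity, fun u M h hM => ?_⟩
  have hM0 : 0 ≤ M := (abs_nonneg _).trans (hM (1/2) ⟨by norm_num, by norm_num⟩ 0)
  have hlc : (l : ℂ) ≠ 0 := by exact_mod_cast hl.ne'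
  have hper : ∀ n : ℤ, Complex.exp (Complex.I * ((-(ω * n) : ℝ) : ℂ) * l) = 1 := by
    intro n
    rw [Complex.exp_eq_one_iff]
    refine ⟨-n, ?_⟩
    rw [hω]; push_cast; field_simp
  have hbd : ∀ κ : ℝ, ∀ r ∈ Ioo (0:ℝ) 1, ‖coneCoeff l κ u r‖ ≤ M * l :=
    fun κ r hr => cone_coeff_bound l κ hl u r M (hM r hr)
  have hcoef : ∀ n : ℤ, n ≠ 0 → ∀ r ∈ Ioo (0:ℝ) 1,
      ‖((1 / l : ℝ) : ℂ) * coneCoeff l (-(ω * n)) u r‖ ≤ M * (r ^ ω) ^ n.natAbs := by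
    intro n hn r hr
    obtain ⟨b, h1, h2⟩ := cone_coeff_ode l _ u h (hper n)
    have hk : 0 < ω * (n.natAbs : ℝ) :=
      mul_pos hωpos (by exact_mod_cast Int.natAbs_pos.mpr hn)
    have hsq : (-(ω * n)) ^ 2 = (ω * (n.natAbs : ℝ)) ^ 2 := by
      rw [neg_sq, mul_pow, mul_pow, Nat.cast_natAbs, Int.cast_abs, sq_abs]
    rw [hsq] at h2
    have := cone_ode_pos _ hk _ b (M * l) h1 h2 (hbd _) r hr
    rw [Real.rpow_mul hr.1.le, Real.rpow_natCast] at this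
    rw [norm_mul, Complex.norm_real, Real.norm_of_nonneg (by positivity)]
    calc 1 / l * ‖coneCoeff l (-(ω * n)) u r‖ ≤ 1 / l * (M * l * (r ^ ω) ^ n.natAbs) :=
          mul_le_mul_of_nonneg_left this (by positivity)
      _ = M * (r ^ ω) ^ n.natAbs := by field_simp
  obtain ⟨D, hD⟩ : ∃ D : ℂ, ∀ r ∈ Ioo (0:ℝ) 1, coneCoeff l (-(ω * (0:ℤ))) u r = D := by
    obtain ⟨b, h1, h2⟩ := cone_coeff_ode l _ u h (hper 0)
    exact cone_ode_zero _ b (M * l) h1 (by simpa using h2) (hbd _)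
  have main : ∀ r ∈ Ioo (0:ℝ) 1, ∀ θ : ℝ,
      |u r θ - (((1 / l : ℝ) : ℂ) * D).re| ≤ M * (2 * r ^ ω / (1 - r ^ ω)) := by
    intro r hr θ
    obtain ⟨ur, urr, ut, utt, c0, -⟩ := cone_regular l u h
    have hc := cone_cont_slice u c0 r hr
    have hp : Function.Periodic (fun θ => (u r θ : ℂ)) l := fun θ => by
      simp only [h.periodic r θ]
    have hcc : Continuous fun θ => (u r θ : ℂ) := Complex.continuous_ofReal.comp hc
    let F : C(AddCircle l, ℂ) := ⟨hp.lift, continuous_coinduced_dom.mpr hcc⟩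
    have hF : ∀ θ : ℝ, F (θ : AddCircle l) = (u r θ : ℂ) := fun θ => rfl
    have hq0' : 0 ≤ r ^ ω := Real.rpow_nonneg hr.1.le _
    have hq1' : r ^ ω < 1 := Real.rpow_lt_one hr.1.le hr.2 hωpos
    have hfc := cone_fourierCoeff l u r F hF
    have hg := cone_hasSum_geom _ hq0' hq1' M
    have hsum : Summable (fourierCoeff F) := by
      refine Summable.of_norm_bounded_eventually hg.summable ?_
      have : ({0} : Set ℤ)ᶜ ∈ (Filter.cofinite : Filter ℤ) :=
        (Set.finite_singleton (0:ℤ)).compl_mem_cofinite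
      filter_upwards [this] with n hn
      have hn : n ≠ 0 := hn
      rw [if_neg hn, hfc n]
      exact hcoef n hn r hr
    have hs := hasSum_ite_sub_hasSum (has_pointwise_sum_fourier_series_of_summable hsum (θ : AddCircle l)) 0
    have hn := HasSum.norm_le_of_bounded hs hg (by
      intro n
      by_cases hn : n = 0
      · simp [hn]
      · rw [if_neg hn, if_neg hn, norm_smul, hfc n]
        have : ‖fourier n (θ : AddCircle l)‖ = 1 := Circle.norm_coe _
        rw [this, mul_one]
        exact hcoef n hn r hr)
    rw [hF, hfc 0, hD r hr, fourier_zero, smul_eq_mul, mul_one] at hn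
    refine le_trans ?_ hn
    have := Complex.abs_re_le_norm ((u r θ : ℂ) - ((1 / l : ℝ) : ℂ) * D)
    rwa [Complex.sub_re, Complex.ofReal_re] at this
  have main2 : ∀ r ∈ Set.Ioc (0:ℝ) (1/2), ∀ θ : ℝ,
      |u r θ - (((1 / l : ℝ) : ℂ) * D).re| ≤ 2 / (1 - q0) * M * r ^ ω := by
    intro r hr θ
    refine (main r ⟨hr.1, by linarith [hr.2]⟩ θ).trans ?_
    have hle : r ^ ω ≤ q0 := Real.rpow_le_rpow hr.1.le hr.2 hωpos.le
    have hq0' : 0 ≤ r ^ ω := Real.rpow_nonneg hr.1.le _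
    calc M * (2 * r ^ ω / (1 - r ^ ω)) ≤ M * (2 * r ^ ω / (1 - q0)) := by
          gcongr
      _ = _ := by ring
  refine ⟨_, main2, fun ε hε => ?_⟩
  have ht : Tendsto (fun r : ℝ => 2 / (1 - q0) * M * r ^ ω) (𝓝 0) (𝓝 0) := by
    have := ((Real.continuousAt_rpow_const 0 ω (Or.inr hωpos.le)).tendsto).const_mul
      (2 / (1 - q0) * M)
    rwa [Real.zero_rpow hωpos.ne', mul_zero] at this
  obtain ⟨δ, hδ, hball⟩ := Metric.eventually_nhds_iff.mp (ht.eventually_lt_const hε)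
  refine ⟨min δ (1/2), by positivity, fun r hr θ => ?_⟩
  refine (main2 r ⟨hr.1, (hr.2.trans_le (min_le_right _ _)).le⟩ θ).trans (hball ?_).le
  rw [Real.dist_eq, sub_zero, abs_of_pos hr.1]
  exact hr.2.trans_le (min_le_left _ _)
end
end

section
/- Let l > 0, let u be a bounded harmonic function on the punctured unit cone of length l, and let α ∈ (0, 2π/l]. For r ∈ (0,1) set D(r) = ∫₀^r ∫₀^l ( (∂_s u(s,θ))² + (∂_θ u(s,θ))²/s² ) s dθ ds. Then D(r) is finite for every r ∈ (0,1), and the function r ↦ r^{−2α} D(r) is nondecreasing on (0,1). -/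
open MeasureTheory Set

noncomputable section

/-- The pointwise squared cone gradient `(∂_s u)² + (∂_θ u)²/s²` times the area
weight `s`, as a function of the polar point `p = (s, θ)`. -/
def dirichletIntegrand (u : ℝ → ℝ → ℝ) (p : ℝ × ℝ) : ℝ :=
  ((deriv (fun s => u s p.2) p.1) ^ 2
    + (deriv (fun φ => u p.1 φ) p.2) ^ 2 / p.1 ^ 2) * p.1



open Filter Topology

/-- the open strip -/
def strip : Set (ℝ × ℝ) := Set.Ioo (0:ℝ) 1 ×ˢ (Set.univ : Set ℝ)

lemma isOpen_strip : IsOpen strip := isOpen_Ioo.prod isOpen_univ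

lemma mem_strip {s θ : ℝ} (hs : s ∈ Set.Ioo (0:ℝ) 1) : (s, θ) ∈ strip := ⟨hs, mem_univ _⟩

lemma partial_fst {n : ℕ} {v : ℝ → ℝ → ℝ}
    (hv : ContDiffOn ℝ (n + 1) (fun p : ℝ × ℝ => v p.1 p.2) strip) :
    ContDiffOn ℝ n (fun p : ℝ × ℝ => deriv (fun s => v s p.2) p.1) strip ∧
    ∀ s ∈ Set.Ioo (0:ℝ) 1, ∀ θ, HasDerivAt (fun s => v s θ) (deriv (fun s => v s θ) s) s := by
  have key : ∀ s ∈ Set.Ioo (0:ℝ) 1, ∀ θ, HasDerivAt (fun s => v s θ)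
      (fderiv ℝ (fun p : ℝ × ℝ => v p.1 p.2) (s, θ) (1, 0)) s := by
    intro s hs θ
    have hd : DifferentiableAt ℝ (fun p : ℝ × ℝ => v p.1 p.2) (s, θ) :=
      ((hv.differentiableOn (by simp)) _ (mem_strip hs)).differentiableAt
        (isOpen_strip.mem_nhds (mem_strip hs))
    have h1 : HasDerivAt (fun s : ℝ => (s, θ)) ((1:ℝ), (0:ℝ)) s :=
      (hasDerivAt_id s).prodMk (hasDerivAt_const s θ)
    exact hd.hasFDerivAt.comp_hasDerivAt s h1
  refine ⟨?_, fun s hs θ => by rw [(key s hs θ).deriv]; exact key s hs θ⟩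
  have h2 : ContDiffOn ℝ n (fderiv ℝ (fun p : ℝ × ℝ => v p.1 p.2)) strip :=
    hv.fderiv_of_isOpen isOpen_strip le_rfl
  refine (h2.clm_apply (contDiffOn_const (c := ((1:ℝ), (0:ℝ))))).congr ?_
  rintro ⟨s, θ⟩ hp
  exact (key s hp.1 θ).deriv

lemma partial_snd {n : ℕ} {v : ℝ → ℝ → ℝ}
    (hv : ContDiffOn ℝ (n + 1) (fun p : ℝ × ℝ => v p.1 p.2) strip) :
    ContDiffOn ℝ n (fun p : ℝ × ℝ => deriv (fun φ => v p.1 φ) p.2) strip ∧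
    ∀ s ∈ Set.Ioo (0:ℝ) 1, ∀ θ, HasDerivAt (fun φ => v s φ) (deriv (fun φ => v s φ) θ) θ := by
  have key : ∀ s ∈ Set.Ioo (0:ℝ) 1, ∀ θ, HasDerivAt (fun φ => v s φ)
      (fderiv ℝ (fun p : ℝ × ℝ => v p.1 p.2) (s, θ) (0, 1)) θ := by
    intro s hs θ
    have hd : DifferentiableAt ℝ (fun p : ℝ × ℝ => v p.1 p.2) (s, θ) :=
      ((hv.differentiableOn (by simp)) _ (mem_strip hs)).differentiableAt
        (isOpen_strip.mem_nhds (mem_strip hs))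
    have h1 : HasDerivAt (fun φ : ℝ => (s, φ)) ((0:ℝ), (1:ℝ)) θ :=
      (hasDerivAt_const θ s).prodMk (hasDerivAt_id θ)
    exact hd.hasFDerivAt.comp_hasDerivAt θ h1
  refine ⟨?_, fun s hs θ => by rw [(key s hs θ).deriv]; exact key s hs θ⟩
  have h2 : ContDiffOn ℝ n (fderiv ℝ (fun p : ℝ × ℝ => v p.1 p.2)) strip :=
    hv.fderiv_of_isOpen isOpen_strip le_rfl
  refine (h2.clm_apply (contDiffOn_const (c := ((0:ℝ), (1:ℝ))))).congr ?_
  rintro ⟨s, θ⟩ hp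
  exact (key s hp.1 θ).deriv

lemma slice_cont {v : ℝ → ℝ → ℝ} (hv : ContinuousOn (fun p : ℝ × ℝ => v p.1 p.2) strip)
    {s : ℝ} (hs : s ∈ Set.Ioo (0:ℝ) 1) : Continuous (v s) := by
  have : ContinuousOn (fun θ : ℝ => v s θ) univ :=
    hv.comp (f := fun θ : ℝ => (s, θ)) (by fun_prop) (fun θ _ => mem_strip hs)
  exact continuousOn_univ.1 this

/-- the Fourier kernel -/
def fker (l : ℝ) (n : ℤ) (θ : ℝ) : ℂ := fourier (-n) (θ : AddCircle l)

lemma fker_cont (l : ℝ) (n : ℤ) : Continuous (fker l n) := by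
  unfold fker
  exact (fourier (-n)).continuous.comp (AddCircle.continuous_mk' l)

lemma fker_norm (l : ℝ) (n : ℤ) (θ : ℝ) : ‖fker l n θ‖ = 1 := by
  rw [fker, fourier_apply]; exact Circle.norm_coe _

/-- Fourier coefficient, unnormalized -/
def fc (l : ℝ) (n : ℤ) (f : ℝ → ℝ) : ℂ := ∫ θ in (0:ℝ)..l, fker l n θ * (f θ : ℂ)

lemma fc_deriv (l : ℝ) (n : ℤ) {v v' : ℝ → ℝ → ℝ}
    (hv : ContinuousOn (fun p : ℝ × ℝ => v p.1 p.2) strip)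
    (hv' : ContinuousOn (fun p : ℝ × ℝ => v' p.1 p.2) strip)
    (hd : ∀ s ∈ Set.Ioo (0:ℝ) 1, ∀ θ, HasDerivAt (fun s => v s θ) (v' s θ) s)
    {s : ℝ} (hs : s ∈ Set.Ioo (0:ℝ) 1) :
    HasDerivAt (fun s => fc l n (v s)) (fc l n (v' s)) s := by
  have hkc := fker_cont l n
  obtain ⟨a, ha⟩ := exists_between hs.1
  obtain ⟨b, hb⟩ := exists_between hs.2
  have hsub : Icc a b ⊆ Ioo (0:ℝ) 1 := fun x hx => ⟨ha.1.trans_le hx.1, hx.2.trans_lt hb.2⟩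
  have hcomp : IsCompact (Icc a b ×ˢ uIcc (0:ℝ) l) := isCompact_Icc.prod isCompact_uIcc
  obtain ⟨C, hC⟩ := hcomp.exists_bound_of_continuousOn
    (hv'.mono (prod_mono hsub (subset_univ _)))
  have hcv : ∀ w : ℝ → ℝ → ℝ, ContinuousOn (fun p : ℝ × ℝ => w p.1 p.2) strip →
      ∀ x ∈ Ioo (0:ℝ) 1, Continuous (fun θ => fker l n θ * (w x θ : ℂ)) := by
    intro w hw x hx
    exact hkc.mul (Complex.continuous_ofReal.comp (slice_cont hw hx))
  refine (intervalIntegral.hasDerivAt_integral_of_dominated_loc_of_deriv_le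
    (F := fun s θ => fker l n θ * (v s θ : ℂ)) (F' := fun s θ => fker l n θ * (v' s θ : ℂ))
    (bound := fun _ => C)
    (Icc_mem_nhds ha.2 hb.1) ?_ ?_ ?_ ?_ ?_ ?_).2
  · filter_upwards [Icc_mem_nhds ha.2 hb.1] with x hx
    exact (hcv v hv x (hsub hx)).aestronglyMeasurable
  · exact (hcv v hv s hs).intervalIntegrable _ _
  · exact (hcv v' hv' s hs).aestronglyMeasurable
  · refine Eventually.of_forall fun t ht x hx => ?_
    rw [norm_mul, fker_norm, one_mul, Complex.norm_real]
    exact hC (x, t) ⟨hx, uIoc_subset_uIcc ht⟩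
  · simp
  · refine Eventually.of_forall fun t ht x hx => ?_
    exact ((hd x (hsub hx) t).ofReal_comp).const_mul _

lemma fc_ibp {l : ℝ} (n : ℤ) {f f' : ℝ → ℝ} (hf' : Continuous f')
    (hd : ∀ θ, HasDerivAt f (f' θ) θ) (hp : f l = f 0) :
    fc l n f' = (2 * Real.pi * Complex.I * n / l) * fc l n f := by
  unfold fc
  rw [intervalIntegral.integral_mul_deriv_eq_deriv_mul (u := fker l n) (v := fun θ => (f θ : ℂ))
    (u' := fun x => -2 * Real.pi * Complex.I * n / l * fker l n x)
    (fun x _ => hasDerivAt_fourier_neg l n x) (fun x _ => (hd x).ofReal_comp)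
    ((continuous_const.mul (fker_cont l n)).intervalIntegrable _ _)
    ((Complex.continuous_ofReal.comp hf').intervalIntegrable _ _)]
  have h0 : fker l n l = fker l n 0 := by simp [fker, AddCircle.coe_period]
  rw [h0, hp, sub_self, zero_sub]
  simp_rw [mul_assoc]
  rw [intervalIntegral.integral_const_mul]
  ring

lemma fc_parseval {l : ℝ} (hl : 0 < l) {f : ℝ → ℝ} (hf : Continuous f) :
    HasSum (fun n : ℤ => ‖fc l n f‖ ^ 2) (l * ∫ θ in (0:ℝ)..l, f θ ^ 2) := by
  have hc : Continuous (fun x => (f x : ℂ)) := Complex.continuous_ofReal.comp hf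
  have hL : MemLp (fun x => (f x : ℂ)) 2 (volume.restrict (Ioc 0 l)) := by
    obtain ⟨C, hC⟩ := (isCompact_Icc (a := (0:ℝ)) (b := l)).exists_bound_of_continuousOn
      hc.continuousOn
    refine MemLp.of_bound hc.aestronglyMeasurable C ?_
    filter_upwards [ae_restrict_mem measurableSet_Ioc] with x hx
    exact hC x (Ioc_subset_Icc_self hx)
  have h := (hasSum_sq_fourierCoeffOn hl hL).mul_left (l ^ 2)
  convert! h using 1
  · ext n
    rw [fourierCoeffOn_eq_integral, fc]
    simp [fker, abs_of_pos hl]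
    field_simp
  · simp
    field_simp

lemma euler1 {m : ℝ} {p p' : ℝ → ℂ} (hd : ∀ s ∈ Ioo (0:ℝ) 1, HasDerivAt p (p' s) s)
    (he : ∀ s ∈ Ioo (0:ℝ) 1, s * p' s = m * p s) :
    ∃ A : ℂ, ∀ s ∈ Ioo (0:ℝ) 1, p s = A * ((s ^ m : ℝ) : ℂ) := by
  have hg : ∀ s ∈ Ioo (0:ℝ) 1, HasDerivAt (fun s => p s * ((s ^ (-m) : ℝ) : ℂ)) 0 s := by
    intro s hs
    have h1 := (Real.hasDerivAt_rpow_const (x := s) (p := -m) (Or.inl hs.1.ne')).ofReal_comp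
    refine ((hd s hs).mul h1).congr_deriv ?_
    rw [Real.rpow_sub_one hs.1.ne']
    have hs0 : (s : ℂ) ≠ 0 := by exact_mod_cast hs.1.ne'
    have := he s hs
    push_cast
    field_simp
    linear_combination (((s ^ (-m) : ℝ) : ℂ)) * this
  have hconst : ∀ s ∈ Ioo (0:ℝ) 1, p s * ((s ^ (-m) : ℝ) : ℂ)
      = p (1/2) * (((1/2 : ℝ) ^ (-m) : ℝ) : ℂ) := by
    intro s hs
    refine isOpen_Ioo.is_const_of_deriv_eq_zero (f := fun s => p s * ((s ^ (-m) : ℝ) : ℂ))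
      isPreconnected_Ioo
      (fun x hx => (hg x hx).differentiableAt.differentiableWithinAt)
      (fun x hx => (hg x hx).deriv) hs (by norm_num)
  refine ⟨p (1/2) * (((1/2 : ℝ) ^ (-m) : ℝ) : ℂ), fun s hs => ?_⟩
  rw [← hconst s hs, mul_assoc, ← Complex.ofReal_mul, ← Real.rpow_add hs.1]
  simp

lemma euler2 {m M : ℝ} (hm : 0 ≤ m) {c c' c'' : ℝ → ℂ}
    (hc : ∀ s ∈ Ioo (0:ℝ) 1, HasDerivAt c (c' s) s)
    (hc' : ∀ s ∈ Ioo (0:ℝ) 1, HasDerivAt c' (c'' s) s)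
    (he : ∀ s ∈ Ioo (0:ℝ) 1, s ^ 2 * c'' s + s * c' s = m ^ 2 * c s)
    (hM : ∀ s ∈ Ioo (0:ℝ) 1, ‖c s‖ ≤ M) :
    ∃ A : ℂ, ∀ s ∈ Ioo (0:ℝ) 1, c s = A * ((s ^ m : ℝ) : ℂ) ∧ s * c' s = m * c s := by
  have hid : ∀ s : ℝ, HasDerivAt (fun s : ℝ => (s : ℂ)) 1 s := fun s => by
    simpa using (hasDerivAt_id s).ofReal_comp
  have hq : ∀ s ∈ Ioo (0:ℝ) 1, HasDerivAt (fun s => s * c' s - m * c s)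
      ((1 * c' s + s * c'' s) - m * c' s) s := fun s hs =>
    ((hid s).mul (hc' s hs)).sub ((hc s hs).const_mul _)
  have hp : ∀ s ∈ Ioo (0:ℝ) 1, HasDerivAt (fun s => s * c' s + m * c s)
      ((1 * c' s + s * c'' s) + m * c' s) s := fun s hs =>
    ((hid s).mul (hc' s hs)).add ((hc s hs).const_mul _)
  obtain ⟨B, hB⟩ := euler1 (m := -m) hq (fun s hs => by
    push_cast; linear_combination he s hs)
  obtain ⟨A, hA⟩ := euler1 (m := m) hp (fun s hs => by
    linear_combination he s hs)
  have hexp : ∀ N : ℕ, Real.exp (-((N : ℝ) + 1)) ∈ Ioo (0:ℝ) 1 := fun N =>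
    ⟨Real.exp_pos _, by rw [Real.exp_lt_one_iff]; have : (0:ℝ) ≤ N := N.cast_nonneg
                        linarith⟩
  have hB0 : B = 0 := by
    by_contra hne
    have hBpos : 0 < ‖B‖ := norm_pos_iff.2 hne
    rcases hm.eq_or_lt with h0 | hpos
    · subst h0
      simp only [neg_zero, Real.rpow_zero, Complex.ofReal_zero, zero_mul, sub_zero,
        Complex.ofReal_one, mul_one] at hB
      have hg : ∀ s ∈ Ioo (0:ℝ) 1, HasDerivAt (fun s => c s - B * (Real.log s : ℂ)) 0 s := by
        intro s hs
        have h1 := ((Real.hasDerivAt_log hs.1.ne').ofReal_comp).const_mul B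
        refine ((hc s hs).sub h1).congr_deriv ?_
        have hs0 : (s : ℂ) ≠ 0 := by exact_mod_cast hs.1.ne'
        push_cast
        rw [← hB s hs]; field_simp; simp
      have hconst : ∀ s ∈ Ioo (0:ℝ) 1, c s - B * (Real.log s : ℂ)
          = c (1/2) - B * (Real.log (1/2) : ℂ) := by
        intro s hs
        refine isOpen_Ioo.is_const_of_deriv_eq_zero (f := fun s => c s - B * (Real.log s : ℂ))
          isPreconnected_Ioo
          (fun x hx => (hg x hx).differentiableAt.differentiableWithinAt)
          (fun x hx => (hg x hx).deriv) hs (by norm_num)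
      set K := c (1/2) - B * (Real.log (1/2) : ℂ)
      obtain ⟨N, hN⟩ := exists_nat_gt ((M + ‖K‖) / ‖B‖)
      have h1 := hconst _ (hexp N)
      have h2 := hM _ (hexp N)
      rw [Real.log_exp] at h1
      have h3 : B * (((N : ℝ) + 1 : ℝ) : ℂ) = K - c (Real.exp (-((N : ℝ) + 1))) := by
        rw [← h1]; push_cast; ring
      have h4 : ‖B‖ * ((N : ℝ) + 1) ≤ ‖K‖ + M := by
        have := congrArg norm h3
        rw [norm_mul, Complex.norm_real, Real.norm_of_nonneg (by positivity)] at this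
        rw [this]
        exact (norm_sub_le _ _).trans (by linarith)
      rw [div_lt_iff₀ hBpos] at hN
      nlinarith
    · obtain ⟨N, hN⟩ := exists_nat_gt ((‖A‖ + 2 * m * M) / (‖B‖ * m))
      have hs := hexp N
      have h2 := hM _ hs
      set s := Real.exp (-((N : ℝ) + 1)) with hsdef
      have h3 : B * ((s ^ (-m) : ℝ) : ℂ) = A * ((s ^ m : ℝ) : ℂ) - 2 * m * c s := by
        rw [← hB s hs, ← hA s hs]; ring
      have h4 : s ^ (-m) = Real.exp (((N : ℝ) + 1) * m) := by
        rw [hsdef, ← Real.exp_mul]; congr 1; ring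
      have h5 : s ^ m ≤ 1 := Real.rpow_le_one hs.1.le hs.2.le hm
      have h5' : 0 ≤ s ^ m := Real.rpow_nonneg hs.1.le _
      have h6 : ‖B‖ * s ^ (-m) ≤ ‖A‖ + 2 * m * M := by
        have := congrArg norm h3
        rw [norm_mul, Complex.norm_real, Real.norm_of_nonneg (Real.rpow_nonneg hs.1.le _)] at this
        rw [this]
        refine (norm_sub_le _ _).trans (add_le_add ?_ ?_)
        · rw [norm_mul, Complex.norm_real, Real.norm_of_nonneg h5']
          exact mul_le_of_le_one_right (norm_nonneg _) h5
        · rw [norm_mul, norm_mul, Complex.norm_real, Real.norm_of_nonneg hm]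
          simp only [Complex.norm_ofNat]
          gcongr
      have h7 : ((N : ℝ) + 1) * m + 1 ≤ s ^ (-m) := h4 ▸ Real.add_one_le_exp _
      rw [div_lt_iff₀ (by positivity)] at hN
      have h8 : ‖B‖ * (((N : ℝ) + 1) * m + 1) ≤ ‖B‖ * s ^ (-m) :=
        mul_le_mul_of_nonneg_left h7 hBpos.le
      nlinarith [mul_pos hBpos hpos]
  have hfin : ∀ s ∈ Ioo (0:ℝ) 1, s * c' s = m * c s := by
    intro s hs
    have := hB s hs
    rw [hB0, zero_mul] at this
    exact sub_eq_zero.1 this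
  obtain ⟨A', hA'⟩ := euler1 hc hfin
  exact ⟨A', fun s hs => ⟨hA' s hs, hfin s hs⟩⟩

lemma coeff_form {l : ℝ} (hl : 0 < l) {u : ℝ → ℝ → ℝ}
    (hu : HarmonicCone l u) {M : ℝ}
    (hbound : ∀ r ∈ Set.Ioo (0:ℝ) 1, ∀ θ : ℝ, |u r θ| ≤ M) (n : ℤ) :
    ∃ A : ℂ, ∀ s ∈ Ioo (0:ℝ) 1,
      fc l n (u s) = A * ((s ^ (|(n:ℝ)| * (2 * Real.pi / l)) : ℝ) : ℂ) ∧
      s * fc l n (fun θ => deriv (fun s => u s θ) s)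
        = ((|(n:ℝ)| * (2 * Real.pi / l) : ℝ) : ℂ) * fc l n (u s) ∧
      fc l n (fun θ => deriv (fun φ => u s φ) θ)
        = (2 * Real.pi * Complex.I * n / l) * fc l n (u s) := by
  have hsm : ContDiffOn ℝ ((1 : ℕ) + 1) (fun p : ℝ × ℝ => u p.1 p.2) strip := by
    have := hu.smooth
    norm_num
    exact this
  obtain ⟨hs1, hs1d⟩ := partial_fst hsm
  obtain ⟨ht1, ht1d⟩ := partial_snd hsm
  have hs1' : ContDiffOn ℝ ((0 : ℕ) + 1) (fun p : ℝ × ℝ => deriv (fun s => u s p.2) p.1) strip := by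
    simpa using hs1
  have ht1' : ContDiffOn ℝ ((0 : ℕ) + 1) (fun p : ℝ × ℝ => deriv (fun φ => u p.1 φ) p.2) strip := by
    simpa using ht1
  obtain ⟨hs2, hs2d⟩ := partial_fst (v := fun s θ => deriv (fun s => u s θ) s) hs1'
  obtain ⟨ht2, ht2d⟩ := partial_snd (v := fun s θ => deriv (fun φ => u s φ) θ) ht1'
  have hper0 : ∀ s, u s l = u s 0 := fun s => by simpa using hu.periodic s 0
  have hper1 : ∀ s, deriv (fun φ => u s φ) l = deriv (fun φ => u s φ) 0 := fun s => by
    have h1 : (fun φ => u s (φ + l)) = fun φ => u s φ := funext fun φ => hu.periodic s φ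
    have h2 := deriv_comp_add_const (f := fun φ => u s φ) l 0
    simp only [h1, zero_add] at h2
    exact h2.symm
  have hB : ∀ s ∈ Ioo (0:ℝ) 1, fc l n (fun θ => deriv (fun φ => u s φ) θ)
        = (2 * Real.pi * Complex.I * n / l) * fc l n (u s) := fun s hs =>
    fc_ibp n (slice_cont (v := fun s θ => deriv (fun φ => u s φ) θ) ht1.continuousOn hs)
      (ht1d s hs) (hper0 s)
  have hBB : ∀ s ∈ Ioo (0:ℝ) 1,
      fc l n (fun θ => deriv (fun φ => deriv (fun φ' => u s φ') φ) θ)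
        = (2 * Real.pi * Complex.I * n / l) * fc l n (fun θ => deriv (fun φ => u s φ) θ) :=
    fun s hs => fc_ibp n
      (slice_cont (v := fun s θ => deriv (fun φ => deriv (fun φ' => u s φ') φ) θ)
        ht2.continuousOn hs) (ht2d s hs) (hper1 s)
  have hode : ∀ s ∈ Ioo (0:ℝ) 1,
      (s : ℂ) ^ 2 * fc l n (fun θ => deriv (fun s => deriv (fun s' => u s' θ) s) s)
        + s * fc l n (fun θ => deriv (fun s => u s θ) s)
        = ((|(n:ℝ)| * (2 * Real.pi / l) : ℝ) : ℂ) ^ 2 * fc l n (u s) := by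
    intro s hs
    have c1 : Continuous fun θ => fker l n θ * ((deriv (fun s => u s θ) s : ℝ) : ℂ) :=
      (fker_cont l n).mul (Complex.continuous_ofReal.comp
        (slice_cont (v := fun s θ => deriv (fun s => u s θ) s) hs1.continuousOn hs))
    have c2 : Continuous fun θ => fker l n θ *
        ((deriv (fun s => deriv (fun s' => u s' θ) s) s : ℝ) : ℂ) :=
      (fker_cont l n).mul (Complex.continuous_ofReal.comp
        (slice_cont (v := fun s θ => deriv (fun s => deriv (fun s' => u s' θ) s) s)
          hs2.continuousOn hs))
    have c1' : Continuous fun θ => (s : ℂ) * (fker l n θ * ((deriv (fun s => u s θ) s : ℝ) : ℂ)) :=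
      continuous_const.mul c1
    have c2' : Continuous fun θ => (s : ℂ) ^ 2 * (fker l n θ *
        ((deriv (fun s => deriv (fun s' => u s' θ) s) s : ℝ) : ℂ)) := continuous_const.mul c2
    have h3 : fc l n (fun θ => deriv (fun φ => deriv (fun φ' => u s φ') φ) θ)
        = -((s : ℂ) ^ 2 * fc l n (fun θ => deriv (fun s => deriv (fun s' => u s' θ) s) s)
        + s * fc l n (fun θ => deriv (fun s => u s θ) s)) := by
      unfold fc
      rw [← intervalIntegral.integral_const_mul, ← intervalIntegral.integral_const_mul,
        ← intervalIntegral.integral_add (c2'.intervalIntegrable _ _)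
          (c1'.intervalIntegrable _ _), ← intervalIntegral.integral_neg]
      refine intervalIntegral.integral_congr fun θ _ => ?_
      have hL := hu.laplace s hs θ
      have hs0 := hs.1.ne'
      field_simp at hL
      have hL' : deriv (fun φ => deriv (fun φ' => u s φ') φ) θ =
        -(s ^ 2 * deriv (fun s => deriv (fun s' => u s' θ) s) s
          + s * deriv (fun s => u s θ) s) := by linear_combination hL
      simp only []
      rw [hL']
      push_cast
      ring
    have h4 := hBB s hs
    rw [hB s hs, h3] at h4
    have h5 : ((|(n:ℝ)| * (2 * Real.pi / l) : ℝ) : ℂ) ^ 2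
        = -(2 * Real.pi * Complex.I * n / l) ^ 2 := by
      have h6 : (|(n:ℝ)| * (2 * Real.pi / l)) ^ 2 = (n * (2 * Real.pi / l)) ^ 2 := by
        rw [mul_pow, sq_abs, mul_pow]
      rw [← Complex.ofReal_pow, h6]
      push_cast
      linear_combination ((2 * Real.pi * n / l) ^ 2 : ℂ) * Complex.I_sq
    rw [h5]
    linear_combination -h4
  obtain ⟨A, hA⟩ := euler2 (m := |(n:ℝ)| * (2 * Real.pi / l)) (M := M * |l - 0|)
    (by positivity)
    (c := fun s => fc l n (u s)) (c' := fun s => fc l n (fun θ => deriv (fun s => u s θ) s))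
    (c'' := fun s => fc l n (fun θ => deriv (fun s => deriv (fun s' => u s' θ) s) s))
    (fun s hs => fc_deriv l n hsm.continuousOn
      (v' := fun s θ => deriv (fun s => u s θ) s) hs1.continuousOn hs1d hs)
    (fun s hs => fc_deriv l n (v := fun s θ => deriv (fun s => u s θ) s)
      (v' := fun s θ => deriv (fun s => deriv (fun s' => u s' θ) s) s)
      hs1.continuousOn hs2.continuousOn hs2d hs)
    hode
    (fun s hs => intervalIntegral.norm_integral_le_of_norm_le_const fun θ _ => by
      rw [norm_mul, fker_norm, one_mul, Complex.norm_real]; exact hbound s hs θ)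
  exact ⟨A, fun s hs => ⟨(hA s hs).1, (hA s hs).2, hB s hs⟩⟩

lemma integrand_cont {l : ℝ} {u : ℝ → ℝ → ℝ} (hu : HarmonicCone l u) :
    ContinuousOn (fun p : ℝ × ℝ => deriv (fun s => u s p.2) p.1) strip ∧
    ContinuousOn (fun p : ℝ × ℝ => deriv (fun φ => u p.1 φ) p.2) strip ∧
    ContinuousOn (dirichletIntegrand u) strip := by
  have hsm : ContDiffOn ℝ ((1 : ℕ) + 1) (fun p : ℝ × ℝ => u p.1 p.2) strip := by
    have := hu.smooth
    norm_num
    exact this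
  have h1 := (partial_fst hsm).1.continuousOn
  have h2 := (partial_snd hsm).1.continuousOn
  refine ⟨h1, h2, ?_⟩
  unfold dirichletIntegrand
  refine ((h1.pow 2).add ((h2.pow 2).div (by fun_prop) ?_)).mul (by fun_prop)
  intro p hp
  exact pow_ne_zero _ hp.1.1.ne'

lemma energy_mono {l : ℝ} (hl : 0 < l) {u : ℝ → ℝ → ℝ}
    (hu : HarmonicCone l u) {M : ℝ}
    (hbound : ∀ r ∈ Set.Ioo (0:ℝ) 1, ∀ θ : ℝ, |u r θ| ≤ M)
    {α : ℝ} (hα : α ∈ Set.Ioc (0:ℝ) (2 * Real.pi / l)) {s t : ℝ} (hs : s ∈ Ioo (0:ℝ) 1)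
    (ht : t ∈ Ioo (0:ℝ) 1) (hst : s ≤ t) :
    s ^ (1 - 2 * α) * (∫ θ in (0:ℝ)..l, dirichletIntegrand u (s, θ))
      ≤ t ^ (1 - 2 * α) * (∫ θ in (0:ℝ)..l, dirichletIntegrand u (t, θ)) := by
  choose A hA using coeff_form hl hu hbound
  obtain ⟨hc1, hc2, -⟩ := integrand_cont hu
  set m : ℤ → ℝ := fun n => |(n:ℝ)| * (2 * Real.pi / l) with hm
  have key : ∀ s ∈ Ioo (0:ℝ) 1, HasSum (fun n : ℤ => 2 * (m n) ^ 2 * ‖A n‖ ^ 2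
      * s ^ (2 * m n - 2 * α))
      (l * (s ^ (1 - 2 * α) * (∫ θ in (0:ℝ)..l, dirichletIntegrand u (s, θ)))) := by
    intro s hs
    have k1 : Continuous fun θ => deriv (fun s => u s θ) s :=
      slice_cont (v := fun s θ => deriv (fun s => u s θ) s) hc1 hs
    have k2 : Continuous fun θ => deriv (fun φ => u s φ) θ :=
      slice_cont (v := fun s θ => deriv (fun φ => u s φ) θ) hc2 hs
    have h1 := fc_parseval hl k1
    have h2 := fc_parseval hl k2
    have h3 := ((h1.add (h2.mul_left (1 / s ^ 2))).mul_left (s ^ (1 - 2 * α) * s))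
    have hs0 := hs.1.ne'
    convert! h3 using 1
    · ext n
      obtain ⟨e1, e2, e3⟩ := hA n s hs
      have f1 : ‖fc l n (fun θ => deriv (fun s => u s θ) s)‖ ^ 2
          = (m n) ^ 2 * ‖fc l n (u s)‖ ^ 2 / s ^ 2 := by
        have := congrArg (fun z : ℂ => ‖z‖ ^ 2) e2
        simp only [norm_mul, Complex.norm_real, mul_pow, Real.norm_eq_abs, sq_abs] at this
        rw [eq_div_iff (pow_ne_zero _ hs0), mul_comm, this]
        simp only [hm, mul_pow, sq_abs]
      have f2 : ‖fc l n (fun θ => deriv (fun φ => u s φ) θ)‖ ^ 2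
          = (m n) ^ 2 * ‖fc l n (u s)‖ ^ 2 := by
        rw [e3, norm_mul, mul_pow]
        congr 1
        simp only [hm, norm_div, norm_mul, Complex.norm_real, Complex.norm_I, Complex.norm_ofNat,
          Complex.norm_intCast, Real.norm_eq_abs, abs_of_pos hl, abs_of_pos Real.pi_pos]
        ring
      have f3 : ‖fc l n (u s)‖ ^ 2 = ‖A n‖ ^ 2 * s ^ (2 * m n) := by
        rw [e1, norm_mul, mul_pow, Complex.norm_real, Real.norm_eq_abs, sq_abs,
          ← Real.rpow_natCast (s ^ _) 2, ← Real.rpow_mul hs.1.le]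
        congr 2
        push_cast
        ring
      rw [f1, f2, f3, Real.rpow_sub hs.1, Real.rpow_sub hs.1, Real.rpow_one]
      have : s ^ (2 * α) ≠ 0 := (Real.rpow_pos_of_pos hs.1 _).ne'
      field_simp
      ring
    · have : (∫ θ in (0:ℝ)..l, dirichletIntegrand u (s, θ))
          = s * ((∫ θ in (0:ℝ)..l, (deriv (fun s => u s θ) s) ^ 2)
            + 1 / s ^ 2 * ∫ θ in (0:ℝ)..l, (deriv (fun φ => u s φ) θ) ^ 2) := by
        have k1' : Continuous fun θ => (deriv (fun s => u s θ) s) ^ 2 := k1.pow 2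
        have k2' : Continuous fun θ => 1 / s ^ 2 * (deriv (fun φ => u s φ) θ) ^ 2 :=
          continuous_const.mul (k2.pow 2)
        rw [← intervalIntegral.integral_const_mul, ← intervalIntegral.integral_add
          (k1'.intervalIntegrable _ _) (k2'.intervalIntegrable _ _),
          ← intervalIntegral.integral_const_mul]
        refine intervalIntegral.integral_congr fun θ _ => ?_
        simp only [dirichletIntegrand]
        ring
      rw [this]
      ring
  have hle := hasSum_le (fun n => ?_) (key s hs) (key t ht)
  · exact le_of_mul_le_mul_left hle hl
  · by_cases hn : n = 0
    · simp [hm, hn]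
    · have h1 : (1:ℝ) ≤ |(n:ℝ)| := by exact_mod_cast Int.one_le_abs hn
      have h2 : α ≤ m n := hα.2.trans (by
        simp only [hm]
        exact le_mul_of_one_le_left (by positivity) h1)
      have h3 : s ^ (2 * m n - 2 * α) ≤ t ^ (2 * m n - 2 * α) :=
        Real.rpow_le_rpow hs.1.le hst (by linarith)
      gcongr

lemma integrand_nonneg (u : ℝ → ℝ → ℝ) {p : ℝ × ℝ} (hp : 0 < p.1) :
    0 ≤ dirichletIntegrand u p := by
  unfold dirichletIntegrand
  positivity

lemma E_eq {l : ℝ} (hl : 0 < l) (u : ℝ → ℝ → ℝ) (s : ℝ) :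
    ∫ θ in Ioo 0 l, dirichletIntegrand u (s, θ)
      = ∫ θ in (0:ℝ)..l, dirichletIntegrand u (s, θ) := by
  rw [intervalIntegral.integral_of_le hl.le, integral_Ioc_eq_integral_Ioo]

/-- Monotonicity of the scaled Dirichlet energy: for a bounded harmonic function `u` on
the punctured unit cone of length `l` and `α ∈ (0, 2π/l]`, the energy
`D(r) = ∫₀^r ∫₀^l ((∂_s u)² + (∂_θ u)²/s²) s dθ ds` is finite for every `r ∈ (0,1)`
and `r ↦ r^{−2α} D(r)` is nondecreasing on `(0,1)`. -/
theorem dirichlet_energy_monotone (l : ℝ) (hl : 0 < l) (u : ℝ → ℝ → ℝ)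
    (hu : HarmonicCone l u) (M : ℝ)
    (hbound : ∀ r ∈ Set.Ioo (0:ℝ) 1, ∀ θ : ℝ, |u r θ| ≤ M)
    (α : ℝ) (hα : α ∈ Set.Ioc (0:ℝ) (2 * Real.pi / l)) :
    (∀ r ∈ Set.Ioo (0:ℝ) 1,
      IntegrableOn (dirichletIntegrand u) (Set.Ioo (0:ℝ) r ×ˢ Set.Ioo (0:ℝ) l)) ∧
    (∀ r₁ ∈ Set.Ioo (0:ℝ) 1, ∀ r₂ ∈ Set.Ioo (0:ℝ) 1, r₁ ≤ r₂ →
      r₁ ^ (-(2 * α)) * (∫ p in Set.Ioo (0:ℝ) r₁ ×ˢ Set.Ioo (0:ℝ) l, dirichletIntegrand u p)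
        ≤ r₂ ^ (-(2 * α)) *
          (∫ p in Set.Ioo (0:ℝ) r₂ ×ˢ Set.Ioo (0:ℝ) l, dirichletIntegrand u p)) := by
  have hmono := fun {s t : ℝ} => energy_mono (s := s) (t := t) hl hu hbound hα
  obtain ⟨-, -, hcont⟩ := integrand_cont hu
  have hα0 := hα.1
  have hint : ∀ r ∈ Set.Ioo (0:ℝ) 1,
      IntegrableOn (dirichletIntegrand u) (Set.Ioo (0:ℝ) r ×ˢ Set.Ioo (0:ℝ) l) := by
    intro r hr
    have hmem : ∀ x ∈ Ioo (0:ℝ) r, x ∈ Ioo (0:ℝ) 1 := fun x hx => ⟨hx.1, hx.2.trans hr.2⟩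
    have hmeas : AEStronglyMeasurable (dirichletIntegrand u)
        ((volume.restrict (Ioo (0:ℝ) r)).prod (volume.restrict (Ioo (0:ℝ) l))) := by
      rw [Measure.prod_restrict]
      exact (hcont.mono (prod_mono hmem (subset_univ _))).aestronglyMeasurable
        (measurableSet_Ioo.prod measurableSet_Ioo)
    rw [IntegrableOn, Measure.volume_eq_prod, ← Measure.prod_restrict, integrable_prod_iff hmeas]
    constructor
    · filter_upwards [ae_restrict_mem measurableSet_Ioo] with x hx
      have : Continuous fun y => dirichletIntegrand u (x, y) :=
        slice_cont (v := fun s θ => dirichletIntegrand u (s, θ)) hcont (hmem x hx)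
      exact (this.continuousOn.integrableOn_compact isCompact_Icc).mono_set Ioo_subset_Icc_self
    · set K := r ^ (1 - 2 * α) * (∫ θ in (0:ℝ)..l, dirichletIntegrand u (r, θ))
      have hI : IntegrableOn (fun x : ℝ => K * x ^ (2 * α - 1)) (Ioo 0 r) := by
        have := (intervalIntegral.intervalIntegrable_rpow' (a := 0) (b := r) (r := 2 * α - 1)
          (by linarith)).const_mul K
        rw [intervalIntegrable_iff_integrableOn_Ioo_of_le hr.1.le] at this
        exact this
      refine Integrable.mono' hI hmeas.norm.integral_prod_right' ?_
      filter_upwards [ae_restrict_mem measurableSet_Ioo] with x hx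
      have e1 : ∫ y in Ioo 0 l, ‖dirichletIntegrand u (x, y)‖
          = ∫ y in (0:ℝ)..l, dirichletIntegrand u (x, y) := by
        rw [← E_eq hl]
        refine integral_congr_ae (Eventually.of_forall fun y => ?_)
        exact Real.norm_of_nonneg (integrand_nonneg u hx.1)
      rw [Real.norm_of_nonneg (integral_nonneg fun _ => norm_nonneg _), e1]
      have h1 := hmono (hmem x hx) hr hx.2.le
      have h2 : x ^ (1 - 2 * α) * x ^ (2 * α - 1) = 1 := by
        rw [← Real.rpow_add hx.1]; simp
      calc _ = (x ^ (1 - 2 * α) * x ^ (2 * α - 1))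
              * ∫ y in (0:ℝ)..l, dirichletIntegrand u (x, y) := by rw [h2, one_mul]
        _ = (x ^ (1 - 2 * α) * ∫ y in (0:ℝ)..l, dirichletIntegrand u (x, y))
              * x ^ (2 * α - 1) := by ring
        _ ≤ _ := mul_le_mul_of_nonneg_right h1 (Real.rpow_nonneg hx.1.le _)
  refine ⟨hint, fun r₁ h₁ r₂ h₂ h12 => ?_⟩
  set E : ℝ → ℝ := fun s => ∫ θ in (0:ℝ)..l, dirichletIntegrand u (s, θ) with hE
  have hEint : ∀ r ∈ Ioo (0:ℝ) 1, IntervalIntegrable E volume 0 r := by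
    intro r hr
    rw [intervalIntegrable_iff_integrableOn_Ioo_of_le hr.1.le]
    have := hint r hr
    rw [IntegrableOn, Measure.volume_eq_prod, ← Measure.prod_restrict] at this
    have h := this.integral_prod_left
    simp only [E_eq hl] at h
    exact h
  have hD : ∀ r ∈ Ioo (0:ℝ) 1, ∫ p in Set.Ioo (0:ℝ) r ×ˢ Set.Ioo (0:ℝ) l, dirichletIntegrand u p
      = ∫ s in (0:ℝ)..r, E s := by
    intro r hr
    have h := hint r hr
    rw [Measure.volume_eq_prod] at h ⊢
    rw [setIntegral_prod _ h, intervalIntegral.integral_of_le hr.1.le,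
      integral_Ioc_eq_integral_Ioo]
    simp only [E_eq hl, hE]
  rw [hD r₁ h₁, hD r₂ h₂]
  set c := r₁ / r₂ with hc
  have hcpos : 0 < c := div_pos h₁.1 h₂.1
  have hc1 : c ≤ 1 := (div_le_one h₂.1).2 h12
  have hcr : c * r₂ = r₁ := div_mul_cancel₀ _ h₂.1.ne'
  have hsub : ∫ s in (0:ℝ)..r₁, E s = c * ∫ s in (0:ℝ)..r₂, E (c * s) := by
    have := intervalIntegral.smul_integral_comp_mul_left (a := 0) (b := r₂) E c
    rw [mul_zero, hcr] at this
    rw [← this, smul_eq_mul]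
  have hcomp : IntervalIntegrable (fun s => E (c * s)) volume 0 r₂ := by
    have := (hEint r₁ h₁).comp_mul_left (c := c)
    have e : r₁ / c = r₂ := by rw [← hcr]; field_simp
    simpa [e] using this
  have hle : ∫ s in (0:ℝ)..r₂, E (c * s) ≤ ∫ s in (0:ℝ)..r₂, c ^ (2 * α - 1) * E s := by
    refine intervalIntegral.integral_mono_on_of_le_Ioo h₂.1.le hcomp
      ((hEint r₂ h₂).const_mul _) fun x hx => ?_
    have hx1 : x ∈ Ioo (0:ℝ) 1 := ⟨hx.1, hx.2.trans h₂.2⟩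
    have hcx : c * x ≤ x := mul_le_of_le_one_left hx.1.le hc1
    have h := hmono (s := c * x) (t := x) ⟨mul_pos hcpos hx.1, hcx.trans_lt hx1.2⟩ hx1 hcx
    rw [Real.mul_rpow hcpos.le hx.1.le] at h
    have hxp : 0 < x ^ (1 - 2 * α) := Real.rpow_pos_of_pos hx.1 _
    have h' : c ^ (1 - 2 * α) * E (c * x) ≤ E x := by
      refine le_of_mul_le_mul_left ?_ hxp
      calc _ = c ^ (1 - 2 * α) * x ^ (1 - 2 * α) * E (c * x) := by ring
        _ ≤ _ := h
    have h2 : c ^ (2 * α - 1) * c ^ (1 - 2 * α) = 1 := by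
      rw [← Real.rpow_add hcpos]; simp
    calc E (c * x) = c ^ (2 * α - 1) * (c ^ (1 - 2 * α) * E (c * x)) := by
          rw [← mul_assoc, h2, one_mul]
      _ ≤ _ := mul_le_mul_of_nonneg_left h' (Real.rpow_nonneg hcpos.le _)
  rw [intervalIntegral.integral_const_mul] at hle
  have hr1 : 0 ≤ r₁ ^ (-(2 * α)) := Real.rpow_nonneg h₁.1.le _
  calc r₁ ^ (-(2 * α)) * ∫ s in (0:ℝ)..r₁, E s
      = r₁ ^ (-(2 * α)) * (c * ∫ s in (0:ℝ)..r₂, E (c * s)) := by rw [hsub]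
    _ ≤ r₁ ^ (-(2 * α)) * (c * (c ^ (2 * α - 1) * ∫ s in (0:ℝ)..r₂, E s)) := by gcongr
    _ = r₂ ^ (-(2 * α)) * ∫ s in (0:ℝ)..r₂, E s := by
      have e1 : c * c ^ (2 * α - 1) = c ^ (2 * α) := by
        rw [Real.rpow_sub_one hcpos.ne']; field_simp
      have e2 : r₁ ^ (-(2 * α)) * c ^ (2 * α) = r₂ ^ (-(2 * α)) := by
        rw [hc, Real.div_rpow h₁.1.le h₂.1.le, Real.rpow_neg h₁.1.le, Real.rpow_neg h₂.1.le]
        have := (Real.rpow_pos_of_pos h₁.1 (2 * α)).ne'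
        field_simp
      rw [← e2, ← e1]; ring
end
end

section
/- Let 0 < l ≤ 2π and α ∈ (0, 4π/l]. Let u₊, u₋ : [0,1) × ℝ → ℝ be nonnegative continuous functions on the unit cone of length l (l-periodic in θ, with u_±(0,θ) independent of θ and u_±(r,θ) → u_±(0) uniformly in θ as r → 0) such that u₊ · u₋ ≡ 0, and such that each u_± is C² and satisfies the polar Laplace equation ∂²u/∂r² + (1/r)∂u/∂r + (1/r²)∂²u/∂θ² = 0 on the open set {u_± > 0} ∩ {r > 0}. Define |Du_±|² = (∂_r u_±)² + (∂_θ u_±)²/r² on {u_± > 0} ∩ {r > 0} and |Du_±|² = 0 elsewhere, and set D_±(r) = ∫₀^r ∫₀^l |Du_±|²(s,θ) s dθ ds; assume D_±(r) < ∞ for every r < 1. Then the function r ↦ Φ(r) = r^{−2α} D₊(r) D₋(r) is nondecreasing on (0,1). -/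
open MeasureTheory Set

noncomputable section

/-- A nonnegative continuous function on the unit cone of length `l` (polar coordinates,
`l`-periodic in `θ`, with a well-defined vertex value approached uniformly as `r → 0`),
which is `C²` and satisfies the polar Laplace equation on its positivity set away from
the vertex. -/
structure ACFPhase (l : ℝ) (u : ℝ → ℝ → ℝ) : Prop where
  nonneg : ∀ r ∈ Set.Ico (0:ℝ) 1, ∀ θ : ℝ, 0 ≤ u r θ
  periodic : ∀ r θ : ℝ, u r (θ + l) = u r θ
  continuous : ContinuousOn (fun p : ℝ × ℝ => u p.1 p.2)
    (Set.Ico (0:ℝ) 1 ×ˢ (Set.univ : Set ℝ))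
  vertex_const : ∀ θ θ' : ℝ, u 0 θ = u 0 θ'
  vertex_unif : ∀ ε > (0:ℝ), ∃ δ > (0:ℝ), ∀ r ∈ Set.Ioo (0:ℝ) δ, ∀ θ : ℝ,
    |u r θ - u 0 0| ≤ ε
  smooth : ContDiffOn ℝ 2 (fun p : ℝ × ℝ => u p.1 p.2)
    {p : ℝ × ℝ | 0 < p.1 ∧ p.1 < 1 ∧ 0 < u p.1 p.2}
  laplace : ∀ r θ : ℝ, 0 < r → r < 1 → 0 < u r θ →
    deriv (fun s => deriv (fun s' => u s' θ) s) r
      + (1 / r) * deriv (fun s => u s θ) r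
      + (1 / r ^ 2) * deriv (fun φ => deriv (fun φ' => u r φ') φ) θ = 0

/-- The squared cone gradient `(∂_r u)² + (∂_θ u)²/r²` on the positivity set
`{u > 0} ∩ {r > 0}`, extended by `0` elsewhere, multiplied by the area weight `r`. -/
def acfIntegrand (u : ℝ → ℝ → ℝ) (p : ℝ × ℝ) : ℝ :=
  if 0 < p.1 ∧ 0 < u p.1 p.2 then
    ((deriv (fun s => u s p.2) p.1) ^ 2
      + (deriv (fun φ => u p.1 φ) p.2) ^ 2 / p.1 ^ 2) * p.1
  else 0

lemma wirt_ind_int (v : ℝ → ℝ) (hc : Continuous v) (a b : ℝ) :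
    IntervalIntegrable (fun θ => if 0 < v θ then (1:ℝ) else 0) volume a b := by
  have hm : Measurable (fun θ => if 0 < v θ then (1:ℝ) else 0) :=
    Measurable.ite (measurableSet_lt measurable_const hc.measurable) measurable_const measurable_const
  refine (intervalIntegrable_const (c := (1:ℝ))).mono_fun hm.aestronglyMeasurable ?_
  refine Filter.Eventually.of_forall fun θ => ?_
  by_cases h : 0 < v θ <;> simp [h]

/-- Truncated Wirtinger inequality. -/
lemma wirt_eps (v : ℝ → ℝ) (hc : Continuous v) (h0 : ∀ θ, 0 ≤ v θ) (a b : ℝ) (hab : a ≤ b)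
    (ha : v a = 0) (hb : v b = 0)
    (hd : ∀ θ, 0 < v θ → DifferentiableAt ℝ v θ ∧ ContinuousAt (deriv v) θ)
    (hi : IntervalIntegrable (fun θ => if 0 < v θ then (deriv v θ) ^ 2 else 0) volume a b)
    (lam : ℝ) (hlam : 0 < lam)
    (hω : lam * (∫ θ in a..b, if 0 < v θ then (1:ℝ) else 0) < Real.pi) (ε : ℝ) (hε : 0 < ε) :
    lam ^ 2 * ∫ θ in a..b, (max 0 (v θ - ε)) ^ 2 ≤
      ∫ θ in a..b, (if 0 < v θ then (deriv v θ) ^ 2 else 0) := by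
  set ω := ∫ θ in a..b, (if 0 < v θ then (1:ℝ) else 0) with hωdef
  set ind : ℝ → ℝ := fun θ => if 0 < v θ then (1:ℝ) else 0 with hind
  have hii : ∀ x y, IntervalIntegrable ind volume x y := wirt_ind_int v hc
  set s : ℝ → ℝ := fun θ => ∫ x in a..θ, ind x with hs
  have hsc : Continuous s := intervalIntegral.continuous_primitive hii a
  have hind0 : ∀ x, 0 ≤ ind x := fun x => by simp only [hind]; split_ifs <;> norm_num
  have hs0 : ∀ θ ∈ Icc a b, 0 ≤ s θ := fun θ hθ =>
    intervalIntegral.integral_nonneg hθ.1 (fun x _ => hind0 x)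
  have hs1 : ∀ θ ∈ Icc a b, s θ ≤ ω := fun θ hθ => by
    have h1 : s θ + ∫ x in θ..b, ind x = ω :=
      intervalIntegral.integral_add_adjacent_intervals (hii _ _) (hii _ _)
    have h2 : 0 ≤ ∫ x in θ..b, ind x :=
      intervalIntegral.integral_nonneg hθ.2 (fun x _ => hind0 x)
    linarith
  set δ := (Real.pi - lam * ω) / 2 with hδ
  have hδ0 : 0 < δ := by rw [hδ]; linarith
  have hsin : ∀ θ ∈ Icc a b, 0 < Real.sin (lam * s θ + δ) := fun θ hθ => by
    apply Real.sin_pos_of_pos_of_lt_pi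
    · have := mul_nonneg hlam.le (hs0 θ hθ); linarith
    · have := mul_le_mul_of_nonneg_left (hs1 θ hθ) hlam.le
      linarith
  set ψ : ℝ → ℝ := fun θ => lam * (Real.cos (lam * s θ + δ) / Real.sin (lam * s θ + δ)) with hψ
  set q : ℝ → ℝ := fun θ => max 0 (v θ - ε) with hq
  have hqc : Continuous q := by fun_prop
  have hsd : ∀ θ, 0 < v θ → HasDerivAt s 1 θ := fun θ hθ => by
    have hev : ind =ᶠ[nhds θ] fun _ => (1:ℝ) := by
      filter_upwards [hc.continuousAt.eventually (lt_mem_nhds hθ)] with x hx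
      simp [hind, hx]
    have h1 : HasDerivAt s (ind θ) θ := by
      apply intervalIntegral.integral_hasDerivAt_right (hii _ _)
      · have hm : Measurable ind :=
          Measurable.ite (measurableSet_lt measurable_const hc.measurable)
            measurable_const measurable_const
        exact hm.stronglyMeasurable.stronglyMeasurableAtFilter
      · exact continuousAt_const.congr hev.symm
    rwa [hev.self_of_nhds] at h1
  set H : ℝ → ℝ := fun θ => q θ ^ 2 * ψ θ with hH
  set H' : ℝ → ℝ := fun θ => 2 * q θ * deriv v θ * ψ θ - q θ ^ 2 * (lam ^ 2 + ψ θ ^ 2) with hH'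
  have hq2 : ∀ t : ℝ, HasDerivAt (fun t : ℝ => (max 0 (t - ε)) ^ 2) (2 * max 0 (t - ε)) t := by
    intro t
    rcases lt_trichotomy t ε with h | h | h
    · have : (fun t : ℝ => (max 0 (t - ε)) ^ 2) =ᶠ[nhds t] fun _ => 0 := by
        filter_upwards [gt_mem_nhds h] with x hx
        rw [max_eq_left (by linarith)]; norm_num
      rw [max_eq_left (by linarith)]
      simpa using (hasDerivAt_const t (0:ℝ)).congr_of_eventuallyEq this
    · subst h
      simp only [sub_self, max_self, mul_zero]
      rw [hasDerivAt_iff_isLittleO]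
      simp only [sub_self, max_self, smul_eq_mul, mul_zero, sub_zero]
      norm_num
      have : (fun x' : ℝ => (x' - t) ^ 2) =o[nhds t] fun x' => x' - t := by
        have h1 : (fun x' : ℝ => (x' - t) ^ 2) = fun x' => (x' - t) * (x' - t) := by
          ext; ring
        rw [h1]
        have h2 : (fun x' : ℝ => (x' - t)) =o[nhds t] (fun _ => (1:ℝ)) := by
          rw [Asymptotics.isLittleO_one_iff]
          have : Filter.Tendsto (fun x' : ℝ => x' - t) (nhds t) (nhds (t - t)) :=
            (continuous_id.sub continuous_const).tendsto t
          simpa using this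
        simpa using h2.mul_isBigO (Asymptotics.isBigO_refl (fun x' : ℝ => x' - t) (nhds t))
      refine Asymptotics.IsBigO.trans_isLittleO ?_ this
      apply Asymptotics.IsBigO.of_bound 1
      refine Filter.Eventually.of_forall fun x => ?_
      rw [one_mul, norm_pow, norm_pow]
      gcongr
      rw [Real.norm_eq_abs, Real.norm_eq_abs, abs_of_nonneg (le_max_left _ _)]
      exact max_le (abs_nonneg _) (le_abs_self _)
    · have : (fun t : ℝ => (max 0 (t - ε)) ^ 2) =ᶠ[nhds t] fun t => (t - ε) ^ 2 := by
        filter_upwards [lt_mem_nhds h] with x hx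
        rw [max_eq_right (by linarith)]
      rw [max_eq_right (by linarith)]
      have h3 : HasDerivAt (fun t : ℝ => (t - ε) ^ 2) (2 * (t - ε)) t := by
        refine (((hasDerivAt_id t).sub_const ε).fun_pow 2).congr_deriv ?_
        simp
      exact h3.congr_of_eventuallyEq this
  have hq0 : ∀ θ, v θ = 0 → q =ᶠ[nhds θ] fun _ => 0 := by
    intro θ hθ
    have : v θ < ε := by rw [hθ]; exact hε
    filter_upwards [hc.continuousAt.eventually (gt_mem_nhds this)] with x hx
    simp only [hq]; exact max_eq_left (by linarith)
  have hHd : ∀ θ ∈ uIcc a b, HasDerivAt H (H' θ) θ := by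
    intro θ hθ
    rw [uIcc_of_le hab] at hθ
    rcases (h0 θ).eq_or_lt with h | h
    · have h1 := hq0 θ h.symm
      have h2 : H =ᶠ[nhds θ] fun _ => 0 := by
        filter_upwards [h1] with x hx
        simp [hH, hx]
      have h3 : H' θ = 0 := by simp [hH', h1.self_of_nhds]
      rw [h3]
      exact (hasDerivAt_const θ (0:ℝ)).congr_of_eventuallyEq h2
    · have hv := (hd θ h).1.hasDerivAt
      have h1 : HasDerivAt (fun θ => q θ ^ 2) (2 * q θ * deriv v θ) θ :=
        (hq2 (v θ)).comp θ hv
      have hS := (hsd θ h).const_mul lam |>.add_const δ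
      have hne := (hsin θ hθ).ne'
      have h2 := ((hS.cos).div hS.sin hne).const_mul lam
      have h3 := h1.mul h2
      refine h3.congr_deriv ?_
      simp only [hH', hψ, Pi.div_apply]
      have hsc2 := Real.sin_sq_add_cos_sq (lam * s θ + δ)
      field_simp
      ring
  have hH'c : ContinuousOn H' (Icc a b) := by
    intro θ hθ
    apply ContinuousAt.continuousWithinAt
    rcases (h0 θ).eq_or_lt with h | h
    · have h1 := hq0 θ h.symm
      have h2 : H' =ᶠ[nhds θ] fun _ => 0 := by
        filter_upwards [h1] with x hx
        simp [hH', hx]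
      exact continuousAt_const.congr h2.symm
    · have h1 := (hd θ h).2
      have hne := (hsin θ hθ).ne'
      have hψc : ContinuousAt ψ θ := by
        apply ContinuousAt.mul continuousAt_const
        exact ContinuousAt.div (by fun_prop) (by fun_prop) hne
      have := hqc.continuousAt (x := θ)
      simp only [hH']
      fun_prop
  have hH'i : IntervalIntegrable H' volume a b := by
    apply ContinuousOn.intervalIntegrable
    rwa [uIcc_of_le hab]
  have hz := intervalIntegral.integral_eq_sub_of_hasDerivAt hHd hH'i
  have hHa : H a = 0 := by simp [hH, (hq0 a ha).self_of_nhds]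
  have hHb : H b = 0 := by simp [hH, (hq0 b hb).self_of_nhds]
  rw [hHa, hHb, sub_zero] at hz
  have hqi : IntervalIntegrable (fun θ => lam ^ 2 * q θ ^ 2) volume a b :=
    Continuous.intervalIntegrable (by fun_prop) _ _
  have hle := intervalIntegral.integral_mono_on hab hH'i (hi.sub hqi) (fun θ _ => ?_)
  · rw [hz, intervalIntegral.integral_sub hi hqi, intervalIntegral.integral_const_mul] at hle
    linarith
  · simp only [hH']
    split_ifs with h
    · nlinarith [sq_nonneg (deriv v θ - q θ * ψ θ)]
    · have : q θ = 0 := (hq0 θ (le_antisymm (not_lt.1 h) (h0 θ))).self_of_nhds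
      simp [this]

lemma wirt (v : ℝ → ℝ) (hc : Continuous v) (h0 : ∀ θ, 0 ≤ v θ) (a b : ℝ) (hab : a ≤ b)
    (ha : v a = 0) (hb : v b = 0)
    (hd : ∀ θ, 0 < v θ → DifferentiableAt ℝ v θ ∧ ContinuousAt (deriv v) θ)
    (hi : IntervalIntegrable (fun θ => if 0 < v θ then (deriv v θ) ^ 2 else 0) volume a b)
    (lam : ℝ) (hlam : 0 < lam)
    (hω : lam * (∫ θ in a..b, if 0 < v θ then (1:ℝ) else 0) < Real.pi) :
    lam ^ 2 * ∫ θ in a..b, v θ ^ 2 ≤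
      ∫ θ in a..b, (if 0 < v θ then (deriv v θ) ^ 2 else 0) := by
  have key : ∀ ε > 0, lam ^ 2 * ((∫ θ in a..b, v θ ^ 2) - 2 * ε * ∫ θ in a..b, v θ) ≤
      ∫ θ in a..b, (if 0 < v θ then (deriv v θ) ^ 2 else 0) := by
    intro ε hε
    refine le_trans ?_ (wirt_eps v hc h0 a b hab ha hb hd hi lam hlam hω ε hε)
    gcongr
    rw [← intervalIntegral.integral_const_mul, ← intervalIntegral.integral_sub]
    · apply intervalIntegral.integral_mono_on hab
      · exact Continuous.intervalIntegrable (by fun_prop) _ _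
      · exact Continuous.intervalIntegrable (by fun_prop) _ _
      · intro x _
        rcases le_total (v x) ε with h | h
        · rw [max_eq_left (by linarith)]; nlinarith [h0 x]
        · rw [max_eq_right (by linarith)]; nlinarith [h0 x]
    · exact Continuous.intervalIntegrable (by fun_prop) _ _
    · exact Continuous.intervalIntegrable (by fun_prop) _ _
  have hlim : Filter.Tendsto (fun ε : ℝ => lam ^ 2 * ((∫ θ in a..b, v θ ^ 2) -
      2 * ε * ∫ θ in a..b, v θ)) (nhdsWithin 0 (Ioi 0)) (nhds (lam ^ 2 * ((∫ θ in a..b, v θ ^ 2) -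
      2 * 0 * ∫ θ in a..b, v θ))) := by
    apply Filter.Tendsto.mono_left _ nhdsWithin_le_nhds
    apply Continuous.tendsto
    fun_prop
  have := le_of_tendsto hlim (by
    filter_upwards [self_mem_nhdsWithin] with ε hε
    exact key ε hε)
  simpa using this

/-- Periodic version. -/
lemma wirt_per (v : ℝ → ℝ) (hc : Continuous v) (h0 : ∀ θ, 0 ≤ v θ) (l : ℝ) (hl : 0 < l)
    (hp : Function.Periodic v l) (θ₀ : ℝ) (ha : v θ₀ = 0)
    (hd : ∀ θ, 0 < v θ → DifferentiableAt ℝ v θ ∧ ContinuousAt (deriv v) θ)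
    (hi : IntervalIntegrable (fun θ => if 0 < v θ then (deriv v θ) ^ 2 else 0) volume 0 l)
    (lam : ℝ) (hlam : 0 < lam)
    (hω : lam * (∫ θ in (0:ℝ)..l, if 0 < v θ then (1:ℝ) else 0) < Real.pi) :
    lam ^ 2 * ∫ θ in (0:ℝ)..l, v θ ^ 2 ≤
      ∫ θ in (0:ℝ)..l, (if 0 < v θ then (deriv v θ) ^ 2 else 0) := by
  have hdp : Function.Periodic (deriv v) l := by
    intro x
    rw [← deriv_comp_add_const]
    congr 1
    ext y; exact hp y
  have p1 : Function.Periodic (fun θ => if 0 < v θ then (1:ℝ) else 0) l := fun x => by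
    simp only [hp x]
  have p2 : Function.Periodic (fun θ => v θ ^ 2) l := fun x => by
    simp only [hp x]
  have p3 : Function.Periodic (fun θ => if 0 < v θ then (deriv v θ) ^ 2 else 0) l := fun x => by
    simp only [hp x, hdp x]
  have e1 := p1.intervalIntegral_add_eq 0 θ₀
  have e2 := p2.intervalIntegral_add_eq 0 θ₀
  have e3 := p3.intervalIntegral_add_eq 0 θ₀
  rw [zero_add] at e1 e2 e3
  rw [e2, e3]
  rw [e1] at hω
  refine wirt v hc h0 _ _ (by linarith) ha (by rw [hp, ha]) hd ?_ lam hlam hω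
  exact p3.intervalIntegrable₀ hl.ne' hi _ _

/-- Smooth-step cutoff. -/
def acfChi (ε t : ℝ) : ℝ := max 0 (min 1 (t / ε - 1))
def acfG (ε t : ℝ) : ℝ := ∫ x in (0:ℝ)..t, acfChi ε x
def acfF (ε t : ℝ) : ℝ := ∫ x in (0:ℝ)..t, acfG ε x

lemma acfChi_cont (ε : ℝ) : Continuous (acfChi ε) := by
  unfold acfChi; fun_prop

lemma acfChi_nonneg (ε t : ℝ) : 0 ≤ acfChi ε t := le_max_left _ _

lemma acfChi_le_one (ε t : ℝ) : acfChi ε t ≤ 1 := max_le zero_le_one (min_le_left _ _)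

lemma acfChi_zero {ε t : ℝ} (hε : 0 < ε) (h : t ≤ ε) : acfChi ε t = 0 := by
  apply max_eq_left
  refine (min_le_right _ _).trans ?_
  have : t / ε ≤ 1 := (div_le_one hε).2 h
  linarith

lemma acfChi_one {ε t : ℝ} (hε : 0 < ε) (h : 2 * ε ≤ t) : acfChi ε t = 1 := by
  have : 2 ≤ t / ε := (le_div_iff₀ hε).2 h
  unfold acfChi
  rw [min_eq_left (by linarith), max_eq_right zero_le_one]

lemma acfG_deriv (ε t : ℝ) : HasDerivAt (acfG ε) (acfChi ε t) t :=
  ((acfChi_cont ε).integral_hasStrictDerivAt 0 t).hasDerivAt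

lemma acfG_cont (ε : ℝ) : Continuous (acfG ε) :=
  continuous_iff_continuousAt.2 fun t => (acfG_deriv ε t).continuousAt

lemma acfF_deriv (ε t : ℝ) : HasDerivAt (acfF ε) (acfG ε t) t :=
  ((acfG_cont ε).integral_hasStrictDerivAt 0 t).hasDerivAt

lemma acfF_cont (ε : ℝ) : Continuous (acfF ε) :=
  continuous_iff_continuousAt.2 fun t => (acfF_deriv ε t).continuousAt

lemma acfG_zero {ε t : ℝ} (hε : 0 < ε) (h : t ≤ ε) : acfG ε t = 0 := by
  unfold acfG
  have : EqOn (acfChi ε) (fun _ => 0) (uIcc 0 t) := fun x hx =>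
    acfChi_zero hε (hx.2.trans (max_le hε.le h))
  rw [intervalIntegral.integral_congr this]; simp

lemma acfF_zero {ε t : ℝ} (hε : 0 < ε) (h : t ≤ ε) : acfF ε t = 0 := by
  unfold acfF
  have : EqOn (acfG ε) (fun _ => 0) (uIcc 0 t) := fun x hx =>
    acfG_zero hε (hx.2.trans (max_le hε.le h))
  rw [intervalIntegral.integral_congr this]; simp

lemma acfG_mono (ε : ℝ) : Monotone (acfG ε) :=
  monotone_of_hasDerivAt_nonneg (f' := acfChi ε) (acfG_deriv ε) (acfChi_nonneg ε)

lemma acfG_nonneg {ε : ℝ} (hε : 0 < ε) (t : ℝ) : 0 ≤ acfG ε t := by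
  rcases le_total t ε with h | h
  · rw [acfG_zero hε h]
  · rw [← acfG_zero hε (le_refl ε)]; exact acfG_mono ε h

lemma acfF_mono {ε : ℝ} (hε : 0 < ε) : Monotone (acfF ε) :=
  monotone_of_hasDerivAt_nonneg (f' := acfG ε) (acfF_deriv ε) (acfG_nonneg hε)

lemma acfG_le {ε t : ℝ} (ht : 0 ≤ t) : acfG ε t ≤ t := by
  have : acfG ε t ≤ ∫ x in (0:ℝ)..t, (1:ℝ) :=
    intervalIntegral.integral_mono_on ht ((acfChi_cont ε).intervalIntegrable _ _)
      (by simp) (fun x _ => acfChi_le_one ε x)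
  simpa using this

def acfUr (u : ℝ → ℝ → ℝ) (p : ℝ × ℝ) : ℝ := deriv (fun s => u s p.2) p.1
def acfUt (u : ℝ → ℝ → ℝ) (p : ℝ × ℝ) : ℝ := deriv (fun φ => u p.1 φ) p.2

section phase
variable {l : ℝ} {u : ℝ → ℝ → ℝ}

lemma acf_contAt (h : ACFPhase l u) {p : ℝ × ℝ} (h0 : 0 < p.1) (h1 : p.1 < 1) :
    ContinuousAt (fun p : ℝ × ℝ => u p.1 p.2) p := by
  apply h.continuous.continuousAt
  exact prod_mem_nhds (Ico_mem_nhds h0 h1) Filter.univ_mem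

lemma acf_strip_nhds {p : ℝ × ℝ} (h0 : 0 < p.1) (h1 : p.1 < 1) :
    ∀ᶠ q : ℝ × ℝ in nhds p, 0 < q.1 ∧ q.1 < 1 := by
  have : Ioo (0:ℝ) 1 ×ˢ (univ : Set ℝ) ∈ nhds p :=
    prod_mem_nhds (Ioo_mem_nhds h0 h1) Filter.univ_mem
  filter_upwards [this] with q hq
  exact hq.1

lemma acf_pos_nhds (h : ACFPhase l u) {p : ℝ × ℝ} (h0 : 0 < p.1) (h1 : p.1 < 1)
    (hp : 0 < u p.1 p.2) :
    ∀ᶠ q : ℝ × ℝ in nhds p, 0 < q.1 ∧ q.1 < 1 ∧ 0 < u q.1 q.2 := by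
  filter_upwards [acf_strip_nhds h0 h1, (acf_contAt h h0 h1).eventually (lt_mem_nhds hp)] with q h2 h3
  exact ⟨h2.1, h2.2, h3⟩

lemma acf_small_nhds (h : ACFPhase l u) {p : ℝ × ℝ} (h0 : 0 < p.1) (h1 : p.1 < 1)
    (hp : u p.1 p.2 = 0) {ε : ℝ} (hε : 0 < ε) :
    ∀ᶠ q : ℝ × ℝ in nhds p, u q.1 q.2 ≤ ε := by
  have : u p.1 p.2 < ε := by rw [hp]; exact hε
  filter_upwards [(acf_contAt h h0 h1).eventually (gt_mem_nhds this)] with q h3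
  exact h3.le

lemma acf_cd (h : ACFPhase l u) {p : ℝ × ℝ} (h0 : 0 < p.1) (h1 : p.1 < 1)
    (hp : 0 < u p.1 p.2) : ContDiffAt ℝ 2 (fun p : ℝ × ℝ => u p.1 p.2) p :=
  h.smooth.contDiffAt (acf_pos_nhds h h0 h1 hp)

lemma acf_line1 (f : ℝ × ℝ → ℝ) {p : ℝ × ℝ} (hf : DifferentiableAt ℝ f p) :
    HasDerivAt (fun s => f (s, p.2)) (fderiv ℝ f p (1, 0)) p.1 := by
  have h1 : HasDerivAt (fun s : ℝ => (s, p.2)) ((1:ℝ), (0:ℝ)) p.1 :=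
    (hasDerivAt_id p.1).prodMk (hasDerivAt_const _ _)
  exact HasFDerivAt.comp_hasDerivAt (f := fun s : ℝ => (s, p.2)) p.1 hf.hasFDerivAt h1

lemma acf_line2 (f : ℝ × ℝ → ℝ) {p : ℝ × ℝ} (hf : DifferentiableAt ℝ f p) :
    HasDerivAt (fun s => f (p.1, s)) (fderiv ℝ f p (0, 1)) p.2 := by
  have h1 : HasDerivAt (fun s : ℝ => (p.1, s)) ((0:ℝ), (1:ℝ)) p.2 :=
    (hasDerivAt_const _ _).prodMk (hasDerivAt_id p.2)
  exact HasFDerivAt.comp_hasDerivAt (f := fun s : ℝ => (p.1, s)) p.2 hf.hasFDerivAt h1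

lemma acf_ur_cd (h : ACFPhase l u) {p : ℝ × ℝ} (h0 : 0 < p.1) (h1 : p.1 < 1)
    (hp : 0 < u p.1 p.2) : ContDiffAt ℝ 1 (acfUr u) p := by
  have h2 : ContDiffAt ℝ 1 (fun q => fderiv ℝ (fun p : ℝ × ℝ => u p.1 p.2) q (1, 0)) p :=
    ((acf_cd h h0 h1 hp).fderiv_right (m := 1) (by norm_num)).clm_apply contDiffAt_const
  refine h2.congr_of_eventuallyEq ?_
  filter_upwards [acf_pos_nhds h h0 h1 hp] with q hq
  exact (acf_line1 _ ((acf_cd h hq.1 hq.2.1 hq.2.2).differentiableAt (by norm_num))).deriv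

lemma acf_ut_cd (h : ACFPhase l u) {p : ℝ × ℝ} (h0 : 0 < p.1) (h1 : p.1 < 1)
    (hp : 0 < u p.1 p.2) : ContDiffAt ℝ 1 (acfUt u) p := by
  have h2 : ContDiffAt ℝ 1 (fun q => fderiv ℝ (fun p : ℝ × ℝ => u p.1 p.2) q (0, 1)) p :=
    ((acf_cd h h0 h1 hp).fderiv_right (m := 1) (by norm_num)).clm_apply contDiffAt_const
  refine h2.congr_of_eventuallyEq ?_
  filter_upwards [acf_pos_nhds h h0 h1 hp] with q hq
  exact (acf_line2 _ ((acf_cd h hq.1 hq.2.1 hq.2.2).differentiableAt (by norm_num))).deriv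

lemma acf_u_d1 (h : ACFPhase l u) {p : ℝ × ℝ} (h0 : 0 < p.1) (h1 : p.1 < 1)
    (hp : 0 < u p.1 p.2) : HasDerivAt (fun s => u s p.2) (acfUr u p) p.1 :=
  (acf_line1 _ ((acf_cd h h0 h1 hp).differentiableAt (by norm_num))).differentiableAt.hasDerivAt

lemma acf_u_d2 (h : ACFPhase l u) {p : ℝ × ℝ} (h0 : 0 < p.1) (h1 : p.1 < 1)
    (hp : 0 < u p.1 p.2) : HasDerivAt (fun s => u p.1 s) (acfUt u p) p.2 :=
  (acf_line2 _ ((acf_cd h h0 h1 hp).differentiableAt (by norm_num))).differentiableAt.hasDerivAt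

def acfFlux (ε : ℝ) (u : ℝ → ℝ → ℝ) (p : ℝ × ℝ) : ℝ := acfG ε (u p.1 p.2) * acfUr u p * p.1
def acfFlux2 (ε : ℝ) (u : ℝ → ℝ → ℝ) (p : ℝ × ℝ) : ℝ := acfG ε (u p.1 p.2) * acfUt u p / p.1

lemma acfFlux_diff (h : ACFPhase l u) {ε : ℝ} (hε : 0 < ε) {p : ℝ × ℝ} (h0 : 0 < p.1)
    (h1 : p.1 < 1) : DifferentiableAt ℝ (acfFlux ε u) p := by
  rcases (h.nonneg p.1 ⟨h0.le, h1⟩ p.2).eq_or_lt with hp | hp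
  · refine (differentiableAt_const (0:ℝ)).congr_of_eventuallyEq ?_
    filter_upwards [acf_small_nhds h h0 h1 hp.symm hε] with q hq
    simp [acfFlux, acfG_zero hε hq]
  · have hU := (acf_cd h h0 h1 hp).differentiableAt (by norm_num)
    have hr := (acf_ur_cd h h0 h1 hp).differentiableAt (by norm_num)
    have hG : DifferentiableAt ℝ (fun q : ℝ × ℝ => acfG ε (u q.1 q.2)) p :=
      DifferentiableAt.comp (g := acfG ε) p (acfG_deriv ε _).differentiableAt hU
    exact (hG.mul hr).mul differentiableAt_fst

lemma acfFlux2_diff (h : ACFPhase l u) {ε : ℝ} (hε : 0 < ε) {p : ℝ × ℝ} (h0 : 0 < p.1)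
    (h1 : p.1 < 1) : DifferentiableAt ℝ (acfFlux2 ε u) p := by
  rcases (h.nonneg p.1 ⟨h0.le, h1⟩ p.2).eq_or_lt with hp | hp
  · refine (differentiableAt_const (0:ℝ)).congr_of_eventuallyEq ?_
    filter_upwards [acf_small_nhds h h0 h1 hp.symm hε] with q hq
    simp [acfFlux2, acfG_zero hε hq]
  · have hU := (acf_cd h h0 h1 hp).differentiableAt (by norm_num)
    have hr := (acf_ut_cd h h0 h1 hp).differentiableAt (by norm_num)
    have hG : DifferentiableAt ℝ (fun q : ℝ × ℝ => acfG ε (u q.1 q.2)) p :=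
      DifferentiableAt.comp (g := acfG ε) p (acfG_deriv ε _).differentiableAt hU
    have hinv : DifferentiableAt ℝ (fun q : ℝ × ℝ => q.1⁻¹) p :=
      DifferentiableAt.comp (g := fun x : ℝ => x⁻¹) p (differentiableAt_inv h0.ne')
        differentiableAt_fst
    have := (hG.mul hr).mul hinv
    exact this

lemma acf_div (h : ACFPhase l u) {ε : ℝ} (hε : 0 < ε) {p : ℝ × ℝ} (h0 : 0 < p.1)
    (h1 : p.1 < 1) : fderiv ℝ (acfFlux ε u) p (1, 0) + fderiv ℝ (acfFlux2 ε u) p (0, 1) =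
      acfChi ε (u p.1 p.2) * acfIntegrand u p := by
  rcases (h.nonneg p.1 ⟨h0.le, h1⟩ p.2).eq_or_lt with hp | hp
  · have e1 : acfFlux ε u =ᶠ[nhds p] fun _ => 0 := by
      filter_upwards [acf_small_nhds h h0 h1 hp.symm hε] with q hq
      simp [acfFlux, acfG_zero hε hq]
    have e2 : acfFlux2 ε u =ᶠ[nhds p] fun _ => 0 := by
      filter_upwards [acf_small_nhds h h0 h1 hp.symm hε] with q hq
      simp [acfFlux2, acfG_zero hε hq]
    rw [e1.fderiv_eq, e2.fderiv_eq, ← hp, acfChi_zero hε hε.le]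
    simp
  · have d1 := acf_line1 _ (acfFlux_diff h hε h0 h1)
    have d2 := acf_line2 _ (acfFlux2_diff h hε h0 h1)
    have r1 := (acf_line1 _ ((acf_ur_cd h h0 h1 hp).differentiableAt (by norm_num))).differentiableAt.hasDerivAt
    have t1 := (acf_line2 _ ((acf_ut_cd h h0 h1 hp).differentiableAt (by norm_num))).differentiableAt.hasDerivAt
    have g1 : HasDerivAt (fun s => acfG ε (u s p.2)) _ p.1 :=
      (acfG_deriv ε _).comp p.1 (acf_u_d1 h h0 h1 hp)
    have g2 : HasDerivAt (fun s => acfG ε (u p.1 s)) _ p.2 :=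
      (acfG_deriv ε _).comp p.2 (acf_u_d2 h h0 h1 hp)
    have D1 := d1.unique ((g1.mul r1).mul (hasDerivAt_id p.1))
    have D2 := d2.unique ((g2.mul t1).div_const p.1)
    rw [D1, D2]
    have hL := h.laplace p.1 p.2 h0 h1 hp
    have hL' : deriv (fun s => acfUr u (s, p.2)) p.1 + (1 / p.1) * acfUr u p
      + (1 / p.1 ^ 2) * deriv (fun s => acfUt u (p.1, s)) p.2 = 0 := hL
    have hI : acfIntegrand u p = ((acfUr u p) ^ 2 + (acfUt u p) ^ 2 / p.1 ^ 2) * p.1 := by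
      rw [acfIntegrand, if_pos ⟨h0, hp⟩]; rfl
    rw [hI]
    have e1 : acfUr u (p.1, p.2) = acfUr u p := rfl
    have e2 : acfUt u (p.1, p.2) = acfUt u p := rfl
    simp only [Pi.mul_apply, e1, e2]
    generalize deriv (fun s => acfUr u (s, p.2)) p.1 = A at *
    generalize deriv (fun s => acfUt u (p.1, s)) p.2 = B at *
    have hA : A = -(1 / p.1) * acfUr u p - (1 / p.1 ^ 2) * B := by linarith
    rw [hA]
    field_simp
    ring

lemma acf_dens_cont (h : ACFPhase l u) {ε : ℝ} (hε : 0 < ε) {p : ℝ × ℝ} (h0 : 0 < p.1)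
    (h1 : p.1 < 1) :
    ContinuousAt (fun p : ℝ × ℝ => acfChi ε (u p.1 p.2) * acfIntegrand u p) p := by
  rcases (h.nonneg p.1 ⟨h0.le, h1⟩ p.2).eq_or_lt with hp | hp
  · refine continuousAt_const.congr (f := fun _ => (0:ℝ)) ?_
    filter_upwards [acf_small_nhds h h0 h1 hp.symm hε] with q hq
    simp [acfChi_zero hε hq]
  · have hr := (acf_ur_cd h h0 h1 hp).continuousAt
    have ht := (acf_ut_cd h h0 h1 hp).continuousAt
    have hU := acf_contAt h h0 h1
    have hC : ContinuousAt (fun q : ℝ × ℝ => acfChi ε (u q.1 q.2)) p :=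
      ContinuousAt.comp (g := acfChi ε) (acfChi_cont ε).continuousAt hU
    refine ContinuousAt.congr (f := fun q : ℝ × ℝ => acfChi ε (u q.1 q.2) *
      (((acfUr u q) ^ 2 + (acfUt u q) ^ 2 / q.1 ^ 2) * q.1)) ?_ ?_
    · refine hC.mul (((hr.pow 2).add ((ht.pow 2).div (continuousAt_fst.pow 2) ?_)).mul
        continuousAt_fst)
      exact pow_ne_zero 2 h0.ne'
    · filter_upwards [acf_pos_nhds h h0 h1 hp] with q hq
      rw [acfIntegrand, if_pos ⟨hq.1, hq.2.2⟩]; rfl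

lemma acfIntegrand_nonneg (u : ℝ → ℝ → ℝ) (p : ℝ × ℝ) : 0 ≤ acfIntegrand u p := by
  unfold acfIntegrand
  split_ifs with h
  · have := h.1; positivity
  · exact le_rfl

lemma acfUt_per (h : ACFPhase l u) (r θ : ℝ) : acfUt u (r, θ + l) = acfUt u (r, θ) := by
  unfold acfUt
  simp only
  rw [← deriv_comp_add_const]
  congr 1
  ext y; exact h.periodic r y

def acfH (ε : ℝ) (l : ℝ) (u : ℝ → ℝ → ℝ) (r : ℝ) : ℝ := ∫ θ in (0:ℝ)..l, acfFlux ε u (r, θ)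

lemma acf_flux (hl : 0 < l) (h : ACFPhase l u) {ε : ℝ} (hε : 0 < ε) {r₁ r₂ : ℝ} (h0 : 0 < r₁)
    (h12 : r₁ ≤ r₂) (h1 : r₂ < 1) :
    ∫ p in Icc (r₁, (0:ℝ)) (r₂, l), acfChi ε (u p.1 p.2) * acfIntegrand u p =
      acfH ε l u r₂ - acfH ε l u r₁ := by
  have hb : ∀ p ∈ Icc (r₁, (0:ℝ)) (r₂, l), 0 < p.1 ∧ p.1 < 1 := fun p hp =>
    ⟨h0.trans_le hp.1.1, hp.2.1.trans_lt h1⟩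
  have hb' : ∀ p ∈ Ioo r₁ r₂ ×ˢ Ioo 0 l, 0 < p.1 ∧ p.1 < 1 := fun p hp =>
    ⟨h0.trans hp.1.1, hp.1.2.trans h1⟩
  have key := integral_divergence_prod_Icc_of_hasFDerivAt_of_le (acfFlux ε u) (acfFlux2 ε u)
    (fun p => fderiv ℝ (acfFlux ε u) p) (fun p => fderiv ℝ (acfFlux2 ε u) p) (r₁, 0) (r₂, l)
    ⟨h12, hl.le⟩
    (fun p hp => (acfFlux_diff h hε (hb p hp).1 (hb p hp).2).continuousAt.continuousWithinAt)
    (fun p hp => (acfFlux2_diff h hε (hb p hp).1 (hb p hp).2).continuousAt.continuousWithinAt)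
    (fun p hp => (acfFlux_diff h hε (hb' p hp).1 (hb' p hp).2).hasFDerivAt)
    (fun p hp => (acfFlux2_diff h hε (hb' p hp).1 (hb' p hp).2).hasFDerivAt)
    (by
      have hc : ContinuousOn (fun p : ℝ × ℝ => acfChi ε (u p.1 p.2) * acfIntegrand u p)
          (Icc (r₁, (0:ℝ)) (r₂, l)) := fun p hp =>
        (acf_dens_cont h hε (hb p hp).1 (hb p hp).2).continuousWithinAt
      refine (hc.integrableOn_compact isCompact_Icc).congr_fun ?_ measurableSet_Icc
      intro p hp
      exact (acf_div h hε (hb p hp).1 (hb p hp).2).symm)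
  have e : ∫ p in Icc (r₁, (0:ℝ)) (r₂, l), acfChi ε (u p.1 p.2) * acfIntegrand u p =
      ∫ p in Icc (r₁, (0:ℝ)) (r₂, l), (fderiv ℝ (acfFlux ε u) p (1, 0) +
        fderiv ℝ (acfFlux2 ε u) p (0, 1)) :=
    setIntegral_congr_fun measurableSet_Icc
      (fun p hp => (acf_div h hε (hb p hp).1 (hb p hp).2).symm)
  rw [e, key]
  have e2 : ∀ x, acfFlux2 ε u (x, l) = acfFlux2 ε u (x, 0) := fun x => by
    have h1 := h.periodic x 0
    have h2 := acfUt_per h x 0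
    rw [zero_add] at h1 h2
    simp only [acfFlux2, h1, h2]
  simp only [e2, sub_self, zero_add, acfH]

lemma acfH_mono (hl : 0 < l) (h : ACFPhase l u) {ε : ℝ} (hε : 0 < ε) {r₁ r₂ : ℝ} (h0 : 0 < r₁)
    (h12 : r₁ ≤ r₂) (h1 : r₂ < 1) : acfH ε l u r₁ ≤ acfH ε l u r₂ := by
  rw [← sub_nonneg, ← acf_flux hl h hε h0 h12 h1]
  exact integral_nonneg fun p => mul_nonneg (acfChi_nonneg _ _) (acfIntegrand_nonneg _ _)

lemma acf_m (h : ACFPhase l u) {ε : ℝ} (hε : 0 < ε) {r₁ r₂ : ℝ} (h0 : 0 < r₁)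
    (h12 : r₁ ≤ r₂) (h1 : r₂ < 1) :
    ∫ s in r₁..r₂, acfH ε l u s * s⁻¹ =
      (∫ θ in (0:ℝ)..l, acfF ε (u r₂ θ)) - ∫ θ in (0:ℝ)..l, acfF ε (u r₁ θ) := by
  have hd : ∀ p : ℝ × ℝ, 0 < p.1 → p.1 < 1 →
      DifferentiableAt ℝ (fun p : ℝ × ℝ => acfF ε (u p.1 p.2)) p := by
    intro p h0 h1
    rcases (h.nonneg p.1 ⟨h0.le, h1⟩ p.2).eq_or_lt with hp | hp
    · refine (differentiableAt_const (0:ℝ)).congr_of_eventuallyEq ?_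
      filter_upwards [acf_small_nhds h h0 h1 hp.symm hε] with q hq
      exact acfF_zero hε hq
    · exact DifferentiableAt.comp (g := acfF ε) p (acfF_deriv ε _).differentiableAt
        ((acf_cd h h0 h1 hp).differentiableAt (by norm_num))
  have hv : ∀ p : ℝ × ℝ, 0 < p.1 → p.1 < 1 →
      fderiv ℝ (fun p : ℝ × ℝ => acfF ε (u p.1 p.2)) p (1, 0) = acfFlux ε u p * p.1⁻¹ := by
    intro p h0 h1
    rcases (h.nonneg p.1 ⟨h0.le, h1⟩ p.2).eq_or_lt with hp | hp
    · have e1 : (fun p : ℝ × ℝ => acfF ε (u p.1 p.2)) =ᶠ[nhds p] fun _ => 0 := by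
        filter_upwards [acf_small_nhds h h0 h1 hp.symm hε] with q hq
        exact acfF_zero hε hq
      rw [e1.fderiv_eq, acfFlux, ← hp, acfG_zero hε hε.le]
      simp
    · have d1 := acf_line1 _ (hd p h0 h1)
      have g1 : HasDerivAt (fun s => acfF ε (u s p.2)) _ p.1 :=
        (acfF_deriv ε _).comp p.1 (acf_u_d1 h h0 h1 hp)
      rw [d1.unique g1, acfFlux]
      field_simp
  have hb : ∀ p ∈ uIcc r₁ r₂ ×ˢ uIcc 0 l, 0 < p.1 ∧ p.1 < 1 := fun p hp => by
    rw [uIcc_of_le h12] at hp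
    exact ⟨h0.trans_le hp.1.1, hp.1.2.trans_lt h1⟩
  have hb' : ∀ p ∈ Ioo (min r₁ r₂) (max r₁ r₂) ×ˢ Ioo (min 0 l) (max 0 l), 0 < p.1 ∧ p.1 < 1 :=
    fun p hp => by
      rw [min_eq_left h12, max_eq_right h12] at hp
      exact ⟨h0.trans hp.1.1, hp.1.2.trans h1⟩
  have key := integral2_divergence_prod_of_hasFDerivAt (fun p : ℝ × ℝ => acfF ε (u p.1 p.2))
    (fun _ => 0) (fun p => fderiv ℝ (fun p : ℝ × ℝ => acfF ε (u p.1 p.2)) p) (fun _ => 0)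
    r₁ 0 r₂ l
    (fun p hp => (hd p (hb p hp).1 (hb p hp).2).continuousAt.continuousWithinAt)
    continuousOn_const
    (fun p hp => (hd p (hb' p hp).1 (hb' p hp).2).hasFDerivAt)
    (fun p hp => hasFDerivAt_const _ _)
    (by
      have hc : ContinuousOn (fun p : ℝ × ℝ => acfFlux ε u p * p.1⁻¹)
          (uIcc r₁ r₂ ×ˢ uIcc 0 l) := fun p hp =>
        ((acfFlux_diff h hε (hb p hp).1 (hb p hp).2).continuousAt.mul
          (continuousAt_fst.inv₀ (hb p hp).1.ne')).continuousWithinAt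
      refine (hc.integrableOn_compact (isCompact_uIcc.prod isCompact_uIcc)).congr_fun ?_
        (measurableSet_uIcc.prod measurableSet_uIcc)
      intro p hp
      simp [hv p (hb p hp).1 (hb p hp).2])
  simp only [intervalIntegral.integral_zero, sub_self, zero_add, add_zero,
    _root_.zero_apply] at key
  rw [← key]
  apply intervalIntegral.integral_congr
  intro s hs
  rw [uIcc_of_le h12] at hs
  simp only [acfH]
  rw [← intervalIntegral.integral_mul_const]
  apply intervalIntegral.integral_congr
  intro θ _
  exact (hv (s, θ) (h0.trans_le hs.1) (hs.2.trans_lt h1)).symm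

lemma acf_circ_cont (h : ACFPhase l u) {r : ℝ} (h0 : 0 < r) (h1 : r < 1) :
    Continuous (fun θ => u r θ) := by
  rw [continuous_iff_continuousAt]
  intro θ
  exact ContinuousAt.comp (f := fun θ : ℝ => (r, θ)) (g := fun p : ℝ × ℝ => u p.1 p.2)
    (acf_contAt h h0 h1) (by fun_prop)

lemma acfH_nonneg (hl : 0 < l) (h : ACFPhase l u) {ε : ℝ} (hε : 0 < ε) {r : ℝ} (h0 : 0 < r)
    (h1 : r < 1) : 0 ≤ acfH ε l u r := by
  by_contra hneg
  push Not at hneg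
  obtain ⟨δ, hδ, hu⟩ := h.vertex_unif 1 one_pos
  set M := acfF ε (u 0 0 + 1)
  set m : ℝ → ℝ := fun r => ∫ θ in (0:ℝ)..l, acfF ε (u r θ) with hm
  have hci : ∀ s, 0 < s → s < 1 → IntervalIntegrable (fun θ => acfF ε (u s θ)) volume 0 l :=
    fun s hs hs1 => ((acfF_cont ε).comp (acf_circ_cont h hs hs1)).intervalIntegrable _ _
  have hbd : ∀ s, 0 < s → s < δ → s < 1 → m s ≤ l * M := by
    intro s hs hsδ hs1
    have := intervalIntegral.integral_mono_on hl.le (hci s hs hs1)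
      (intervalIntegrable_const (c := M)) (fun θ _ => ?_)
    · simpa [hm] using this
    · apply acfF_mono hε
      have := (abs_le.1 (hu s ⟨hs, hsδ⟩ θ)).2
      linarith
  have hgrow : ∀ s, 0 < s → s ≤ r → m r - acfH ε l u r * Real.log (r / s) ≤ m s := by
    intro s hs hsr
    have e := acf_m h hε hs hsr h1
    have hmono : MonotoneOn (acfH ε l u) (uIcc s r) := by
      rw [uIcc_of_le hsr]
      intro x hx y hy hxy
      exact acfH_mono hl h hε (hs.trans_le hx.1) hxy (hy.2.trans_lt h1)
    have hinv : ContinuousOn (fun x : ℝ => x⁻¹) (uIcc s r) := by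
      rw [uIcc_of_le hsr]
      exact continuousOn_inv₀.mono fun x hx => (hs.trans_le hx.1).ne'
    have h2 : ∫ x in s..r, acfH ε l u x * x⁻¹ ≤ ∫ x in s..r, acfH ε l u r * x⁻¹ := by
      apply intervalIntegral.integral_mono_on hsr
      · exact hmono.intervalIntegrable.mul_continuousOn hinv
      · exact (continuousOn_const.mul hinv).intervalIntegrable
      · intro x hx
        have hx0 := hs.trans_le hx.1
        have := acfH_mono hl h hε hx0 hx.2 h1
        gcongr
    rw [intervalIntegral.integral_const_mul, integral_inv_of_pos hs h0, e] at h2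
    simp only [hm]; linarith
  have hlim : Filter.Tendsto (fun s : ℝ => m r - acfH ε l u r * Real.log (r / s))
      (nhdsWithin 0 (Ioi 0)) Filter.atTop := by
    have t1 : Filter.Tendsto (fun s : ℝ => Real.log (r / s)) (nhdsWithin 0 (Ioi 0)) Filter.atTop := by
      apply Real.tendsto_log_atTop.comp
      have tt : Filter.Tendsto (fun s : ℝ => r * s⁻¹) (nhdsWithin 0 (Ioi 0)) Filter.atTop :=
        tendsto_inv_nhdsGT_zero.const_mul_atTop h0
      exact tt.congr fun s => (div_eq_mul_inv _ _).symm
    have t2 := (t1.const_mul_atTop (neg_pos.2 hneg))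
    have t3 := Filter.tendsto_atTop_add_const_left (nhdsWithin (0:ℝ) (Ioi 0)) (m r) t2
    refine t3.congr fun s => by ring
  have hev := hlim.eventually (Filter.eventually_gt_atTop (l * M))
  have hev2 : ∀ᶠ s in nhdsWithin (0:ℝ) (Ioi 0), s ∈ Ioo 0 (min δ r) :=
    Ioo_mem_nhdsGT (lt_min hδ h0)
  obtain ⟨s, hs1, hs2⟩ := (hev.and hev2).exists
  have hsδ := hs2.2.trans_le (min_le_left _ _)
  have hsr := hs2.2.trans_le (min_le_right _ _)
  have := hgrow s hs2.1 hsr.le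
  have := hbd s hs2.1 hsδ (hsr.trans h1)
  linarith

lemma acf_energy_le (hl : 0 < l) (h : ACFPhase l u) {ε : ℝ} (hε : 0 < ε) {r₁ r₂ : ℝ} (h0 : 0 < r₁)
    (h12 : r₁ ≤ r₂) (h1 : r₂ < 1) :
    ∫ p in Icc r₁ r₂ ×ˢ Icc 0 l, acfChi ε (u p.1 p.2) * acfIntegrand u p ≤
      acfH ε l u r₂ := by
  rw [Icc_prod_Icc, acf_flux hl h hε h0 h12 h1]
  linarith [acfH_nonneg hl h hε h0 (h12.trans_lt h1)]
end phase

section phase2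
variable {l : ℝ} {u : ℝ → ℝ → ℝ}

def acfD (l : ℝ) (u : ℝ → ℝ → ℝ) (r : ℝ) : ℝ :=
  ∫ p in Set.Ioo (0:ℝ) r ×ˢ Set.Ioo (0:ℝ) l, acfIntegrand u p
def acfSlice (l : ℝ) (u : ℝ → ℝ → ℝ) (r : ℝ) : ℝ :=
  ∫ θ in Set.Ioo (0:ℝ) l, acfIntegrand u (r, θ)
def acfOm (l : ℝ) (u : ℝ → ℝ → ℝ) (r : ℝ) : ℝ :=
  ∫ θ in (0:ℝ)..l, if 0 < u r θ then (1:ℝ) else 0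

lemma acf_D_le (hl : 0 < l) (h : ACFPhase l u) {r : ℝ} (h0 : 0 < r) (h1 : r < 1)
    (hIg : IntegrableOn (acfIntegrand u) (Set.Ioo (0:ℝ) r ×ˢ Set.Ioo (0:ℝ) l)) (B : ℝ)
    (hB : ∀ ε > 0, acfH ε l u r ≤ B) : acfD l u r ≤ B := by
  set Fn : ℕ → ℝ × ℝ → ℝ := fun n => (Icc (r / (n + 1)) r ×ˢ Icc 0 l).indicator
    (fun p => acfChi (1 / (n + 1)) (u p.1 p.2) * acfIntegrand u p) with hFn
  have hpos : ∀ n : ℕ, (0:ℝ) < n + 1 := fun n => by positivity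
  have hlim : Filter.Tendsto (fun n => ∫ p in Ioo (0:ℝ) r ×ˢ Ioo (0:ℝ) l, Fn n p)
      Filter.atTop (nhds (acfD l u r)) := by
    apply tendsto_integral_of_dominated_convergence (acfIntegrand u)
    · intro n
      apply AEStronglyMeasurable.indicator _ (measurableSet_Icc.prod measurableSet_Icc)
      apply ContinuousOn.aestronglyMeasurable _ (measurableSet_Ioo.prod measurableSet_Ioo)
      intro p hp
      exact (acf_dens_cont h (by have := hpos n; positivity) hp.1.1
        (hp.1.2.trans h1)).continuousWithinAt
    · exact hIg
    · intro n
      refine Filter.Eventually.of_forall fun p => ?_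
      have hc0 := acfChi_nonneg (1 / ((n:ℝ) + 1)) (u p.1 p.2)
      have hc1 := acfChi_le_one (1 / ((n:ℝ) + 1)) (u p.1 p.2)
      have hi0 := acfIntegrand_nonneg u p
      simp only [hFn, indicator]
      split_ifs
      · rw [Real.norm_eq_abs, abs_of_nonneg (mul_nonneg hc0 hi0)]
        exact mul_le_of_le_one_left hi0 hc1
      · simpa using hi0
    · rw [ae_restrict_iff' (measurableSet_Ioo.prod measurableSet_Ioo)]
      refine Filter.Eventually.of_forall fun p hp => ?_
      apply tendsto_const_nhds.congr'
      have t1 : ∀ᶠ n : ℕ in Filter.atTop, r / ((n:ℝ) + 1) < p.1 := by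
        have : Filter.Tendsto (fun n : ℕ => r * (1 / ((n:ℝ) + 1))) Filter.atTop (nhds (r * 0)) :=
          tendsto_one_div_add_atTop_nhds_zero_nat.const_mul r
        rw [mul_zero] at this
        filter_upwards [this.eventually (gt_mem_nhds hp.1.1)] with n hn
        rwa [mul_one_div] at hn
      by_cases hu : 0 < u p.1 p.2
      · have t2 : ∀ᶠ n : ℕ in Filter.atTop, 1 / ((n:ℝ) + 1) < u p.1 p.2 / 2 :=
          tendsto_one_div_add_atTop_nhds_zero_nat.eventually (gt_mem_nhds (by linarith))
        filter_upwards [t1, t2] with n h1 h2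
        simp only [hFn]
        rw [indicator_of_mem, acfChi_one (by have := hpos n; positivity) (by linarith), one_mul]
        exact ⟨⟨h1.le, hp.1.2.le⟩, ⟨hp.2.1.le, hp.2.2.le⟩⟩
      · have hz : acfIntegrand u p = 0 := by
          rw [acfIntegrand, if_neg]; tauto
        refine Filter.Eventually.of_forall fun n => ?_
        simp [hFn, indicator, hz]
  refine le_of_tendsto hlim (Filter.Eventually.of_forall fun n => ?_)
  have hn := hpos n
  have hε : (0:ℝ) < 1 / (n + 1) := by positivity
  have hr1 : 0 < r / ((n:ℝ) + 1) := by positivity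
  have hr2 : r / ((n:ℝ) + 1) ≤ r := div_le_self h0.le (by linarith [Nat.cast_nonneg (α := ℝ) n])
  refine le_trans ?_ ((acf_energy_le hl h hε hr1 hr2 h1).trans (hB _ hε))
  simp only [hFn]
  rw [setIntegral_indicator (measurableSet_Icc.prod measurableSet_Icc)]
  apply setIntegral_mono_set
  · apply ContinuousOn.integrableOn_compact (isCompact_Icc.prod isCompact_Icc)
    intro p hp
    exact (acf_dens_cont h hε (hr1.trans_le hp.1.1) (hp.1.2.trans_lt h1)).continuousWithinAt
  · exact Filter.Eventually.of_forall fun p =>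
      mul_nonneg (acfChi_nonneg _ _) (acfIntegrand_nonneg _ _)
  · exact Filter.Eventually.of_forall fun p hp => hp.2

lemma acf_D_zero (hl : 0 < l) (h : ACFPhase l u) {r : ℝ} (h0 : 0 < r) (h1 : r < 1)
    (hIg : IntegrableOn (acfIntegrand u) (Set.Ioo (0:ℝ) r ×ˢ Set.Ioo (0:ℝ) l))
    (hz : ∀ θ, u r θ = 0) : acfD l u r ≤ 0 := by
  apply acf_D_le hl h h0 h1 hIg
  intro ε hε
  simp [acfH, acfFlux, hz, acfG_zero hε hε.le]

lemma acf_slice_lam (hl : 0 < l) (h : ACFPhase l u) {r : ℝ} (h0 : 0 < r) (h1 : r < 1)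
    (hIg : IntegrableOn (acfIntegrand u) (Set.Ioo (0:ℝ) r ×ˢ Set.Ioo (0:ℝ) l))
    (hsl : IntegrableOn (fun θ => acfIntegrand u (r, θ)) (Ioo 0 l))
    (θ₀ : ℝ) (hz : u r θ₀ = 0) (lam : ℝ) (hlam : 0 < lam) (hω : lam * acfOm l u r < Real.pi) :
    2 * lam * acfD l u r ≤ r * acfSlice l u r := by
  have hvc := acf_circ_cont h h0 h1
  have hv0 : ∀ θ, 0 ≤ u r θ := h.nonneg r ⟨h0.le, h1⟩
  set A : ℝ → ℝ := fun θ => if 0 < u r θ then (acfUr u (r, θ)) ^ 2 else 0 with hA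
  set B : ℝ → ℝ := fun θ => if 0 < u r θ then (acfUt u (r, θ)) ^ 2 else 0 with hB
  have hI : ∀ θ, acfIntegrand u (r, θ) = r * A θ + r⁻¹ * B θ := by
    intro θ
    simp only [acfIntegrand, hA, hB]
    by_cases hp : 0 < u r θ
    · simp only [h0, hp, and_self, if_true, acfUr, acfUt]
      field_simp
    · simp [hp]
  have hA0 : ∀ θ, 0 ≤ A θ := fun θ => by simp only [hA]; split_ifs <;> positivity
  have hB0 : ∀ θ, 0 ≤ B θ := fun θ => by simp only [hB]; split_ifs <;> positivity
  have hopen : IsOpen {θ | 0 < u r θ} := isOpen_lt continuous_const hvc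
  have hpair : ∀ θ : ℝ, ContinuousAt (fun θ : ℝ => (r, θ)) θ := fun θ => by fun_prop
  have hur : ∀ θ, 0 < u r θ → ContinuousAt (fun θ => acfUr u (r, θ)) θ := fun θ hp =>
    ContinuousAt.comp (f := fun θ : ℝ => (r, θ)) (g := acfUr u)
      (acf_ur_cd h (p := (r, θ)) h0 h1 hp).continuousAt (hpair θ)
  have hut : ∀ θ, 0 < u r θ → ContinuousAt (fun θ => acfUt u (r, θ)) θ := fun θ hp =>
    ContinuousAt.comp (f := fun θ : ℝ => (r, θ)) (g := acfUt u)
      (acf_ut_cd h (p := (r, θ)) h0 h1 hp).continuousAt (hpair θ)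
  have hAm : AEStronglyMeasurable A volume := by
    have : A = {θ | 0 < u r θ}.indicator (fun θ => (acfUr u (r, θ)) ^ 2) := by
      ext θ; simp [hA, indicator]
    rw [this, aestronglyMeasurable_indicator_iff hopen.measurableSet]
    apply ContinuousOn.aestronglyMeasurable _ hopen.measurableSet
    exact fun θ hp => ((hur θ hp).pow 2).continuousWithinAt
  have hBm : AEStronglyMeasurable B volume := by
    have : B = {θ | 0 < u r θ}.indicator (fun θ => (acfUt u (r, θ)) ^ 2) := by
      ext θ; simp [hB, indicator]
    rw [this, aestronglyMeasurable_indicator_iff hopen.measurableSet]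
    apply ContinuousOn.aestronglyMeasurable _ hopen.measurableSet
    exact fun θ hp => ((hut θ hp).pow 2).continuousWithinAt
  have hIi : IntervalIntegrable (fun θ => acfIntegrand u (r, θ)) volume 0 l :=
    (intervalIntegrable_iff_integrableOn_Ioo_of_le hl.le).2 hsl
  have hAi : IntervalIntegrable A volume 0 l := by
    refine (hIi.const_mul r⁻¹).mono_fun hAm.restrict ?_
    refine Filter.Eventually.of_forall fun θ => ?_
    have hr : 0 < r⁻¹ := inv_pos.2 h0
    have h2 : r⁻¹ * acfIntegrand u (r, θ) = A θ + r⁻¹ * (r⁻¹ * B θ) := by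
      rw [hI]; field_simp
    have h3 : 0 ≤ r⁻¹ * (r⁻¹ * B θ) := by have := hB0 θ; positivity
    simp only [h2]
    rw [Real.norm_eq_abs, Real.norm_eq_abs, abs_of_nonneg (hA0 θ),
      abs_of_nonneg (add_nonneg (hA0 θ) h3)]
    linarith
  have hBi : IntervalIntegrable B volume 0 l := by
    refine (hIi.const_mul r).mono_fun hBm.restrict ?_
    refine Filter.Eventually.of_forall fun θ => ?_
    have h2 : r * acfIntegrand u (r, θ) = r * (r * A θ) + B θ := by
      rw [hI]; field_simp
    have h3 : 0 ≤ r * (r * A θ) := by have := hA0 θ; positivity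
    simp only [h2]
    rw [Real.norm_eq_abs, Real.norm_eq_abs, abs_of_nonneg (hB0 θ),
      abs_of_nonneg (add_nonneg h3 (hB0 θ))]
    linarith
  have hW : lam ^ 2 * ∫ θ in (0:ℝ)..l, u r θ ^ 2 ≤ ∫ θ in (0:ℝ)..l, B θ := by
    refine wirt_per (fun θ => u r θ) hvc hv0 l hl (h.periodic r) θ₀ hz ?_ hBi lam hlam hω
    intro θ hp
    exact ⟨(acf_u_d2 h (p := (r, θ)) h0 h1 hp).differentiableAt, hut θ hp⟩
  have hS : acfSlice l u r = r * (∫ θ in (0:ℝ)..l, A θ) + r⁻¹ * ∫ θ in (0:ℝ)..l, B θ := by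
    rw [acfSlice, ← integral_Ioc_eq_integral_Ioo, ← intervalIntegral.integral_of_le hl.le,
      ← intervalIntegral.integral_const_mul, ← intervalIntegral.integral_const_mul,
      ← intervalIntegral.integral_add (hAi.const_mul _) (hBi.const_mul _)]
    simp only [hI]
  have hD : acfD l u r ≤ r / (2 * lam) * acfSlice l u r := by
    apply acf_D_le hl h h0 h1 hIg
    intro ε hε
    have hv2 : IntervalIntegrable (fun θ => lam / 2 * u r θ ^ 2) volume 0 l :=
      Continuous.intervalIntegrable (by fun_prop) _ _
    have hle : acfH ε l u r ≤ ∫ θ in (0:ℝ)..l, (lam / 2 * u r θ ^ 2 + r ^ 2 / (2 * lam) * A θ) := by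
      apply intervalIntegral.integral_mono_on hl.le
      · apply Continuous.intervalIntegrable
        rw [continuous_iff_continuousAt]
        intro θ
        exact ContinuousAt.comp (f := fun θ : ℝ => (r, θ)) (g := acfFlux ε u)
          (acfFlux_diff h (p := (r, θ)) hε h0 h1).continuousAt (hpair θ)
      · exact hv2.add (hAi.const_mul _)
      · intro θ _
        simp only [acfFlux]
        by_cases hp : 0 < u r θ
        · have hAθ : A θ = (acfUr u (r, θ)) ^ 2 := by simp [hA, hp]
          rw [hAθ]
          have g1 := acfG_nonneg hε (u r θ)
          have g2 : acfG ε (u r θ) ≤ u r θ := acfG_le hp.le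
          generalize acfG ε (u r θ) = g at *
          generalize acfUr u (r, θ) = y at *
          have e1 : lam / 2 * u r θ ^ 2 + r ^ 2 / (2 * lam) * y ^ 2 - g * y * r =
              (lam ^ 2 * (u r θ ^ 2 - g ^ 2) + (lam * g - r * y) ^ 2) / (2 * lam) := by
            field_simp; ring
          have e2 : 0 ≤ u r θ ^ 2 - g ^ 2 := by nlinarith
          have e3 : 0 ≤ (lam ^ 2 * (u r θ ^ 2 - g ^ 2) + (lam * g - r * y) ^ 2) / (2 * lam) := by
            positivity
          linarith
        · have hz0 : u r θ = 0 := le_antisymm (not_lt.1 hp) (hv0 θ)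
          have := hA0 θ
          rw [hz0, acfG_zero hε hε.le]
          simp only [zero_mul]
          positivity
    rw [intervalIntegral.integral_add hv2 (hAi.const_mul _), intervalIntegral.integral_const_mul,
      intervalIntegral.integral_const_mul] at hle
    refine hle.trans ?_
    rw [hS]
    have : r / (2 * lam) * (r * (∫ θ in (0:ℝ)..l, A θ) + r⁻¹ * ∫ θ in (0:ℝ)..l, B θ) -
      (lam / 2 * (∫ θ in (0:ℝ)..l, u r θ ^ 2) + r ^ 2 / (2 * lam) * ∫ θ in (0:ℝ)..l, A θ) =
      ((∫ θ in (0:ℝ)..l, B θ) - lam ^ 2 * ∫ θ in (0:ℝ)..l, u r θ ^ 2) / (2 * lam) := by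
      field_simp; ring
    have h5 : 0 ≤ ((∫ θ in (0:ℝ)..l, B θ) - lam ^ 2 * ∫ θ in (0:ℝ)..l, u r θ ^ 2) / (2 * lam) :=
      div_nonneg (by linarith) (by linarith)
    linarith
  calc 2 * lam * acfD l u r ≤ 2 * lam * (r / (2 * lam) * acfSlice l u r) := by gcongr
    _ = r * acfSlice l u r := by field_simp

lemma acfOm_nonneg (hl : 0 < l) (u : ℝ → ℝ → ℝ) (r : ℝ) : 0 ≤ acfOm l u r :=
  intervalIntegral.integral_nonneg hl.le (fun θ _ => by split_ifs <;> norm_num)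

lemma acf_slice (hl : 0 < l) (h : ACFPhase l u) {r : ℝ} (h0 : 0 < r) (h1 : r < 1)
    (hIg : IntegrableOn (acfIntegrand u) (Set.Ioo (0:ℝ) r ×ˢ Set.Ioo (0:ℝ) l))
    (hsl : IntegrableOn (fun θ => acfIntegrand u (r, θ)) (Ioo 0 l))
    (θ₀ : ℝ) (hz : u r θ₀ = 0) :
    2 * Real.pi * acfD l u r ≤ acfOm l u r * (r * acfSlice l u r) := by
  have key := acf_slice_lam hl h h0 h1 hIg hsl θ₀ hz
  rcases (acfOm_nonneg hl u r).eq_or_lt with hω | hω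
  · rw [← hω] at key ⊢
    rw [zero_mul]
    by_contra hc
    push Not at hc
    have hD : 0 < acfD l u r := by
      have := Real.pi_pos
      by_contra hD
      push Not at hD
      nlinarith
    have hf : 0 ≤ r * acfSlice l u r :=
      mul_nonneg h0.le (integral_nonneg fun _ => acfIntegrand_nonneg _ _)
    have := key ((r * acfSlice l u r + 1) / acfD l u r) (by positivity) (by
      rw [mul_zero]; exact Real.pi_pos)
    field_simp at this
    linarith
  · have hlim : Filter.Tendsto (fun t : ℝ => 2 * (t * Real.pi) * acfD l u r)
        (nhdsWithin 1 (Iio 1)) (nhds (2 * (1 * Real.pi) * acfD l u r)) := by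
      apply Filter.Tendsto.mono_left _ nhdsWithin_le_nhds
      apply Continuous.tendsto
      fun_prop
    rw [one_mul] at hlim
    refine le_of_tendsto hlim ?_
    filter_upwards [Ioo_mem_nhdsLT (show (0:ℝ) < 1 by norm_num)] with t ht
    have hpi := Real.pi_pos
    have := key (t * Real.pi / acfOm l u r) (by have := ht.1; positivity) (by
      rw [div_mul_cancel₀ _ hω.ne']
      nlinarith [ht.2])
    calc 2 * (t * Real.pi) * acfD l u r
        = acfOm l u r * (2 * (t * Real.pi / acfOm l u r) * acfD l u r) := by field_simp
      _ ≤ _ := by gcongr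
end phase2

lemma acf_gron (f₁ f₂ : ℝ → ℝ) (a b c : ℝ) (ha : 0 < a) (hab : a ≤ b) (hc : 0 ≤ c)
    (h1 : IntervalIntegrable f₁ volume 0 b) (h2 : IntervalIntegrable f₂ volume 0 b)
    (hae : ∀ᵐ x, x ∈ Ioc a b → c / x * ((∫ s in (0:ℝ)..x, f₁ s) * ∫ s in (0:ℝ)..x, f₂ s) ≤
      f₁ x * (∫ s in (0:ℝ)..x, f₂ s) + (∫ s in (0:ℝ)..x, f₁ s) * f₂ x) :
    a ^ (-c) * ((∫ s in (0:ℝ)..a, f₁ s) * ∫ s in (0:ℝ)..a, f₂ s) ≤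
      b ^ (-c) * ((∫ s in (0:ℝ)..b, f₁ s) * ∫ s in (0:ℝ)..b, f₂ s) := by
  have hb : 0 < b := ha.trans_le hab
  set D₁ : ℝ → ℝ := fun x => ∫ s in (0:ℝ)..x, f₁ s with hD₁
  set D₂ : ℝ → ℝ := fun x => ∫ s in (0:ℝ)..x, f₂ s with hD₂
  have ac1 : AbsolutelyContinuousOnInterval D₁ 0 b :=
    h1.absolutelyContinuousOnInterval_intervalIntegral (by simp)
  have ac2 : AbsolutelyContinuousOnInterval D₂ 0 b :=
    h2.absolutelyContinuousOnInterval_intervalIntegral (by simp)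
  have hsub : ∀ y ∈ Icc a b, uIcc a y ⊆ uIcc 0 b := by
    intro y hy
    rw [uIcc_of_le hy.1, uIcc_of_le hb.le]
    exact Icc_subset_Icc ha.le hy.2
  have hPc : ContinuousOn (fun x => D₁ x * D₂ x) (Icc a b) := by
    have := (ac1.continuousOn.mul ac2.continuousOn)
    rw [uIcc_of_le hb.le] at this
    exact this.mono (Icc_subset_Icc ha.le le_rfl)
  set k : ℝ → ℝ := fun x => c / x * (D₁ x * D₂ x) with hk
  have hkc : ContinuousOn k (Icc a b) :=
    (continuousOn_const.div continuousOn_id fun x hx => (ha.trans_le hx.1).ne').mul hPc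
  have hki : ∀ y ∈ Icc a b, IntervalIntegrable k volume a y := fun y hy => by
    apply ContinuousOn.intervalIntegrable
    rw [uIcc_of_le hy.1]
    exact hkc.mono (Icc_subset_Icc le_rfl hy.2)
  have hQP : ∀ y ∈ Icc a b, D₁ a * D₂ a + ∫ x in a..y, k x ≤ D₁ y * D₂ y := by
    intro y hy
    have a1 := ac1.mono (hsub y hy)
    have a2 := ac2.mono (hsub y hy)
    have e := a1.integral_deriv_mul_eq_sub a2
    have : ∫ x in a..y, k x ≤ ∫ x in a..y, deriv D₁ x * D₂ x + D₁ x * deriv D₂ x := by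
      apply intervalIntegral.integral_mono_ae_restrict hy.1 (hki y hy)
      · exact (a1.intervalIntegrable_deriv.mul_continuousOn a2.continuousOn).add
          (a2.intervalIntegrable_deriv.continuousOn_mul a1.continuousOn)
      · rw [Filter.EventuallyLE, ← restrict_Ioc_eq_restrict_Icc, ae_restrict_iff' measurableSet_Ioc]
        filter_upwards [hae, h1.ae_hasDerivAt_integral, h2.ae_hasDerivAt_integral] with x h3 h4 h5 hx
        have hx' : x ∈ Ioc a b := ⟨hx.1, hx.2.trans hy.2⟩
        have hx2 : x ∈ uIcc 0 b := by
          rw [uIcc_of_le hb.le]; exact ⟨(ha.trans hx.1).le, hx'.2⟩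
        have e1 : deriv D₁ x = f₁ x := (h4 hx2 0 (by simp)).deriv
        have e2 : deriv D₂ x = f₂ x := (h5 hx2 0 (by simp)).deriv
        rw [e1, e2]
        exact h3 hx'
    linarith
  set Q : ℝ → ℝ := fun y => D₁ a * D₂ a + ∫ x in a..y, k x with hQ
  have hQc : ContinuousOn Q (Icc a b) := by
    apply continuousOn_const.add
    have := intervalIntegral.continuousOn_primitive_interval
      ((intervalIntegrable_iff_integrableOn_Icc_of_le hab).1 (hki b ⟨hab, le_rfl⟩) |>.congr_set_ae
        (by rw [uIcc_of_le hab]; exact Filter.EventuallyEq.rfl))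
    rwa [uIcc_of_le hab] at this
  have hQd : ∀ y ∈ Ioo a b, HasDerivAt Q (k y) y := by
    intro y hy
    apply HasDerivAt.const_add
    apply intervalIntegral.integral_hasDerivAt_right (hki y ⟨hy.1.le, hy.2.le⟩)
    · exact (hkc.mono Ioo_subset_Icc_self).stronglyMeasurableAtFilter isOpen_Ioo y hy
    · exact hkc.continuousAt (Icc_mem_nhds hy.1 hy.2)
  have hmono : MonotoneOn (fun y => y ^ (-c) * Q y) (Icc a b) := by
    apply monotoneOn_of_hasDerivWithinAt_nonneg (convex_Icc a b)
      (f' := fun y => (-c) * y ^ (-c - 1) * Q y + y ^ (-c) * k y)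
    · refine ContinuousOn.mul ?_ hQc
      exact continuousOn_id.rpow_const fun x hx => Or.inl (ha.trans_le hx.1).ne'
    · intro y hy
      rw [interior_Icc] at hy
      have hy0 : 0 < y := ha.trans hy.1
      have := (Real.hasDerivAt_rpow_const (p := -c) (Or.inl hy0.ne')).mul (hQd y hy)
      exact this.hasDerivWithinAt
    · intro y hy
      rw [interior_Icc] at hy
      have hy0 : 0 < y := ha.trans hy.1
      have hle := hQP y ⟨hy.1.le, hy.2.le⟩
      have e : (-c) * y ^ (-c - 1) * Q y + y ^ (-c) * k y =
          c * y ^ (-c - 1) * (D₁ y * D₂ y - Q y) := by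
        simp only [hk]
        rw [Real.rpow_sub_one hy0.ne']
        field_simp
        ring
      rw [e]
      have : 0 ≤ y ^ (-c - 1) := Real.rpow_nonneg hy0.le _
      have : 0 ≤ D₁ y * D₂ y - Q y := by simp only [hQ]; linarith
      positivity
  have h5 := hmono (left_mem_Icc.2 hab) (right_mem_Icc.2 hab) hab
  have h6 := hQP b ⟨hab, le_rfl⟩
  have h7 : Q a = D₁ a * D₂ a := by simp [hQ]
  simp only [h7] at h5
  have h8 : 0 ≤ b ^ (-c) := Real.rpow_nonneg hb.le _
  exact h5.trans (mul_le_mul_of_nonneg_left h6 h8)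

section final
variable {l : ℝ} {u : ℝ → ℝ → ℝ}

lemma acf_int_prod {r : ℝ}
    (hIg : IntegrableOn (acfIntegrand u) (Set.Ioo (0:ℝ) r ×ˢ Set.Ioo (0:ℝ) l)) :
    Integrable (acfIntegrand u) ((volume.restrict (Ioo (0:ℝ) r)).prod (volume.restrict (Ioo 0 l))) := by
  rw [Measure.prod_restrict]; exact hIg

lemma acf_D_eq {r : ℝ} (h0 : 0 < r)
    (hIg : IntegrableOn (acfIntegrand u) (Set.Ioo (0:ℝ) r ×ˢ Set.Ioo (0:ℝ) l)) :
    acfD l u r = ∫ s in (0:ℝ)..r, acfSlice l u s := by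
  rw [intervalIntegral.integral_of_le h0.le, integral_Ioc_eq_integral_Ioo]
  exact setIntegral_prod _ hIg

lemma acf_slice_int {r : ℝ} (h0 : 0 < r)
    (hIg : IntegrableOn (acfIntegrand u) (Set.Ioo (0:ℝ) r ×ˢ Set.Ioo (0:ℝ) l)) :
    IntervalIntegrable (acfSlice l u) volume 0 r := by
  rw [intervalIntegrable_iff_integrableOn_Ioo_of_le h0.le]
  exact (acf_int_prod hIg).integral_prod_left

lemma acf_slice_ae {r : ℝ}
    (hIg : IntegrableOn (acfIntegrand u) (Set.Ioo (0:ℝ) r ×ˢ Set.Ioo (0:ℝ) l)) :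
    ∀ᵐ s, s ∈ Ioc 0 r → IntegrableOn (fun θ => acfIntegrand u (s, θ)) (Ioo 0 l) := by
  rw [← ae_restrict_iff' measurableSet_Ioc, ← restrict_Ioo_eq_restrict_Ioc]
  exact (acf_int_prod hIg).prod_right_ae

lemma acfD_nonneg (l : ℝ) (u : ℝ → ℝ → ℝ) (r : ℝ) : 0 ≤ acfD l u r :=
  integral_nonneg fun _ => acfIntegrand_nonneg _ _

lemma acfSlice_nonneg (l : ℝ) (u : ℝ → ℝ → ℝ) (r : ℝ) : 0 ≤ acfSlice l u r :=
  integral_nonneg fun _ => acfIntegrand_nonneg _ _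

lemma acfD_mono {r s : ℝ} (hrs : r ≤ s)
    (hIg : IntegrableOn (acfIntegrand u) (Set.Ioo (0:ℝ) s ×ˢ Set.Ioo (0:ℝ) l)) :
    acfD l u r ≤ acfD l u s := by
  apply setIntegral_mono_set hIg
  · exact Filter.Eventually.of_forall fun p => acfIntegrand_nonneg _ _
  · exact Filter.Eventually.of_forall (prod_mono (Ioo_subset_Ioo le_rfl hrs) le_rfl)

/-- Pointwise differential inequality. -/
lemma acf_point (hl0 : 0 < l) {up um : ℝ → ℝ → ℝ} (hup : ACFPhase l up) (hum : ACFPhase l um)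
    (hdisj : ∀ r ∈ Set.Ico (0:ℝ) 1, ∀ θ : ℝ, up r θ * um r θ = 0)
    {α : ℝ} (hα : α ≤ 4 * Real.pi / l) {r : ℝ} (h0 : 0 < r) (h1 : r < 1)
    (hintp : IntegrableOn (acfIntegrand up) (Set.Ioo (0:ℝ) r ×ˢ Set.Ioo (0:ℝ) l))
    (hintm : IntegrableOn (acfIntegrand um) (Set.Ioo (0:ℝ) r ×ˢ Set.Ioo (0:ℝ) l))
    (hsp : IntegrableOn (fun θ => acfIntegrand up (r, θ)) (Ioo 0 l))
    (hsm : IntegrableOn (fun θ => acfIntegrand um (r, θ)) (Ioo 0 l))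
    (hDp : 0 < acfD l up r) (hDm : 0 < acfD l um r) :
    2 * α / r * (acfD l up r * acfD l um r) ≤
      acfSlice l up r * acfD l um r + acfD l up r * acfSlice l um r := by
  have hr : r ∈ Ico (0:ℝ) 1 := ⟨h0.le, h1⟩
  have ep : ∃ θ, up r θ ≠ 0 := by
    by_contra hc
    push Not at hc
    exact absurd (acf_D_zero hl0 hup h0 h1 hintp hc) (not_le.2 hDp)
  have em : ∃ θ, um r θ ≠ 0 := by
    by_contra hc
    push Not at hc
    exact absurd (acf_D_zero hl0 hum h0 h1 hintm hc) (not_le.2 hDm)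
  obtain ⟨θ₁, hθ₁⟩ := ep
  obtain ⟨θ₂, hθ₂⟩ := em
  have z1 : um r θ₁ = 0 := (mul_eq_zero.1 (hdisj r hr θ₁)).resolve_left hθ₁
  have z2 : up r θ₂ = 0 := (mul_eq_zero.1 (hdisj r hr θ₂)).resolve_right hθ₂
  have sp := acf_slice hl0 hup h0 h1 hintp hsp θ₂ z2
  have sm := acf_slice hl0 hum h0 h1 hintm hsm θ₁ z1
  have hω : acfOm l up r + acfOm l um r ≤ l := by
    have ip := wirt_ind_int _ (acf_circ_cont hup h0 h1) 0 l
    have im := wirt_ind_int _ (acf_circ_cont hum h0 h1) 0 l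
    unfold acfOm
    rw [← intervalIntegral.integral_add ip im]
    have : ∫ θ in (0:ℝ)..l, ((if 0 < up r θ then (1:ℝ) else 0) + if 0 < um r θ then (1:ℝ) else 0) ≤
        ∫ θ in (0:ℝ)..l, (1:ℝ) := by
      apply intervalIntegral.integral_mono_on hl0.le (ip.add im) (by simp)
      intro θ _
      have hd := hdisj r hr θ
      split_ifs with ha hb
      · exact absurd hd (mul_pos ha hb).ne'
      all_goals norm_num
    simpa using this
  have op := acfOm_nonneg hl0 up r
  have om := acfOm_nonneg hl0 um r
  have fp := acfSlice_nonneg l up r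
  have fm := acfSlice_nonneg l um r
  generalize acfD l up r = P at *
  generalize acfD l um r = M at *
  generalize acfSlice l up r = F at *
  generalize acfSlice l um r = G at *
  generalize acfOm l up r = a at *
  generalize acfOm l um r = b at *
  have hpi := Real.pi_pos
  have ha : 0 < a := by
    rcases op.eq_or_lt with h | h
    · rw [← h, zero_mul] at sp
      have : 0 < 2 * Real.pi * P := by positivity
      linarith
    · exact h
  have hb : 0 < b := by
    rcases om.eq_or_lt with h | h
    · rw [← h, zero_mul] at sm
      have : 0 < 2 * Real.pi * M := by positivity
      linarith
    · exact h
  have s1 : 2 * Real.pi * P / (a * r) ≤ F := by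
    rw [div_le_iff₀ (by positivity)]; linarith
  have s2 : 2 * Real.pi * M / (b * r) ≤ G := by
    rw [div_le_iff₀ (by positivity)]; linarith
  have hl4 : 4 / l ≤ 1 / a + 1 / b := by
    rw [div_add_div _ _ ha.ne' hb.ne', div_le_div_iff₀ hl0 (by positivity)]
    nlinarith [sq_nonneg (a - b), mul_nonneg (add_pos ha hb).le (sub_nonneg.2 hω)]
  calc 2 * α / r * (P * M) ≤ 2 * (4 * Real.pi / l) / r * (P * M) := by gcongr
    _ = 2 * Real.pi / r * (P * M) * (4 / l) := by ring
    _ ≤ 2 * Real.pi / r * (P * M) * (1 / a + 1 / b) := by gcongr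
    _ = 2 * Real.pi * P / (a * r) * M + P * (2 * Real.pi * M / (b * r)) := by
      field_simp
    _ ≤ F * M + P * G := by gcongr

end final

/-- Alt–Caffarelli–Friedman monotonicity formula on a cone of length `l ≤ 2π`:
for a disjoint pair of nonnegative continuous functions, each harmonic on its own
positivity set, and `α ∈ (0, 4π/l]`, the quantity `Φ(r) = r^{−2α} D₊(r) D₋(r)` is
nondecreasing on `(0,1)`, where `D_±(r) = ∫₀^r ∫₀^l |Du_±|² s dθ ds`. -/
theorem acf_monotonicity (l : ℝ) (hl0 : 0 < l) (hl : l ≤ 2 * Real.pi)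
    (up um : ℝ → ℝ → ℝ) (hup : ACFPhase l up) (hum : ACFPhase l um)
    (hdisj : ∀ r ∈ Set.Ico (0:ℝ) 1, ∀ θ : ℝ, up r θ * um r θ = 0)
    (α : ℝ) (hα : α ∈ Set.Ioc (0:ℝ) (4 * Real.pi / l))
    (hintp : ∀ r ∈ Set.Ioo (0:ℝ) 1,
      IntegrableOn (acfIntegrand up) (Set.Ioo (0:ℝ) r ×ˢ Set.Ioo (0:ℝ) l))
    (hintm : ∀ r ∈ Set.Ioo (0:ℝ) 1,
      IntegrableOn (acfIntegrand um) (Set.Ioo (0:ℝ) r ×ˢ Set.Ioo (0:ℝ) l)) :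
    ∀ r₁ ∈ Set.Ioo (0:ℝ) 1, ∀ r₂ ∈ Set.Ioo (0:ℝ) 1, r₁ ≤ r₂ →
      r₁ ^ (-(2 * α)) *
          (∫ p in Set.Ioo (0:ℝ) r₁ ×ˢ Set.Ioo (0:ℝ) l, acfIntegrand up p) *
          (∫ p in Set.Ioo (0:ℝ) r₁ ×ˢ Set.Ioo (0:ℝ) l, acfIntegrand um p)
        ≤ r₂ ^ (-(2 * α)) *
          (∫ p in Set.Ioo (0:ℝ) r₂ ×ˢ Set.Ioo (0:ℝ) l, acfIntegrand up p) *
          (∫ p in Set.Ioo (0:ℝ) r₂ ×ˢ Set.Ioo (0:ℝ) l, acfIntegrand um p) := by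
  intro r₁ hr₁ r₂ hr₂ h12
  change r₁ ^ (-(2 * α)) * acfD l up r₁ * acfD l um r₁ ≤
    r₂ ^ (-(2 * α)) * acfD l up r₂ * acfD l um r₂
  rw [mul_assoc, mul_assoc]
  have hR : 0 ≤ r₂ ^ (-(2 * α)) * (acfD l up r₂ * acfD l um r₂) :=
    mul_nonneg (Real.rpow_nonneg hr₂.1.le _) (mul_nonneg (acfD_nonneg _ _ _) (acfD_nonneg _ _ _))
  rcases (acfD_nonneg l up r₁).eq_or_lt with hp | hp
  · rw [← hp]; simpa using hR
  rcases (acfD_nonneg l um r₁).eq_or_lt with hm | hm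
  · rw [← hm]; simpa using hR
  have key := acf_gron (acfSlice l up) (acfSlice l um) r₁ r₂ (2 * α) hr₁.1 h12
    (by linarith [hα.1]) (acf_slice_int hr₂.1 (hintp r₂ hr₂)) (acf_slice_int hr₂.1 (hintm r₂ hr₂)) (by
      filter_upwards [acf_slice_ae (hintp r₂ hr₂), acf_slice_ae (hintm r₂ hr₂)] with x hx1 hx2 hx
      have hx0 : 0 < x := hr₁.1.trans hx.1
      have hx3 : x ∈ Ioo (0:ℝ) 1 := ⟨hx0, hx.2.trans_lt hr₂.2⟩
      rw [← acf_D_eq hx0 (hintp x hx3), ← acf_D_eq hx0 (hintm x hx3)]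
      exact acf_point hl0 hup hum hdisj hα.2 hx0 hx3.2 (hintp x hx3) (hintm x hx3)
        (hx1 ⟨hx0, hx.2⟩) (hx2 ⟨hx0, hx.2⟩) (hp.trans_le (acfD_mono hx.1.le (hintp x hx3)))
        (hm.trans_le (acfD_mono hx.1.le (hintm x hx3))))
  rwa [← acf_D_eq hr₁.1 (hintp r₁ hr₁), ← acf_D_eq hr₁.1 (hintm r₁ hr₁),
    ← acf_D_eq hr₂.1 (hintp r₂ hr₂), ← acf_D_eq hr₂.1 (hintm r₂ hr₂)] at key
end
end
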